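/- arXiv:2509.13153 — 4 statements merged into one kernel-verified Lean document; each statement's English description precedes it below -/
import Mathlib

section
/- Let K be an imaginary bicyclic biquadratic field with quadratic subfields K₁, K₂, K₃. Then h_K ≥ (h_{K₁}·h_{K₂}·h_{K₃})/2, where h denotes class number. -/
section

open Filter Topology IsDedekindDomain NumberField
open scoped nonZeroDivisors

theorem hasSum_finsupp_support_subset_prod_pow {ι : Type*} [DecidableEq ι] {x : ι → ℝ} (h0 : ∀ i, 0 ≤ x i)
    (h1 : ∀ i, x i < 1) (S : Finset ι) :
    HasSum (fun n : {n : ι →₀ ℕ // n.support ⊆ S} ↦ n.1.prod fun i k ↦ x i ^ k)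
      (∏ i ∈ S, (1 - x i)⁻¹) := by
  induction S using Finset.induction_on with
  | empty =>
    have : Unique {n : ι →₀ ℕ // n.support ⊆ ∅} :=
      { default := ⟨0, by simp⟩
        uniq := fun n ↦ Subtype.ext (by simpa using n.2) }
    convert! hasSum_unique _
    rw [show (default : {n : ι →₀ ℕ // n.support ⊆ ∅}) = ⟨0, by simp⟩ from Subsingleton.elim _ _]
    simp
  | insert a S ha ih =>
    rw [Finset.prod_insert ha]
    let e : ℕ × {n : ι →₀ ℕ // n.support ⊆ S} ≃ {n : ι →₀ ℕ // n.support ⊆ insert a S} :=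
      { toFun := fun p ↦ ⟨Finsupp.single a p.1 + p.2.1, by
          refine Finsupp.support_add.trans (Finset.union_subset ?_ ?_)
          · exact Finsupp.support_single_subset.trans (by simp)
          · exact p.2.2.trans (Finset.subset_insert _ _)⟩
        invFun := fun n ↦ ⟨n.1 a, n.1.erase a, by
          rw [Finsupp.support_erase]
          exact Finset.subset_insert_iff.1 n.2⟩
        left_inv := fun ⟨k, n, hn⟩ ↦ by
          have hna : n a = 0 := Finsupp.notMem_support_iff.1 fun h ↦ ha (hn h)
          ext1
          · simp [hna]
          · ext i
            by_cases hi : i = a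
            · simp [hi, hna]
            · simp [Finsupp.erase_ne hi]
        right_inv := fun n ↦ Subtype.ext (Finsupp.single_add_erase a n.1) }
    rw [← e.hasSum_iff]
    have hg := hasSum_geometric_of_lt_one (h0 a) (h1 a)
    have hs : Summable fun p : ℕ × {n : ι →₀ ℕ // n.support ⊆ S} ↦
        x a ^ p.1 * (p.2.1.prod fun i k ↦ x i ^ k) :=
      hg.summable.mul_of_nonneg ih.summable (fun k ↦ pow_nonneg (h0 a) k)
        (fun n ↦ Finset.prod_nonneg fun i _ ↦ pow_nonneg (h0 i) _)
    convert! hg.mul ih hs using 2 with p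
    have hna : p.2.1 a = 0 := Finsupp.notMem_support_iff.1 fun h ↦ ha (p.2.2 h)
    change Finsupp.prod (Finsupp.single a p.1 + p.2.1) _ = _
    rw [Finsupp.prod_add_index' (by simp) (by simp [pow_add]), Finsupp.prod_single_index (by simp)]

theorem hasProd_one_sub_inv_of_hasSum_finsupp {ι : Type*} {x : ι → ℝ} (h0 : ∀ i, 0 ≤ x i)
    (h1 : ∀ i, x i < 1) {Z : ℝ} (h : HasSum (fun n : ι →₀ ℕ ↦ n.prod fun i k ↦ x i ^ k) Z) :
    HasProd (fun i ↦ (1 - x i)⁻¹) Z := by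
  classical
  have hF (n : ι →₀ ℕ) : 0 ≤ n.prod fun i k ↦ x i ^ k :=
    Finset.prod_nonneg fun i _ ↦ pow_nonneg (h0 i) _
  rw [← h.tsum_eq]
  have (S : Finset ι) : ∏ i ∈ S, (1 - x i)⁻¹ =
      ∑' n, {n : ι →₀ ℕ | n.support ⊆ S}.indicator (fun n ↦ n.prod fun i k ↦ x i ^ k) n := by
    rw [← (hasSum_finsupp_support_subset_prod_pow h0 h1 S).tsum_eq, ← tsum_subtype]
    rfl
  simp only [HasProd, this, SummationFilter.unconditional_filter]
  refine tendsto_tsum_of_dominated_convergence h.summable (fun n ↦ ?_) (Eventually.of_forall fun S n ↦ ?_)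
  · refine tendsto_const_nhds.congr' ?_
    filter_upwards [eventually_ge_atTop n.support] with S hS
    rw [Set.indicator_of_mem]
    exact hS
  · rw [Real.norm_of_nonneg (Set.indicator_nonneg (fun n _ ↦ hF n) n)]
    exact Set.indicator_le_self' (fun n _ ↦ hF n) n

theorem bijective_finsupp_heightOneSpectrum_prod_pow (R : Type*) [CommRing R] [IsDedekindDomain R] :
    Function.Bijective fun n : HeightOneSpectrum R →₀ ℕ ↦
      (⟨n.prod fun P k ↦ P.asIdeal ^ k, Finset.prod_ne_zero_iff.2 fun P _ ↦ pow_ne_zero _ P.ne_bot⟩ :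
        {I : Ideal R // I ≠ 0}) := by
  classical
  constructor
  · intro m n h
    have key (n : HeightOneSpectrum R →₀ ℕ) :
        factorization (n.prod fun P k ↦ P.asIdeal ^ k) = n.mapDomain HeightOneSpectrum.asIdeal := by
      induction n using Finsupp.induction with
      | zero => rw [Finsupp.prod_zero_index, factorization_one, Finsupp.mapDomain_zero]
      | single_add P k n hP hk ih =>
        rw [Finsupp.prod_add_index' (by simp) (by simp [pow_add]),
          Finsupp.prod_single_index (by simp), factorization_mul (pow_ne_zero _ P.ne_bot)
          (by exact Finset.prod_ne_zero_iff.2 fun Q _ ↦ pow_ne_zero _ Q.ne_bot), ih, factorization_pow,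
          Finsupp.mapDomain_add, Finsupp.mapDomain_single]
        congr 1
        rw [factorization, UniqueFactorizationMonoid.normalizedFactors_irreducible P.irreducible]
        simp
    have h' := congrArg (fun I ↦ factorization I.1) h
    simp only [key] at h'
    exact Finsupp.mapDomain_injective (fun P Q h ↦ HeightOneSpectrum.ext h) h'
  · rintro ⟨I, hI⟩
    suffices ∃ n : HeightOneSpectrum R →₀ ℕ, (n.prod fun P k ↦ P.asIdeal ^ k) = I from
      this.imp fun n hn ↦ Subtype.ext hn
    induction I using UniqueFactorizationMonoid.induction_on_prime with
    | h₁ => exact absurd rfl hI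
    | h₂ I hu => exact ⟨0, by rw [Finsupp.prod_zero_index, Ideal.isUnit_iff.1 hu, Ideal.one_eq_top]⟩
    | h₃ I P hI' hP ih =>
      obtain ⟨n, rfl⟩ := ih hI'
      let Q : HeightOneSpectrum R := ⟨P, Ideal.isPrime_of_prime hP, hP.ne_zero⟩
      exact ⟨Finsupp.single Q 1 + n, by
        rw [Finsupp.prod_add_index' (by simp) (by simp [pow_add]),
          Finsupp.prod_single_index (by simp), pow_one]⟩

theorem hasSum_absNorm_rpow_of_LSeriesSummable (F : Type*) [Field F] [NumberField F] {s : ℝ}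
    (hs : LSeriesSummable (fun n ↦ (Nat.card {I : Ideal (𝓞 F) // I.absNorm = n} : ℂ)) s) :
    ∃ Z : ℝ, dedekindZeta F s = Z ∧
      HasSum (fun I : {I : Ideal (𝓞 F) // I ≠ 0} ↦ (I.1.absNorm : ℝ) ^ (-s)) Z := by
  let e := Equiv.sigmaFiberEquiv fun I : {I : Ideal (𝓞 F) // I ≠ 0} ↦ I.1.absNorm
  let t : ℕ → ℝ := fun n ↦ if n = 0 then 0 else Nat.card {I : Ideal (𝓞 F) // I.absNorm = n} * (n : ℝ) ^ (-s)
  have ht : LSeries.term (fun n ↦ (Nat.card {I : Ideal (𝓞 F) // I.absNorm = n} : ℂ)) s =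
      fun n ↦ ((t n : ℝ) : ℂ) := by
    ext n
    rcases eq_or_ne n 0 with rfl | hn
    · simp [t]
    · rw [LSeries.term_of_ne_zero hn]
      simp only [t, hn, if_false]
      push_cast
      rw [Complex.ofReal_cpow (by positivity), div_eq_mul_inv]
      push_cast
      rw [Complex.cpow_neg]
  have hts : Summable t := by
    rw [LSeriesSummable, ht] at hs
    exact_mod_cast hs
  refine ⟨∑' n, t n, ?_, ?_⟩
  · rw [dedekindZeta, LSeries, ht]
    push_cast
    rfl
  have hfib (n : ℕ) : HasSum (fun I : {I : {I : Ideal (𝓞 F) // I ≠ 0} // I.1.absNorm = n} ↦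
      (I.1.1.absNorm : ℝ) ^ (-s)) (t n) := by
    rcases eq_or_ne n 0 with rfl | hn
    · have : IsEmpty {I : {I : Ideal (𝓞 F) // I ≠ 0} // I.1.absNorm = 0} :=
        ⟨fun I ↦ I.1.2 (Ideal.absNorm_eq_zero_iff.1 I.2)⟩
      simp [t]
    · let e' : {I : {I : Ideal (𝓞 F) // I ≠ 0} // I.1.absNorm = n} ≃ {I : Ideal (𝓞 F) // I.absNorm = n} :=
        { toFun := fun I ↦ ⟨I.1.1, I.2⟩
          invFun := fun I ↦ ⟨⟨I.1, fun h ↦ hn (by rw [← I.2, h]; simp)⟩, I.2⟩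
          left_inv := fun _ ↦ rfl
          right_inv := fun _ ↦ rfl }
      have : Finite {I : Ideal (𝓞 F) // I.absNorm = n} := Ideal.finite_setOfPred_absNorm_eq n
      have := Finite.of_equiv _ e'.symm
      have := Fintype.ofFinite {I : {I : Ideal (𝓞 F) // I ≠ 0} // I.1.absNorm = n}
      have key : t n = ∑ I : {I : {I : Ideal (𝓞 F) // I ≠ 0} // I.1.absNorm = n},
          (I.1.1.absNorm : ℝ) ^ (-s) := by
        simp only [t, hn, if_false]
        rw [Finset.sum_congr rfl fun I _ ↦ by rw [I.2], ← Nat.card_congr e']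
        simp
      rw [key]
      exact hasSum_fintype _
  rw [← e.hasSum_iff]
  have hnn (p) : 0 ≤ ((fun I : {I : Ideal (𝓞 F) // I ≠ 0} ↦ (I.1.absNorm : ℝ) ^ (-s)) ∘ e) p := by
    simp only [Function.comp]; positivity
  have hsum : Summable ((fun I : {I : Ideal (𝓞 F) // I ≠ 0} ↦ (I.1.absNorm : ℝ) ^ (-s)) ∘ e) := by
    rw [summable_sigma_of_nonneg hnn]
    exact ⟨fun n ↦ (hfib n).summable, hts.congr fun n ↦ (hfib n).tsum_eq.symm⟩
  have h2 := hsum.hasSum.sigma fun n ↦ hfib n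
  rw [h2.tsum_eq]
  exact hsum.hasSum

theorem hasProd_heightOneSpectrum_of_hasSum_absNorm_rpow (F : Type*) [Field F] [NumberField F] {s Z : ℝ}
    (hs : 0 < s) (h : HasSum (fun I : {I : Ideal (𝓞 F) // I ≠ 0} ↦ (I.1.absNorm : ℝ) ^ (-s)) Z) :
    HasProd (fun P : HeightOneSpectrum (𝓞 F) ↦ (1 - (P.asIdeal.absNorm : ℝ) ^ (-s))⁻¹) Z := by
  refine hasProd_one_sub_inv_of_hasSum_finsupp (fun P ↦ by positivity) (fun P ↦ ?_) ?_
  · refine Real.rpow_lt_one_of_one_lt_of_neg ?_ (by linarith)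
    have h0 : P.asIdeal.absNorm ≠ 0 := by
      rw [Ne, Ideal.absNorm_eq_zero_iff]; exact P.ne_bot
    have h1 : P.asIdeal.absNorm ≠ 1 := by
      rw [Ne, Ideal.absNorm_eq_one_iff]; exact P.isPrime.ne_top
    exact_mod_cast (by omega : 1 < P.asIdeal.absNorm)
  · rw [← (Equiv.ofBijective _ (bijective_finsupp_heightOneSpectrum_prod_pow (𝓞 F))).hasSum_iff] at h
    convert! h using 2 with n
    simp only [Function.comp, Equiv.ofBijective_apply, Finsupp.prod, map_prod, map_pow, Nat.cast_prod,
      Nat.cast_pow]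
    rw [← Real.finsetProd_rpow _ _ (fun i _ ↦ by positivity)]
    refine Finset.prod_congr rfl fun P _ ↦ ?_
    rw [← Real.rpow_natCast, ← Real.rpow_natCast, ← Real.rpow_mul (by positivity), mul_comm, Real.rpow_mul (by positivity)]

noncomputable def sigmaPrimesOverEquiv (F : Type*) [Field F] [NumberField F] :
    (Σ p : Nat.Primes, Ideal.primesOver (Ideal.span {(p : ℤ)}) (𝓞 F)) ≃ HeightOneSpectrum (𝓞 F) :=
  Equiv.ofBijective (fun x ↦ ⟨x.2.1, x.2.2.1, by
    have := x.2.2.2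
    have hp : (Ideal.span {((x.1 : ℕ) : ℤ)}) ≠ ⊥ := by
      simpa using x.1.2.ne_zero
    exact Ideal.ne_bot_of_liesOver_of_ne_bot hp _⟩) (by
  constructor
  · rintro ⟨p, P, hP, hPp⟩ ⟨q, Q, hQ, hQq⟩ h
    simp only [HeightOneSpectrum.mk.injEq] at h
    subst h
    have : p = q := by
      have := (hPp.over).trans hQq.over.symm
      rw [Ideal.span_singleton_eq_span_singleton, Int.associated_iff_natAbs] at this
      exact Subtype.ext (by simpa using this)
    subst this
    rfl
  · intro P
    have := P.isPrime
    have : NeZero P.asIdeal := ⟨P.ne_bot⟩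
    exact ⟨⟨⟨_, Nat.absNorm_under_prime P.asIdeal⟩, P.asIdeal, P.isPrime,
      Int.liesOver_span_absNorm P.asIdeal⟩, rfl⟩)

theorem hasProd_primes_of_hasSum_absNorm_rpow (F : Type*) [Field F] [NumberField F] [IsGalois ℚ F]
    {s Z : ℝ} (hs : 0 < s)
    (h : HasSum (fun I : {I : Ideal (𝓞 F) // I ≠ 0} ↦ (I.1.absNorm : ℝ) ^ (-s)) Z) :
    HasProd (fun p : Nat.Primes ↦
      ((1 - ((p : ℝ) ^ (-s)) ^ Ideal.inertiaDegIn (Ideal.span {(p : ℤ)}) (𝓞 F))⁻¹) ^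
        (Ideal.primesOver (Ideal.span {(p : ℤ)}) (𝓞 F)).ncard) Z := by
  have h1 := hasProd_heightOneSpectrum_of_hasSum_absNorm_rpow F hs h
  rw [← (sigmaPrimesOverEquiv F).hasProd_iff] at h1
  refine h1.sigma fun p ↦ ?_
  have : (Ideal.span {((p : ℕ) : ℤ)}).IsPrime := by
    rw [Ideal.span_singleton_prime (by simpa using p.2.ne_zero)]
    exact Nat.prime_iff_prime_int.1 p.2
  have : Fintype (Ideal.primesOver (Ideal.span {(p : ℤ)}) (𝓞 F)) :=
    (Algebra.QuasiFinite.finite_primesOver _).fintype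
  convert! hasProd_fintype _ using 1
  rw [← Set.fintypeCard_eq_ncard, Finset.prod_congr rfl (g := fun _ ↦
    (1 - ((p : ℝ) ^ (-s)) ^ Ideal.inertiaDegIn (Ideal.span {(p : ℤ)}) (𝓞 F))⁻¹), Finset.prod_const,
    Finset.card_univ]
  rintro ⟨P, hP, hPp⟩ -
  change (1 - (P.absNorm : ℝ) ^ (-s))⁻¹ = _
  rw [← Ideal.natAbs_pow_inertiaDeg p P, Ideal.inertiaDegIn_eq_inertiaDeg _ P Gal(F/ℚ)]
  simp only [Int.natAbs_natCast, Nat.cast_pow]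
  rw [← Real.rpow_natCast, ← Real.rpow_natCast, ← Real.rpow_mul (by positivity), mul_comm, Real.rpow_mul (by positivity)]

theorem eventually_hasProd_dedekindZeta (F : Type*) [Field F] [NumberField F] [IsGalois ℚ F] :
    ∀ᶠ s : ℝ in 𝓝[>] 1, HasProd (fun p : Nat.Primes ↦
      ((1 - ((p : ℂ) ^ (-s : ℂ)) ^ Ideal.inertiaDegIn (Ideal.span {(p : ℤ)}) (𝓞 F))⁻¹) ^
        (Ideal.primesOver (Ideal.span {(p : ℤ)}) (𝓞 F)).ncard) (dedekindZeta F s) := by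
  have hne : ((dedekindZeta_residue F : ℝ) : ℂ) ≠ 0 := by
    exact_mod_cast dedekindZeta_residue_ne_zero F
  have := (tendsto_sub_one_mul_dedekindZeta_nhdsGT F).eventually_ne hne
  filter_upwards [this, self_mem_nhdsWithin] with s hs hs1
  have hsum : LSeriesSummable (fun n ↦ (Nat.card {I : Ideal (𝓞 F) // I.absNorm = n} : ℂ)) s := by
    by_contra h
    refine hs ?_
    rw [dedekindZeta, LSeries, tsum_eq_zero_of_not_summable h, mul_zero]
  obtain ⟨Z, hZ, hZs⟩ := hasSum_absNorm_rpow_of_LSeriesSummable F hsum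
  rw [Set.mem_Ioi] at hs1
  have h2 := (hasProd_primes_of_hasSum_absNorm_rpow F (by linarith) hZs).map Complex.ofRealHom
    Complex.continuous_ofReal
  rw [hZ]
  convert! h2 using 2 with p
  simp only [Function.comp, Complex.ofRealHom_eq_coe]
  push_cast
  rw [Complex.ofReal_cpow (by positivity)]
  push_cast
  rfl

theorem dedekindZeta_residue_eq_mul_mul_of_forall_prime
    (K K₁ K₂ K₃ : Type*) [Field K] [NumberField K] [IsGalois ℚ K] [Field K₁] [NumberField K₁]
    [IsGalois ℚ K₁] [Field K₂] [NumberField K₂] [IsGalois ℚ K₂] [Field K₃] [NumberField K₃]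
    [IsGalois ℚ K₃]
    (h : ∀ (p : ℕ), p.Prime → ∀ x : ℂ,
      (1 - x ^ Ideal.inertiaDegIn (Ideal.span {(p : ℤ)}) (𝓞 K)) ^
        (Ideal.primesOver (Ideal.span {(p : ℤ)}) (𝓞 K)).ncard * (1 - x) ^ 2 =
      (1 - x ^ Ideal.inertiaDegIn (Ideal.span {(p : ℤ)}) (𝓞 K₁)) ^
        (Ideal.primesOver (Ideal.span {(p : ℤ)}) (𝓞 K₁)).ncard *
      (1 - x ^ Ideal.inertiaDegIn (Ideal.span {(p : ℤ)}) (𝓞 K₂)) ^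
        (Ideal.primesOver (Ideal.span {(p : ℤ)}) (𝓞 K₂)).ncard *
      (1 - x ^ Ideal.inertiaDegIn (Ideal.span {(p : ℤ)}) (𝓞 K₃)) ^
        (Ideal.primesOver (Ideal.span {(p : ℤ)}) (𝓞 K₃)).ncard) :
    dedekindZeta_residue K =
      dedekindZeta_residue K₁ * dedekindZeta_residue K₂ * dedekindZeta_residue K₃ := by
  have hζ : Tendsto (fun s : ℝ ↦ (s - 1 : ℂ) * riemannZeta s) (𝓝[>] 1) (𝓝 1) := by
    refine riemannZeta_residue_one.comp (tendsto_nhdsWithin_iff.2 ⟨?_, ?_⟩)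
    · exact (Complex.continuous_ofReal.tendsto' 1 1 (by simp)).mono_left nhdsWithin_le_nhds
    · filter_upwards [self_mem_nhdsWithin] with s hs
      rw [Set.mem_Ioi] at hs
      simp only [Set.mem_compl_iff, Set.mem_singleton_iff]
      exact_mod_cast hs.ne'
  have hL := (tendsto_sub_one_mul_dedekindZeta_nhdsGT K).mul (hζ.pow 2)
  have hR := ((tendsto_sub_one_mul_dedekindZeta_nhdsGT K₁).mul
    (tendsto_sub_one_mul_dedekindZeta_nhdsGT K₂)).mul (tendsto_sub_one_mul_dedekindZeta_nhdsGT K₃)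
  have : ((dedekindZeta_residue K : ℝ) : ℂ) * 1 ^ 2 =
      dedekindZeta_residue K₁ * dedekindZeta_residue K₂ * dedekindZeta_residue K₃ := by
    refine tendsto_nhds_unique hL (hR.congr' ?_)
    filter_upwards [eventually_hasProd_dedekindZeta K, eventually_hasProd_dedekindZeta K₁,
      eventually_hasProd_dedekindZeta K₂, eventually_hasProd_dedekindZeta K₃,
      self_mem_nhdsWithin] with s h0 h1 h2 h3 hs
    have hz := riemannZeta_eulerProduct_hasProd (s := s) (by simpa using hs)
    have := ((h1.mul h2).mul h3).unique (by
      have h4 := h0.mul (hz.mul hz)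
      refine h4.congr_fun fun p ↦ ?_
      have := congrArg (·⁻¹) (h p p.2 ((p : ℂ) ^ (-s : ℂ)))
      simp only [mul_inv, ← inv_pow] at this
      simp only [inv_pow] at this ⊢
      rw [← this, sq, mul_inv])
    linear_combination (s - 1 : ℂ) ^ 3 * this
  rw [one_pow, mul_one] at this
  exact_mod_cast this

end

section

open NumberField
open scoped Pointwise

open scoped Classical in
theorem natCard_subgroup_of_natCard_eq_two {G : Type*} [Group G] (hG : Nat.card G = 2) {τ : G} (hτ : τ ≠ 1)
    (H : Subgroup G) : Nat.card H = 1 + if τ ∈ H then 1 else 0 := by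
  have : Finite G := Nat.finite_of_card_ne_zero (by omega)
  let := Fintype.ofFinite G
  have hu : ({1, τ} : Finset G) = Finset.univ := by
    refine Finset.eq_univ_of_card _ ?_
    rw [Finset.card_pair hτ.symm, ← Nat.card_eq_fintype_card, hG]
  have hall (g : G) : g = 1 ∨ g = τ := by
    have : g ∈ ({1, τ} : Finset G) := by rw [hu]; exact Finset.mem_univ g
    simpa using this
  split_ifs with h
  · have : H = ⊤ := by
      ext g
      rcases hall g with rfl | rfl <;> simp [h, H.one_mem]
    rw [this, Subgroup.card_top, hG]
  · have : H = ⊥ := by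
      ext g
      rcases hall g with rfl | rfl <;> simp [h, H.one_mem, hτ]
    rw [this]; simp

open scoped Classical in
theorem natCard_subgroup_of_natCard_eq_four {G : Type*} [Group G] (hG : Nat.card G = 4) {σ₁ σ₂ σ₃ : G}
    (h₁ : σ₁ ≠ 1) (h₂ : σ₂ ≠ 1) (h₃ : σ₃ ≠ 1) (h₁₂ : σ₁ ≠ σ₂) (h₁₃ : σ₁ ≠ σ₃) (h₂₃ : σ₂ ≠ σ₃)
    (H : Subgroup G) : Nat.card H = 1 + (if σ₁ ∈ H then 1 else 0) + (if σ₂ ∈ H then 1 else 0) +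
      (if σ₃ ∈ H then 1 else 0) := by
  have : Finite G := Nat.finite_of_card_ne_zero (by omega)
  let := Fintype.ofFinite G
  have hu : ({1, σ₁, σ₂, σ₃} : Finset G) = Finset.univ := by
    refine Finset.eq_univ_of_card _ ?_
    rw [← Nat.card_eq_fintype_card, hG]
    have := h₁.symm; have := h₂.symm; have := h₃.symm
    simp [*]
  rw [Nat.card_eq_fintype_card, Fintype.card_subtype, Finset.card_filter, ← hu]
  have := h₁.symm; have := h₂.symm; have := h₃.symm
  rw [Finset.sum_insert (by simp [*]), Finset.sum_insert (by simp [*]), Finset.sum_insert (by simp [*]),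
    Finset.sum_singleton]
  simp [H.one_mem, add_assoc]

theorem finite_quotient_of_liesOver_prime {F : Type*} [Field F] [NumberField F] {p : ℕ} (hp : p.Prime)
    (P : Ideal (𝓞 F)) [P.LiesOver (Ideal.span {(p : ℤ)})] : Finite (𝓞 F ⧸ P) := by
  have hp0 : Ideal.span {(p : ℤ)} ≠ ⊥ := by simpa using hp.ne_zero
  exact Ideal.finiteQuotientOfFreeOfNeBot P (Ideal.ne_bot_of_liesOver_of_ne_bot hp0 P)

theorem finite_residueField_of_liesOver_prime {F : Type*} [Field F] [NumberField F] {p : ℕ} (hp : p.Prime)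
    (P : Ideal (𝓞 F)) [P.IsPrime] [P.LiesOver (Ideal.span {(p : ℤ)})] : Finite P.ResidueField := by
  have := finite_quotient_of_liesOver_prime hp P
  infer_instance

theorem isPrime_span_natCast {p : ℕ} (hp : p.Prime) : (Ideal.span {(p : ℤ)}).IsPrime := by
  rw [Ideal.span_singleton_prime (by simpa using hp.ne_zero)]
  exact Nat.prime_iff_prime_int.1 hp

theorem perfectField_residueField_span {p : ℕ} (hp : p.Prime) [(Ideal.span {(p : ℤ)}).IsPrime] :
    PerfectField (Ideal.span {(p : ℤ)}).ResidueField := by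
  have : Finite (ℤ ⧸ Ideal.span {(p : ℤ)}) := by
    apply Nat.finite_of_card_ne_zero
    rw [Int.card_ideal_quot]
    exact hp.ne_zero
  infer_instance

theorem natCard_le_of_forall_pow_eq_self {k : Type*} [Field k] [Finite k] {n : ℕ} (hn : 1 < n)
    (h : ∀ x : k, x ^ n = x) : Nat.card k ≤ n := by
  let := Fintype.ofFinite k
  rw [Nat.card_eq_fintype_card, ← Finset.card_univ, ← FiniteField.X_pow_card_sub_X_natDegree_eq k hn]
  refine Polynomial.card_le_degree_of_subset_roots (Z := Finset.univ) fun x _ ↦ ?_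
  rw [Polynomial.mem_roots (FiniteField.X_pow_card_sub_X_ne_zero _ hn)]
  simp [h]

theorem inertiaDeg_le_of_forall_pow_eq_one {K : Type*} [Field K] [NumberField K] [IsGalois ℚ K]
    {n : ℕ} (hn : n ≠ 0) (hexp : ∀ σ : Gal(K/ℚ), σ ^ n = 1) {p : ℕ} (hp : p.Prime) (P : Ideal (𝓞 K)) [P.IsPrime]
    [P.LiesOver (Ideal.span {(p : ℤ)})] : P.inertiaDeg ℤ ≤ n := by
  have hfin := finite_quotient_of_liesOver_prime hp P
  have hu : Nat.card (ℤ ⧸ P.under ℤ) = p := by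
    rw [← Ideal.over_def P (Ideal.span {(p : ℤ)}), Int.card_ideal_quot]
  obtain ⟨σ, hσ⟩ := IsArithFrobAt.exists_of_isInvariant ℤ Gal(K/ℚ) P
  have h1 (x : 𝓞 K) : Ideal.Quotient.mk P (σ • x) = Ideal.Quotient.mk P x ^ p := by
    have := hσ.mk_apply x
    rwa [hu] at this
  have h2 (k : ℕ) (x : 𝓞 K) : Ideal.Quotient.mk P ((σ ^ k) • x) = Ideal.Quotient.mk P x ^ (p ^ k) := by
    induction k generalizing x with
    | zero => simp
    | succ k ih => rw [pow_succ, mul_smul, ih, h1, ← pow_mul, pow_succ, mul_comm]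
  have h3 (x : 𝓞 K ⧸ P) : x ^ (p ^ n) = x := by
    obtain ⟨x, rfl⟩ := Ideal.Quotient.mk_surjective x
    rw [← h2, hexp, one_smul]
  have hmax : P.IsMaximal := Ideal.Quotient.maximal_of_isField _ (Finite.isField_of_domain (𝓞 K ⧸ P))
  let := Ideal.Quotient.field P
  have hcard := natCard_le_of_forall_pow_eq_self (Nat.one_lt_pow hn hp.one_lt) h3
  rw [← Submodule.cardQuot_apply, ← Ideal.absNorm_apply, ← Ideal.natAbs_pow_inertiaDeg p P] at hcard
  exact (Nat.pow_le_pow_iff_right hp.one_lt).1 (by simpa using hcard)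

open scoped Classical in
theorem exists_mem_inertia_mem_stabilizer_of_finrank_eq_two
    (F K : Type*) [Field F] [NumberField F] [Field K] [NumberField K] [Algebra F K]
    [IsGalois ℚ F] [IsGalois ℚ K] (h2 : Module.finrank F K = 2) :
    ∃ σ : Gal(K/ℚ), σ ≠ 1 ∧ (∀ x : F, σ (algebraMap F K x) = algebraMap F K x) ∧
      ∀ (p : ℕ), p.Prime → ∀ (P : Ideal (𝓞 K)) [P.IsPrime] [P.LiesOver (Ideal.span {(p : ℤ)})],
        (P.under (𝓞 F)).ramificationIdxIn (𝓞 K) = 1 + (if σ ∈ P.inertia Gal(K/ℚ) then 1 else 0) ∧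
        (P.under (𝓞 F)).ramificationIdxIn (𝓞 K) * (P.under (𝓞 F)).inertiaDegIn (𝓞 K) =
          1 + (if σ ∈ MulAction.stabilizer Gal(K/ℚ) P then 1 else 0) ∧
        (Ideal.span {(p : ℤ)}).ramificationIdxIn (𝓞 F) * (P.under (𝓞 F)).ramificationIdxIn (𝓞 K) =
          (Ideal.span {(p : ℤ)}).ramificationIdxIn (𝓞 K) ∧
        (Ideal.span {(p : ℤ)}).inertiaDegIn (𝓞 F) * (P.under (𝓞 F)).inertiaDegIn (𝓞 K) =
          (Ideal.span {(p : ℤ)}).inertiaDegIn (𝓞 K) := by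
  have : IsGalois F K := IsGalois.tower_top_of_isGalois ℚ F K
  have hc : Nat.card Gal(K/F) = 2 := by rw [IsGalois.card_aut_eq_finrank, h2]
  have : Nontrivial Gal(K/F) := by
    rw [← Finite.one_lt_card_iff_nontrivial]; omega
  obtain ⟨τ, hτ⟩ := exists_ne (1 : Gal(K/F))
  refine ⟨τ.restrictScalars ℚ, ?_, fun x ↦ by simp, fun p hp P _ _ ↦ ?_⟩
  · contrapose! hτ
    ext x
    exact DFunLike.congr_fun hτ x
  have := isPrime_span_natCast hp
  have := finite_residueField_of_liesOver_prime hp (P.under (𝓞 F))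
  refine ⟨?_, ?_, ?_, ?_⟩
  · rw [← Ideal.card_inertia_eq_ramificationIdxIn (G := Gal(K/F)) (P.under (𝓞 F)) P,
      natCard_subgroup_of_natCard_eq_two hc hτ]
    congr 2
  · rw [← Ideal.card_stabilizer_eq (G := Gal(K/F)) (P.under (𝓞 F)) P,
      natCard_subgroup_of_natCard_eq_two hc hτ]
    congr 2
  · exact Ideal.ramificationIdxIn_mul_ramificationIdxIn (P.under (𝓞 F)) Gal(F/ℚ) (𝓞 K) Gal(K/ℚ) Gal(K/F)
  · exact Ideal.inertiaDegIn_mul_inertiaDegIn _ (P.under (𝓞 F)) Gal(F/ℚ) (𝓞 K) Gal(K/ℚ) Gal(K/F)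

theorem range_algebraMap_eq_fixedPoints {F K : Type*} [Field F] [NumberField F] [Field K] [NumberField K]
    [Algebra F K] [IsGalois ℚ K] (h2 : Module.finrank F K = 2) {σ : Gal(K/ℚ)} (hσ : σ ≠ 1)
    (h : ∀ x : F, σ (algebraMap F K x) = algebraMap F K x) :
    Set.range (algebraMap F K) = {x | σ x = x} := by
  let S := IntermediateField.fixedField (Subgroup.zpowers σ)
  let R := (IsScalarTower.toAlgHom ℚ F K).fieldRange
  have hS (x : K) : x ∈ S ↔ σ x = x := by
    rw [IntermediateField.mem_fixedField_iff]
    refine ⟨fun h ↦ h σ (Subgroup.mem_zpowers σ), fun h f hf ↦ ?_⟩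
    have : Subgroup.zpowers σ ≤ MulAction.stabilizer Gal(K/ℚ) x := by
      rw [Subgroup.zpowers_le]; exact h
    exact this hf
  have hle : R ≤ S := by
    rintro _ ⟨x, rfl⟩
    exact (hS _).2 (h x)
  have hR : Module.finrank ℚ R = Module.finrank ℚ F :=
    (AlgEquiv.ofInjectiveField (IsScalarTower.toAlgHom ℚ F K)).toLinearEquiv.finrank_eq.symm
  have h1 : Module.finrank ℚ F * 2 = Module.finrank ℚ K := by
    rw [← h2, Module.finrank_mul_finrank]
  have h3 : Module.finrank S K = Nat.card (Subgroup.zpowers σ) := IntermediateField.finrank_fixedField_eq_card _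
  have h4 : 1 < Nat.card (Subgroup.zpowers σ) := by
    rw [Nat.card_zpowers]
    have := orderOf_pos σ
    have : orderOf σ ≠ 1 := by rwa [Ne, orderOf_eq_one_iff]
    omega
  have h5 : Module.finrank ℚ S * Module.finrank S K = Module.finrank ℚ K := Module.finrank_mul_finrank ..
  have hRS : R = S := by
    refine IntermediateField.eq_of_le_of_finrank_le hle ?_
    rw [hR]
    rw [h3] at h5
    nlinarith
  ext x
  have : x ∈ R ↔ x ∈ S := by rw [hRS]
  rw [hS] at this
  exact this

section

variable (K K₁ K₂ K₃ : Type*) [Field K] [NumberField K] [IsGalois ℚ K] [Field K₁] [NumberField K₁]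
    [IsGalois ℚ K₁] [Field K₂] [NumberField K₂] [IsGalois ℚ K₂] [Field K₃] [NumberField K₃]
    [IsGalois ℚ K₃] [Algebra K₁ K] [Algebra K₂ K] [Algebra K₃ K]

theorem finrank_eq_two_of_biquadratic {F K : Type*} [Field F] [NumberField F] [Field K] [NumberField K]
    [Algebra F K] (hK : Module.finrank ℚ K = 4) (hF : Module.finrank ℚ F = 2) : Module.finrank F K = 2 := by
  have := Module.finrank_mul_finrank ℚ F K
  rw [hK, hF] at this
  omega

theorem exists_ramification_data_of_biquadratic
    (hK : Module.finrank ℚ K = 4) (hexp : ∀ σ : Gal(K/ℚ), σ ^ 2 = 1)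
    (h₁ : Module.finrank ℚ K₁ = 2) (h₂ : Module.finrank ℚ K₂ = 2) (h₃ : Module.finrank ℚ K₃ = 2)
    (h₁₂ : Set.range (algebraMap K₁ K) ≠ Set.range (algebraMap K₂ K))
    (h₁₃ : Set.range (algebraMap K₁ K) ≠ Set.range (algebraMap K₃ K))
    (h₂₃ : Set.range (algebraMap K₂ K) ≠ Set.range (algebraMap K₃ K))
    {p : ℕ} (hp : p.Prime) (P : Ideal (𝓞 K)) [P.IsPrime] [P.LiesOver (Ideal.span {(p : ℤ)})] :
    ∃ t₁ t₂ t₃ s₁ s₂ s₃ : ℕ, t₁ ≤ s₁ ∧ t₂ ≤ s₂ ∧ t₃ ≤ s₃ ∧ s₁ ≤ 1 ∧ s₂ ≤ 1 ∧ s₃ ≤ 1 ∧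
      (Ideal.span {(p : ℤ)}).ramificationIdxIn (𝓞 K) = 1 + t₁ + t₂ + t₃ ∧
      (Ideal.span {(p : ℤ)}).ramificationIdxIn (𝓞 K) * (Ideal.span {(p : ℤ)}).inertiaDegIn (𝓞 K) =
        1 + s₁ + s₂ + s₃ ∧
      (Ideal.span {(p : ℤ)}).inertiaDegIn (𝓞 K) ≤ 2 ∧
      (P.under (𝓞 K₁)).ramificationIdxIn (𝓞 K) = 1 + t₁ ∧
      (P.under (𝓞 K₂)).ramificationIdxIn (𝓞 K) = 1 + t₂ ∧
      (P.under (𝓞 K₃)).ramificationIdxIn (𝓞 K) = 1 + t₃ ∧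
      (1 + t₁) * (P.under (𝓞 K₁)).inertiaDegIn (𝓞 K) = 1 + s₁ ∧
      (1 + t₂) * (P.under (𝓞 K₂)).inertiaDegIn (𝓞 K) = 1 + s₂ ∧
      (1 + t₃) * (P.under (𝓞 K₃)).inertiaDegIn (𝓞 K) = 1 + s₃ ∧
      (Ideal.span {(p : ℤ)}).ramificationIdxIn (𝓞 K₁) * (1 + t₁) = 1 + t₁ + t₂ + t₃ ∧
      (Ideal.span {(p : ℤ)}).ramificationIdxIn (𝓞 K₂) * (1 + t₂) = 1 + t₁ + t₂ + t₃ ∧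
      (Ideal.span {(p : ℤ)}).ramificationIdxIn (𝓞 K₃) * (1 + t₃) = 1 + t₁ + t₂ + t₃ ∧
      (Ideal.span {(p : ℤ)}).inertiaDegIn (𝓞 K₁) * (P.under (𝓞 K₁)).inertiaDegIn (𝓞 K) =
        (Ideal.span {(p : ℤ)}).inertiaDegIn (𝓞 K) ∧
      (Ideal.span {(p : ℤ)}).inertiaDegIn (𝓞 K₂) * (P.under (𝓞 K₂)).inertiaDegIn (𝓞 K) =
        (Ideal.span {(p : ℤ)}).inertiaDegIn (𝓞 K) ∧
      (Ideal.span {(p : ℤ)}).inertiaDegIn (𝓞 K₃) * (P.under (𝓞 K₃)).inertiaDegIn (𝓞 K) =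
        (Ideal.span {(p : ℤ)}).inertiaDegIn (𝓞 K) := by
  classical
  have hr₁ := finrank_eq_two_of_biquadratic hK h₁
  have hr₂ := finrank_eq_two_of_biquadratic hK h₂
  have hr₃ := finrank_eq_two_of_biquadratic hK h₃
  obtain ⟨σ₁, hσ₁, hf₁, H₁⟩ := exists_mem_inertia_mem_stabilizer_of_finrank_eq_two K₁ K hr₁
  obtain ⟨σ₂, hσ₂, hf₂, H₂⟩ := exists_mem_inertia_mem_stabilizer_of_finrank_eq_two K₂ K hr₂
  obtain ⟨σ₃, hσ₃, hf₃, H₃⟩ := exists_mem_inertia_mem_stabilizer_of_finrank_eq_two K₃ K hr₃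
  rw [range_algebraMap_eq_fixedPoints hr₁ hσ₁ hf₁, range_algebraMap_eq_fixedPoints hr₂ hσ₂ hf₂] at h₁₂
  rw [range_algebraMap_eq_fixedPoints hr₁ hσ₁ hf₁, range_algebraMap_eq_fixedPoints hr₃ hσ₃ hf₃] at h₁₃
  rw [range_algebraMap_eq_fixedPoints hr₂ hσ₂ hf₂, range_algebraMap_eq_fixedPoints hr₃ hσ₃ hf₃] at h₂₃
  have hd₁₂ : σ₁ ≠ σ₂ := fun h ↦ h₁₂ (by rw [h])
  have hd₁₃ : σ₁ ≠ σ₃ := fun h ↦ h₁₃ (by rw [h])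
  have hd₂₃ : σ₂ ≠ σ₃ := fun h ↦ h₂₃ (by rw [h])
  have hG : Nat.card Gal(K/ℚ) = 4 := by rw [IsGalois.card_aut_eq_finrank, hK]
  have hmono (σ : Gal(K/ℚ)) : (if σ ∈ P.inertia Gal(K/ℚ) then 1 else 0) ≤
      (if σ ∈ MulAction.stabilizer Gal(K/ℚ) P then 1 else 0) := by
    split_ifs with h h'
    · rfl
    · exact absurd (Ideal.inertia_le_stabilizer P h) h'
    · simp
    · rfl
  have hle (q : Prop) [Decidable q] : (if q then 1 else 0) ≤ 1 := by split_ifs <;> simp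
  have := isPrime_span_natCast hp
  have := perfectField_residueField_span hp
  have he := natCard_subgroup_of_natCard_eq_four hG hσ₁ hσ₂ hσ₃ hd₁₂ hd₁₃ hd₂₃ (P.inertia Gal(K/ℚ))
  rw [Ideal.card_inertia_eq_ramificationIdxIn (Ideal.span {(p : ℤ)}) P] at he
  have hs := natCard_subgroup_of_natCard_eq_four hG hσ₁ hσ₂ hσ₃ hd₁₂ hd₁₃ hd₂₃
    (MulAction.stabilizer Gal(K/ℚ) P)
  rw [Ideal.card_stabilizer_eq (Ideal.span {(p : ℤ)}) P] at hs
  have hf := inertiaDeg_le_of_forall_pow_eq_one two_ne_zero hexp hp P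
  rw [← Ideal.inertiaDegIn_eq_inertiaDeg (Ideal.span {(p : ℤ)}) P Gal(K/ℚ)] at hf
  obtain ⟨a₁, b₁, c₁, d₁⟩ := H₁ p hp P
  obtain ⟨a₂, b₂, c₂, d₂⟩ := H₂ p hp P
  obtain ⟨a₃, b₃, c₃, d₃⟩ := H₃ p hp P
  refine ⟨_, _, _, _, _, _, hmono σ₁, hmono σ₂, hmono σ₃, hle _, hle _, hle _, he, hs, hf, a₁, a₂, a₃,
    by rw [← a₁, b₁], by rw [← a₂, b₂], by rw [← a₃, b₃], ?_, ?_, ?_, d₁, d₂, d₃⟩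
  · exact (congrArg _ a₁.symm).trans (c₁.trans he)
  · exact (congrArg _ a₂.symm).trans (c₂.trans he)
  · exact (congrArg _ a₃.symm).trans (c₃.trans he)

theorem one_sub_pow_identity_of_ramification_data {R : Type*} [CommRing R] (x : R)
    {t₁ t₂ t₃ s₁ s₂ s₃ f g e₁ e₂ e₃ f₁ f₂ f₃ g₁ g₂ g₃ F₁ F₂ F₃ : ℕ}
    (ht₁ : t₁ ≤ s₁) (ht₂ : t₂ ≤ s₂) (ht₃ : t₃ ≤ s₃) (hs₁ : s₁ ≤ 1) (hs₂ : s₂ ≤ 1) (hs₃ : s₃ ≤ 1)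
    (hs : (1 + t₁ + t₂ + t₃) * f = 1 + s₁ + s₂ + s₃) (hf : f ≤ 2)
    (n₀ : g * ((1 + t₁ + t₂ + t₃) * f) = 4) (n₁ : g₁ * (e₁ * f₁) = 2) (n₂ : g₂ * (e₂ * f₂) = 2)
    (n₃ : g₃ * (e₃ * f₃) = 2)
    (b₁ : (1 + t₁) * F₁ = 1 + s₁) (b₂ : (1 + t₂) * F₂ = 1 + s₂) (b₃ : (1 + t₃) * F₃ = 1 + s₃)
    (c₁ : e₁ * (1 + t₁) = 1 + t₁ + t₂ + t₃) (c₂ : e₂ * (1 + t₂) = 1 + t₁ + t₂ + t₃)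
    (c₃ : e₃ * (1 + t₃) = 1 + t₁ + t₂ + t₃)
    (d₁ : f₁ * F₁ = f) (d₂ : f₂ * F₂ = f) (d₃ : f₃ * F₃ = f) :
    (1 - x ^ f) ^ g * (1 - x) ^ 2 = (1 - x ^ f₁) ^ g₁ * (1 - x ^ f₂) ^ g₂ * (1 - x ^ f₃) ^ g₃ := by
  have key {e f g t s F : ℕ} {E φ : ℕ} (hE : E ≤ 4) (hφ : φ ≤ 2) (hts : t ≤ s) (hs1 : s ≤ 1)
      (n : g * (e * f) = 2) (b : (1 + t) * F = 1 + s) (c : e * (1 + t) = E) (d : f * F = φ) :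
      (E = 1 + t ∧ φ = 1 + s - t ∧ f = 1 ∧ g = 2) ∨ (E = 1 + t ∧ φ = 2 * (1 + s - t) ∧ f = 2 ∧ g = 1) ∨
      (E = 2 * (1 + t) ∧ φ = 1 + s - t ∧ f = 1 ∧ g = 1) := by
    have hF : F = 1 + s - t := by interval_cases s <;> interval_cases t <;> omega
    subst hF
    have he : e ∣ 2 := ⟨f * g, by rw [← n]; ring⟩
    have hf : f ∣ 2 := ⟨e * g, by rw [← n]; ring⟩
    rcases (Nat.dvd_prime Nat.prime_two).1 he with rfl | rfl <;>
    rcases (Nat.dvd_prime Nat.prime_two).1 hf with rfl | rfl <;> omega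
  have hE : 1 + t₁ + t₂ + t₃ ≤ 4 := by omega
  have hg : g = 1 ∧ s₁ + s₂ + s₃ = 3 ∨ g = 2 ∧ s₁ + s₂ + s₃ = 1 ∨ g = 4 ∧ s₁ + s₂ + s₃ = 0 := by
    rw [hs] at n₀
    interval_cases s₁ <;> interval_cases s₂ <;> interval_cases s₃ <;> omega
  rcases key hE hf ht₁ hs₁ n₁ b₁ c₁ d₁ with ⟨i₁, j₁, rfl, rfl⟩ | ⟨i₁, j₁, rfl, rfl⟩ | ⟨i₁, j₁, rfl, rfl⟩ <;>
  rcases key hE hf ht₂ hs₂ n₂ b₂ c₂ d₂ with ⟨i₂, j₂, rfl, rfl⟩ | ⟨i₂, j₂, rfl, rfl⟩ | ⟨i₂, j₂, rfl, rfl⟩ <;>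
  rcases key hE hf ht₃ hs₃ n₃ b₃ c₃ d₃ with ⟨i₃, j₃, rfl, rfl⟩ | ⟨i₃, j₃, rfl, rfl⟩ | ⟨i₃, j₃, rfl, rfl⟩ <;>
  rcases hg with ⟨rfl, hg⟩ | ⟨rfl, hg⟩ | ⟨rfl, hg⟩ <;> clear n₀ n₁ n₂ n₃ b₁ b₂ b₃ c₁ c₂ c₃ d₁ d₂ d₃ key <;>
  interval_cases f <;> first | omega | ring

theorem one_sub_pow_inertiaDegIn_of_biquadratic
    (hK : Module.finrank ℚ K = 4) (hexp : ∀ σ : Gal(K/ℚ), σ ^ 2 = 1)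
    (h₁ : Module.finrank ℚ K₁ = 2) (h₂ : Module.finrank ℚ K₂ = 2) (h₃ : Module.finrank ℚ K₃ = 2)
    (h₁₂ : Set.range (algebraMap K₁ K) ≠ Set.range (algebraMap K₂ K))
    (h₁₃ : Set.range (algebraMap K₁ K) ≠ Set.range (algebraMap K₃ K))
    (h₂₃ : Set.range (algebraMap K₂ K) ≠ Set.range (algebraMap K₃ K))
    {p : ℕ} (hp : p.Prime) {R : Type*} [CommRing R] (x : R) :
    (1 - x ^ Ideal.inertiaDegIn (Ideal.span {(p : ℤ)}) (𝓞 K)) ^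
        (Ideal.primesOver (Ideal.span {(p : ℤ)}) (𝓞 K)).ncard * (1 - x) ^ 2 =
      (1 - x ^ Ideal.inertiaDegIn (Ideal.span {(p : ℤ)}) (𝓞 K₁)) ^
        (Ideal.primesOver (Ideal.span {(p : ℤ)}) (𝓞 K₁)).ncard *
      (1 - x ^ Ideal.inertiaDegIn (Ideal.span {(p : ℤ)}) (𝓞 K₂)) ^
        (Ideal.primesOver (Ideal.span {(p : ℤ)}) (𝓞 K₂)).ncard *
      (1 - x ^ Ideal.inertiaDegIn (Ideal.span {(p : ℤ)}) (𝓞 K₃)) ^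
        (Ideal.primesOver (Ideal.span {(p : ℤ)}) (𝓞 K₃)).ncard := by
  have := isPrime_span_natCast hp
  obtain ⟨P, _, _⟩ := (inferInstance : Nonempty (Ideal.primesOver (Ideal.span {(p : ℤ)}) (𝓞 K)))
  have n₀ := Ideal.ncard_primesOver_mul_ramificationIdxIn_mul_inertiaDegIn (Ideal.span {(p : ℤ)}) (𝓞 K) Gal(K/ℚ)
  have n₁ := Ideal.ncard_primesOver_mul_ramificationIdxIn_mul_inertiaDegIn (Ideal.span {(p : ℤ)}) (𝓞 K₁) Gal(K₁/ℚ)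
  have n₂ := Ideal.ncard_primesOver_mul_ramificationIdxIn_mul_inertiaDegIn (Ideal.span {(p : ℤ)}) (𝓞 K₂) Gal(K₂/ℚ)
  have n₃ := Ideal.ncard_primesOver_mul_ramificationIdxIn_mul_inertiaDegIn (Ideal.span {(p : ℤ)}) (𝓞 K₃) Gal(K₃/ℚ)
  rw [IsGalois.card_aut_eq_finrank, hK] at n₀
  rw [IsGalois.card_aut_eq_finrank, h₁] at n₁
  rw [IsGalois.card_aut_eq_finrank, h₂] at n₂
  rw [IsGalois.card_aut_eq_finrank, h₃] at n₃
  obtain ⟨t₁, t₂, t₃, s₁, s₂, s₃, ht₁, ht₂, ht₃, hs₁, hs₂, hs₃, he, hs, hf, -, -, -, b₁, b₂, b₃,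
    c₁, c₂, c₃, d₁, d₂, d₃⟩ := exists_ramification_data_of_biquadratic K K₁ K₂ K₃ hK hexp h₁ h₂ h₃ h₁₂ h₁₃ h₂₃ hp P
  rw [he] at n₀ hs
  generalize Ideal.inertiaDegIn (Ideal.span {(p : ℤ)}) (𝓞 K) = f at *
  generalize Ideal.inertiaDegIn (Ideal.span {(p : ℤ)}) (𝓞 K₁) = f₁ at *
  generalize Ideal.inertiaDegIn (Ideal.span {(p : ℤ)}) (𝓞 K₂) = f₂ at *
  generalize Ideal.inertiaDegIn (Ideal.span {(p : ℤ)}) (𝓞 K₃) = f₃ at *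
  generalize (Ideal.primesOver (Ideal.span {(p : ℤ)}) (𝓞 K)).ncard = g at *
  generalize (Ideal.primesOver (Ideal.span {(p : ℤ)}) (𝓞 K₁)).ncard = g₁ at *
  generalize (Ideal.primesOver (Ideal.span {(p : ℤ)}) (𝓞 K₂)).ncard = g₂ at *
  generalize (Ideal.primesOver (Ideal.span {(p : ℤ)}) (𝓞 K₃)).ncard = g₃ at *
  generalize (Ideal.span {(p : ℤ)}).ramificationIdxIn (𝓞 K₁) = e₁ at *
  generalize (Ideal.span {(p : ℤ)}).ramificationIdxIn (𝓞 K₂) = e₂ at *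
  generalize (Ideal.span {(p : ℤ)}).ramificationIdxIn (𝓞 K₃) = e₃ at *
  generalize (P.under (𝓞 K₁)).inertiaDegIn (𝓞 K) = F₁ at *
  generalize (P.under (𝓞 K₂)).inertiaDegIn (𝓞 K) = F₂ at *
  generalize (P.under (𝓞 K₃)).inertiaDegIn (𝓞 K) = F₃ at *
  exact one_sub_pow_identity_of_ramification_data x ht₁ ht₂ ht₃ hs₁ hs₂ hs₃ hs hf n₀ n₁ n₂ n₃ b₁ b₂ b₃
    c₁ c₂ c₃ d₁ d₂ d₃
end

end

section

open NumberField

theorem linearIndependent_one_of_notMem_range {k L : Type*} [Field k] [Field L] [Algebra k L]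
    {x : L} (hx : x ∉ Set.range (algebraMap k L)) : LinearIndependent k ![1, x] := by
  rw [LinearIndependent.pair_iff]
  intro s t hst
  have ht : t = 0 := by
    by_contra ht
    refine hx ⟨-s / t, ?_⟩
    have ht' : algebraMap k L t ≠ 0 := by simpa using ht
    rw [Algebra.smul_def, Algebra.smul_def, mul_one] at hst
    rw [map_div₀, map_neg, div_eq_iff ht']
    linear_combination -hst
  subst ht
  simpa using hst

theorem exists_eq_add_mul_of_finrank_eq_two {k L : Type*} [Field k] [Field L] [Algebra k L]
    (h : Module.finrank k L = 2) {x : L} (hx : x ∉ Set.range (algebraMap k L)) (y : L) :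
    ∃ a b : k, y = algebraMap k L a + algebraMap k L b * x := by
  have : Module.Finite k L := Module.finite_of_finrank_eq_succ h
  have hs := (linearIndependent_one_of_notMem_range hx).span_eq_top_of_card_eq_finrank (by simp [h])
  have hy : y ∈ Submodule.span k (Set.range ![1, x]) := hs ▸ Submodule.mem_top
  rw [Matrix.range_cons, Matrix.range_cons, Matrix.range_empty, Set.union_empty,
    Set.singleton_union, Submodule.mem_span_pair] at hy
  obtain ⟨a, b, hab⟩ := hy
  exact ⟨a, b, by rw [← hab, Algebra.smul_def, Algebra.smul_def, mul_one]⟩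

theorem Rat.exists_squarefree_mul_sq {q : ℚ} (hq : q ≠ 0) :
    ∃ (m : ℤ) (r : ℚ), Squarefree m ∧ r ≠ 0 ∧ q = m * r ^ 2 := by
  obtain ⟨a, b, hab, ha⟩ := Nat.sq_mul_squarefree (q.num * q.den).natAbs
  have hd : (q.den : ℚ) ≠ 0 := by simp
  have hn : q.num * q.den ≠ 0 := by simp [hq]
  have hb : b ≠ 0 := by
    rintro rfl
    exact hn (Int.natAbs_eq_zero.mp (by rw [← hab]; simp))
  refine ⟨(q.num * q.den).sign * a, b / q.den, ?_, by positivity, ?_⟩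
  · rw [← Int.squarefree_natAbs, Int.natAbs_mul, Int.natAbs_sign_of_ne_zero hn]
    simpa using ha
  · have h1 := Int.sign_mul_natAbs (q.num * q.den)
    rw [← hab] at h1
    have h2 : ((q.num * q.den).sign : ℚ) * (b ^ 2 * a) = q.num * q.den := by exact_mod_cast h1
    field_simp
    calc q * (q.den : ℚ) ^ 2 = (q * q.den) * q.den := by ring
      _ = q.num * q.den := by rw [Rat.mul_den_eq_num]
      _ = _ := by rw [← h2]; push_cast; ring

theorem exists_sq_eq_squarefree_of_finrank_eq_two {F : Type*} [Field F] [CharZero F]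
    (h : Module.finrank ℚ F = 2) :
    ∃ (m : ℤ) (α : F), Squarefree m ∧ α ^ 2 = m ∧ α ∉ Set.range (algebraMap ℚ F) := by
  obtain ⟨x, hx⟩ : ∃ x : F, x ∉ Set.range (algebraMap ℚ F) := by
    by_contra! H
    have h1 : Module.finrank ℚ F = 1 := by
      rw [finrank_eq_one_iff']
      refine ⟨1, one_ne_zero, fun w ↦ ?_⟩
      obtain ⟨c, hc⟩ := H w
      exact ⟨c, by rw [← hc, Algebra.smul_def, mul_one]⟩
    omega
  obtain ⟨a, b, hab⟩ := exists_eq_add_mul_of_finrank_eq_two h hx (x ^ 2)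
  simp only [eq_ratCast] at hab
  have hy : (2 * x - b) ^ 2 = ((4 * a + b ^ 2 : ℚ) : F) := by
    push_cast
    linear_combination 4 * hab
  have hne : 4 * a + b ^ 2 ≠ 0 := by
    intro h0
    rw [h0, Rat.cast_zero, sq_eq_zero_iff] at hy
    refine hx ⟨b / 2, ?_⟩
    simp only [eq_ratCast, Rat.cast_div, Rat.cast_ofNat]
    linear_combination -hy / 2
  obtain ⟨m, r, hm, hr, hq⟩ := Rat.exists_squarefree_mul_sq hne
  have hr' : (r : F) ≠ 0 := by exact_mod_cast hr
  refine ⟨m, (2 * x - b) / r, hm, ?_, ?_⟩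
  · rw [div_pow, hy, hq]
    push_cast
    field_simp
  · rintro ⟨c, hc⟩
    refine hx ⟨(c * r + b) / 2, ?_⟩
    rw [eq_ratCast, eq_div_iff hr'] at hc
    simp only [eq_ratCast, Rat.cast_div, Rat.cast_ofNat, Rat.cast_add, Rat.cast_mul]
    linear_combination hc / 2

theorem trace_eq_zero_of_sq_eq {F : Type*} [Field F] [NumberField F] {m : ℤ} {α : F}
    (hα : α ^ 2 = m) (hr : α ∉ Set.range (algebraMap ℚ F)) : Algebra.trace ℚ F α = 0 := by
  have hm : minpoly ℚ α = Polynomial.X ^ 2 - Polynomial.C (m : ℚ) := by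
    refine (minpoly.unique ℚ α (Polynomial.monic_X_pow_sub_C _ two_ne_zero) (by simp [hα]) ?_).symm
    intro q hq hq0
    rw [Polynomial.degree_X_pow_sub_C two_pos]
    refine le_trans ?_ (minpoly.min ℚ α hq hq0)
    rw [Polynomial.degree_eq_natDegree (minpoly.ne_zero (Algebra.IsIntegral.isIntegral α))]
    exact_mod_cast (minpoly.two_le_natDegree_iff (Algebra.IsIntegral.isIntegral α)).mpr hr
  rw [trace_eq_finrank_mul_minpoly_nextCoeff, hm,
    Polynomial.nextCoeff_of_natDegree_pos (by rw [Polynomial.natDegree_X_pow_sub_C]; simp),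
    Polynomial.natDegree_X_pow_sub_C, Polynomial.coeff_sub, Polynomial.coeff_X_pow,
    Polynomial.coeff_C]
  simp

theorem exists_discr_mul_sq_eq_four_mul {F : Type*} [Field F] [NumberField F]
    (h : Module.finrank ℚ F = 2) {m : ℤ} {α : F} (hα : α ^ 2 = m)
    (hr : α ∉ Set.range (algebraMap ℚ F)) :
    ∃ k : ℤ, k ≠ 0 ∧ discr F * k ^ 2 = 4 * m := by
  have hα_int : IsIntegral ℤ α := by
    refine ⟨Polynomial.X ^ 2 - Polynomial.C m, Polynomial.monic_X_pow_sub_C m two_ne_zero, ?_⟩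
    rw [Polynomial.eval₂_sub, Polynomial.eval₂_X_pow, Polynomial.eval₂_C, hα]
    simp
  let a : 𝓞 F := ⟨α, hα_int⟩
  have haα : (a : F) = α := rfl
  let b := RingOfIntegers.basis F
  have hcard : Fintype.card (Module.Free.ChooseBasisIndex ℤ (𝓞 F)) = 2 := by
    rw [← Module.finrank_eq_card_chooseBasisIndex, RingOfIntegers.rank, h]
  let e : Module.Free.ChooseBasisIndex ℤ (𝓞 F) ≃ Fin 2 := Fintype.equivFinOfCardEq hcard
  let b' := b.reindex e
  have h1 : discr F = Algebra.discr ℤ b' := (discr_eq_discr F b').symm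
  let P := b'.toMatrix ![1, a]
  have h2 : Algebra.discr ℤ ![1, a] = P.det ^ 2 * Algebra.discr ℤ b' := by
    rw [← Algebra.discr_of_matrix_vecMul]
    congr 1
    exact (b'.toMatrix_map_vecMul ![1, a]).symm
  have h3 : Algebra.discr ℤ ![1, a] = 4 * m := by
    have htr := trace_eq_zero_of_sq_eq hα hr
    apply Int.cast_injective (α := ℚ)
    have hii (x y : 𝓞 F) (z : ℚ) (hz : Algebra.trace ℚ F (x * y) = z) :
        ((Algebra.trace ℤ (𝓞 F) (x * y) : ℤ) : ℚ) = z := by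
      rw [Algebra.coe_trace_int, ← hz]
      simp
    have e11 := hii 1 1 2 (by simpa [h] using Algebra.trace_algebraMap (R := ℚ) (S := F) 1)
    have e12 := hii 1 a 0 (by simpa [haα] using htr)
    have e21 := hii a 1 0 (by simpa [haα] using htr)
    have e22 := hii a a (2 * m) (by
      have := Algebra.trace_algebraMap (R := ℚ) (S := F) (m : ℚ)
      rw [h] at this
      rw [show ((a : F) * (a : F)) = algebraMap ℚ F m by rw [← sq, map_intCast]; exact hα, this]
      simp)
    rw [Algebra.discr_def, Matrix.det_fin_two]
    simp only [Algebra.traceMatrix_apply, Algebra.traceForm_apply, Matrix.cons_val_zero,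
      Matrix.cons_val_one]
    push_cast
    rw [e11, e12, e21, e22]
    ring
  have h4 : m ≠ 0 := by
    rintro rfl
    simp at hα
    exact hr ⟨0, by simp [hα]⟩
  refine ⟨P.det, ?_, ?_⟩
  · intro h0
    rw [h0, h3] at h2
    simp [h4] at h2
  · rw [h1, mul_comm, ← h2, h3]

theorem ramificationIdxIn_ne_one_of_dvd_discr {F : Type*} [Field F] [NumberField F] [IsGalois ℚ F]
    {p : ℕ} (hp : p.Prime) (h : (p : ℤ) ∣ discr F) :
    (Ideal.span {(p : ℤ)}).ramificationIdxIn (𝓞 F) ≠ 1 := by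
  intro he
  refine (not_dvd_discr_iff_isUnramifiedIn F (𝓞 F) (Nat.prime_iff_prime_int.mp hp)).mpr ?_ h
  rw [Algebra.isUnramifiedIn_iff_forall_ramificationIdx_eq_one]
  intro P _ hP
  rw [← Ideal.ramificationIdxIn_eq_ramificationIdx (Ideal.span {(p : ℤ)}) P Gal(F/ℚ), he]

theorem dvd_differentIdeal_of_ramificationIdxIn_ne_one {F K : Type*} [Field F] [NumberField F]
    [Field K] [NumberField K] [Algebra F K] [IsGalois F K] (P : Ideal (𝓞 K)) [P.IsMaximal]
    (h : (P.under (𝓞 F)).ramificationIdxIn (𝓞 K) ≠ 1) : P ∣ differentIdeal (𝓞 F) (𝓞 K) := by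
  by_contra H
  rw [not_dvd_differentIdeal_iff, ← Ideal.ramificationIdx_eq_one_iff,
    ← Ideal.ramificationIdxIn_eq_ramificationIdx (P.under (𝓞 F)) P Gal(K/F)] at H
  exact h H

theorem factorization_discr_of_ramificationIdxIn_ne_one {F K : Type*} [Field F] [NumberField F]
    [Field K] [NumberField K] [Algebra F K] [IsGalois F K] (hr : Module.finrank F K = 2)
    {p : ℕ} (hp : p.Prime) (P : Ideal (𝓞 K)) [P.IsMaximal] [P.LiesOver (Ideal.span {(p : ℤ)})]
    (h : (P.under (𝓞 F)).ramificationIdxIn (𝓞 K) ≠ 1) :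
    2 * (discr F).natAbs.factorization p + 1 ≤ (discr K).natAbs.factorization p := by
  have hd := natAbs_discr_eq_absNorm_differentIdeal_mul_natAbs_discr_pow F (𝓞 F) K (𝓞 K)
  have hK : (discr K).natAbs ≠ 0 := by simpa using discr_ne_zero K
  rw [hd] at hK
  rw [hd, hr, Nat.factorization_mul (left_ne_zero_of_mul hK) (by simpa using discr_ne_zero F),
    Nat.factorization_pow]
  simp only [Finsupp.coe_add, Finsupp.coe_smul, Pi.add_apply, Pi.smul_apply, smul_eq_mul]
  have hdvd : p ∣ Ideal.absNorm (differentIdeal (𝓞 F) (𝓞 K)) := by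
    refine dvd_trans ?_ (map_dvd Ideal.absNorm (dvd_differentIdeal_of_ramificationIdxIn_ne_one P h))
    rw [← Ideal.natAbs_pow_inertiaDeg (p : ℤ) P, Int.natAbs_natCast]
    exact dvd_pow_self _ (Ideal.inertiaDeg_pos P ℤ).ne'
  have := hp.factorization_pos_of_dvd (left_ne_zero_of_mul hK) hdvd
  omega

theorem two_mul_factorization_discr_le {F K : Type*} [Field F] [NumberField F]
    [Field K] [NumberField K] [Algebra F K] (hr : Module.finrank F K = 2) (p : ℕ) :
    2 * (discr F).natAbs.factorization p ≤ (discr K).natAbs.factorization p := by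
  have hd := natAbs_discr_eq_absNorm_differentIdeal_mul_natAbs_discr_pow F (𝓞 F) K (𝓞 K)
  have hK : (discr K).natAbs ≠ 0 := by simpa using discr_ne_zero K
  rw [hd] at hK
  rw [hd, hr, Nat.factorization_mul (left_ne_zero_of_mul hK) (by simpa using discr_ne_zero F),
    Nat.factorization_pow]
  simp

theorem factorization_discr_le_of_finrank_eq_two {F : Type*} [Field F] [NumberField F]
    (h : Module.finrank ℚ F = 2) {p : ℕ} :
    (discr F).natAbs.factorization p ≤ if p = 2 then 3 else 1 := by
  obtain ⟨m, α, hm, hα, hr⟩ := exists_sq_eq_squarefree_of_finrank_eq_two h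
  obtain ⟨k, hk, hdk⟩ := exists_discr_mul_sq_eq_four_mul h hα hr
  have h1 : (discr F).natAbs ∣ 4 * m.natAbs := by
    have := congrArg Int.natAbs hdk
    rw [Int.natAbs_mul, Int.natAbs_mul] at this
    exact ⟨_, this.symm⟩
  have hm0 : m.natAbs ≠ 0 := by simpa using hm.ne_zero
  have h2 := (Nat.factorization_le_iff_dvd (by simpa using discr_ne_zero F) (by omega)).mpr h1 p
  refine h2.trans ?_
  rw [Nat.factorization_mul four_ne_zero hm0, show 4 = 2 ^ 2 by rfl, Nat.factorization_pow,
    Nat.prime_two.factorization]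
  have h3 := (Int.squarefree_natAbs.mpr hm).natFactorization_le_one p
  simp only [Finsupp.coe_add, Finsupp.coe_smul, Pi.add_apply, Pi.smul_apply, smul_eq_mul,
    Finsupp.single_apply]
  split_ifs <;> omega

theorem eq_or_eq_mul_of_sq_eq {k L : Type*} [Field k] [Field L] [Algebra k L] [CharZero L]
    (h : Module.finrank k L = 2) {α y : L} (hα : α ∉ Set.range (algebraMap k L)) {c d : k}
    (hc : α ^ 2 = algebraMap k L c) (hd : y ^ 2 = algebraMap k L d) :
    y ∈ Set.range (algebraMap k L) ∨ ∃ b : k, y = algebraMap k L b * α := by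
  obtain ⟨a, b, rfl⟩ := exists_eq_add_mul_of_finrank_eq_two h hα y
  by_cases ha : a = 0
  · exact Or.inr ⟨b, by simp [ha]⟩
  by_cases hb : b = 0
  · exact Or.inl ⟨a, by simp [hb]⟩
  have ha' : algebraMap k L a ≠ 0 := by simpa using ha
  have hb' : algebraMap k L b ≠ 0 := by simpa using hb
  refine absurd ⟨(d - a ^ 2 - b ^ 2 * c) / (2 * a * b), ?_⟩ hα
  rw [map_div₀]
  simp only [map_sub, map_mul, map_pow, map_ofNat, ← hc, ← hd]
  field_simp
  ring

theorem range_algebraMap_subset_of_mem {F E K : Type*} [Field F] [CharZero F] [Field E]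
    [CharZero E] [Field K] [CharZero K] [Algebra F K] [Algebra E K] (hF : Module.finrank ℚ F = 2)
    {x : F} {y : E} (hx : x ∉ Set.range (algebraMap ℚ F))
    (hxy : algebraMap F K x = algebraMap E K y) :
    Set.range (algebraMap F K) ⊆ Set.range (algebraMap E K) := by
  rintro _ ⟨z, rfl⟩
  obtain ⟨a, b, rfl⟩ := exists_eq_add_mul_of_finrank_eq_two hF hx z
  exact ⟨a + b * y, by simp [hxy]⟩

theorem notMem_range_of_range_ne {F E K : Type*} [Field F] [CharZero F] [Field E]
    [CharZero E] [Field K] [CharZero K] [Algebra F K] [Algebra E K] (hF : Module.finrank ℚ F = 2)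
    (hE : Module.finrank ℚ E = 2) (hne : Set.range (algebraMap F K) ≠ Set.range (algebraMap E K))
    {x : F} (hx : x ∉ Set.range (algebraMap ℚ F)) :
    algebraMap F K x ∉ Set.range (algebraMap E K) := by
  rintro ⟨y, hy⟩
  have hy' : y ∉ Set.range (algebraMap ℚ E) := by
    rintro ⟨q, rfl⟩
    refine hx ⟨q, (algebraMap F K).injective ?_⟩
    rw [← hy]
    simp
  exact hne ((range_algebraMap_subset_of_mem hF hx hy.symm).antisymm
    (range_algebraMap_subset_of_mem hE hy' hy))

section

variable (K K₁ K₂ K₃ : Type*) [Field K] [NumberField K] [Field K₁] [NumberField K₁]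
  [Field K₂] [NumberField K₂] [Field K₃] [NumberField K₃]
  [Algebra K₁ K] [Algebra K₂ K] [Algebra K₃ K]

theorem exists_discr_mul_discr_mul_discr_eq_sq
    (hK : Module.finrank ℚ K = 4)
    (h₁ : Module.finrank ℚ K₁ = 2) (h₂ : Module.finrank ℚ K₂ = 2) (h₃ : Module.finrank ℚ K₃ = 2)
    (h₁₂ : Set.range (algebraMap K₁ K) ≠ Set.range (algebraMap K₂ K))
    (h₁₃ : Set.range (algebraMap K₁ K) ≠ Set.range (algebraMap K₃ K))
    (h₂₃ : Set.range (algebraMap K₂ K) ≠ Set.range (algebraMap K₃ K)) :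
    ∃ n : ℤ, discr K₁ * discr K₂ * discr K₃ = n ^ 2 := by
  obtain ⟨m₁, α₁, -, hα₁, hr₁⟩ := exists_sq_eq_squarefree_of_finrank_eq_two h₁
  obtain ⟨m₂, α₂, -, hα₂, hr₂⟩ := exists_sq_eq_squarefree_of_finrank_eq_two h₂
  obtain ⟨m₃, α₃, -, hα₃, hr₃⟩ := exists_sq_eq_squarefree_of_finrank_eq_two h₃
  obtain ⟨k₁, hk₁, hd₁⟩ := exists_discr_mul_sq_eq_four_mul h₁ hα₁ hr₁
  obtain ⟨k₂, hk₂, hd₂⟩ := exists_discr_mul_sq_eq_four_mul h₂ hα₂ hr₂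
  obtain ⟨k₃, hk₃, hd₃⟩ := exists_discr_mul_sq_eq_four_mul h₃ hα₃ hr₃
  have e₁ : algebraMap K₁ K α₁ ^ 2 = m₁ := by rw [← map_pow, hα₁, map_intCast]
  have e₂ : algebraMap K₂ K α₂ ^ 2 = m₂ := by rw [← map_pow, hα₂, map_intCast]
  obtain h | ⟨b, hb⟩ := eq_or_eq_mul_of_sq_eq (finrank_eq_two_of_biquadratic hK h₃)
    (notMem_range_of_range_ne h₁ h₃ h₁₃ hr₁) (c := (m₁ : K₃)) (d := (m₂ : K₃))
    (y := algebraMap K₂ K α₂) (by simpa using e₁) (by simpa using e₂)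
  · exact absurd h (notMem_range_of_range_ne h₂ h₃ h₂₃ hr₂)
  have hb2 : b ^ 2 * m₁ = m₂ := by
    apply (algebraMap K₃ K).injective
    simp only [map_mul, map_pow, map_intCast, ← e₁, ← e₂, hb]
    ring
  obtain ⟨u, rfl⟩ | ⟨u, rfl⟩ := eq_or_eq_mul_of_sq_eq h₃ hr₃ (c := (m₃ : ℚ)) (d := m₂ / m₁) (y := b)
    (by simpa using hα₃) (by
      have : (m₁ : K₃) ≠ 0 := by
        intro h0
        have : m₁ = 0 := by exact_mod_cast h0
        simp [this] at e₁
        simp [e₁] at hb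
        exact hr₂ ⟨0, by simp [hb]⟩
      simp only [map_div₀, map_intCast]
      rw [eq_div_iff this, hb2])
  · refine absurd ⟨u * α₁, ?_⟩ (notMem_range_of_range_ne h₂ h₁ h₁₂.symm hr₂)
    rw [hb]
    simp
  have hm : (m₂ : ℚ) = u ^ 2 * m₃ * m₁ := by
    apply (algebraMap ℚ K₃).injective
    simp only [map_mul, map_pow, map_intCast, ← hα₃, ← hb2]
    ring
  have hsq : IsSquare ((discr K₁ * discr K₂ * discr K₃ : ℤ) : ℚ) := by
    refine ⟨8 * u * m₁ * m₃ / (k₁ * k₂ * k₃), ?_⟩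
    have hk : (k₁ : ℚ) ≠ 0 ∧ (k₂ : ℚ) ≠ 0 ∧ (k₃ : ℚ) ≠ 0 :=
      ⟨by exact_mod_cast hk₁, by exact_mod_cast hk₂, by exact_mod_cast hk₃⟩
    obtain ⟨q₁, q₂, q₃⟩ := hk
    have E₁ : (discr K₁ : ℚ) * k₁ ^ 2 = 4 * m₁ := by exact_mod_cast hd₁
    have E₂ : (discr K₂ : ℚ) * k₂ ^ 2 = 4 * m₂ := by exact_mod_cast hd₂
    have E₃ : (discr K₃ : ℚ) * k₃ ^ 2 = 4 * m₃ := by exact_mod_cast hd₃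
    field_simp
    push_cast
    calc _ = ((discr K₁ : ℚ) * k₁ ^ 2) * ((discr K₂ : ℚ) * k₂ ^ 2) * ((discr K₃ : ℚ) * k₃ ^ 2) := by
          ring
      _ = _ := by
        rw [E₁, E₂, E₃, hm]
        ring
  rw [Rat.isSquare_intCast_iff] at hsq
  obtain ⟨n, hn⟩ := hsq
  exact ⟨n, by rw [hn, sq]⟩

theorem natAbs_discr_mul_discr_mul_discr_dvd [IsGalois ℚ K]
    (hK : Module.finrank ℚ K = 4) (hexp : ∀ σ : Gal(K/ℚ), σ ^ 2 = 1)
    (h₁ : Module.finrank ℚ K₁ = 2) (h₂ : Module.finrank ℚ K₂ = 2) (h₃ : Module.finrank ℚ K₃ = 2)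
    (h₁₂ : Set.range (algebraMap K₁ K) ≠ Set.range (algebraMap K₂ K))
    (h₁₃ : Set.range (algebraMap K₁ K) ≠ Set.range (algebraMap K₃ K))
    (h₂₃ : Set.range (algebraMap K₂ K) ≠ Set.range (algebraMap K₃ K)) :
    (discr K₁).natAbs * (discr K₂).natAbs * (discr K₃).natAbs ∣ 2 * (discr K).natAbs := by
  have : Algebra.IsQuadraticExtension ℚ K₁ := ⟨h₁⟩
  have : Algebra.IsQuadraticExtension ℚ K₂ := ⟨h₂⟩
  have : Algebra.IsQuadraticExtension ℚ K₃ := ⟨h₃⟩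
  have : IsGalois K₁ K := IsGalois.tower_top_of_isGalois ℚ K₁ K
  have : IsGalois K₂ K := IsGalois.tower_top_of_isGalois ℚ K₂ K
  have : IsGalois K₃ K := IsGalois.tower_top_of_isGalois ℚ K₃ K
  have z₁ : (discr K₁).natAbs ≠ 0 := by simpa using discr_ne_zero K₁
  have z₂ : (discr K₂).natAbs ≠ 0 := by simpa using discr_ne_zero K₂
  have z₃ : (discr K₃).natAbs ≠ 0 := by simpa using discr_ne_zero K₃
  have z : (discr K).natAbs ≠ 0 := by simpa using discr_ne_zero K
  have hr₁ := finrank_eq_two_of_biquadratic hK h₁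
  have hr₂ := finrank_eq_two_of_biquadratic hK h₂
  have hr₃ := finrank_eq_two_of_biquadratic hK h₃
  rw [← Nat.factorization_prime_le_iff_dvd (by positivity) (by positivity)]
  intro p hp
  obtain ⟨n, hn⟩ := exists_discr_mul_discr_mul_discr_eq_sq K K₁ K₂ K₃ hK h₁ h₂ h₃ h₁₂ h₁₃ h₂₃
  have hpar : (discr K₁).natAbs.factorization p + (discr K₂).natAbs.factorization p +
      (discr K₃).natAbs.factorization p = 2 * n.natAbs.factorization p := by
    have := congrArg (fun z : ℤ ↦ z.natAbs.factorization p) hn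
    simpa [Int.natAbs_mul, Int.natAbs_pow, Nat.factorization_mul, z₁, z₂, z₃,
      Nat.factorization_pow] using this
  have b₁ := factorization_discr_le_of_finrank_eq_two h₁ (p := p)
  have b₂ := factorization_discr_le_of_finrank_eq_two h₂ (p := p)
  have b₃ := factorization_discr_le_of_finrank_eq_two h₃ (p := p)
  have c₁ := two_mul_factorization_discr_le hr₁ p
  have c₂ := two_mul_factorization_discr_le hr₂ p
  have c₃ := two_mul_factorization_discr_le hr₃ p
  have hram : 0 < (discr K₁).natAbs.factorization p → 0 < (discr K₂).natAbs.factorization p →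
      0 < (discr K₃).natAbs.factorization p →
      2 * (discr K₁).natAbs.factorization p + 1 ≤ (discr K).natAbs.factorization p ∧
      2 * (discr K₂).natAbs.factorization p + 1 ≤ (discr K).natAbs.factorization p ∧
      2 * (discr K₃).natAbs.factorization p + 1 ≤ (discr K).natAbs.factorization p := by
    intro v₁ v₂ v₃
    have r₁ := ramificationIdxIn_ne_one_of_dvd_discr hp
      (Int.natCast_dvd.mpr (Nat.dvd_of_factorization_pos v₁.ne'))
    have r₂ := ramificationIdxIn_ne_one_of_dvd_discr hp
      (Int.natCast_dvd.mpr (Nat.dvd_of_factorization_pos v₂.ne'))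
    have r₃ := ramificationIdxIn_ne_one_of_dvd_discr hp
      (Int.natCast_dvd.mpr (Nat.dvd_of_factorization_pos v₃.ne'))
    have : (Ideal.span {(p : ℤ)}).IsPrime := isPrime_span_natCast hp
    have : (Ideal.span {(p : ℤ)}).IsMaximal := this.isMaximal (by simpa using hp.ne_zero)
    obtain ⟨P, hPm, hPl⟩ := Ideal.exists_maximal_ideal_liesOver_of_isIntegral (S := 𝓞 K)
      (Ideal.span {(p : ℤ)})
    obtain ⟨t₁, t₂, t₃, s₁, s₂, s₃, l₁, l₂, l₃, m₁, m₂, m₃, -, -, -, E₁, E₂, E₃, -, -, -,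
      F₁, F₂, F₃, -⟩ := exists_ramification_data_of_biquadratic K K₁ K₂ K₃ hK hexp h₁ h₂ h₃
        h₁₂ h₁₃ h₂₃ hp P
    have ht : t₁ = 1 ∧ t₂ = 1 ∧ t₃ = 1 := by
      have u₁ : t₁ = 0 ∨ t₁ = 1 := by omega
      have u₂ : t₂ = 0 ∨ t₂ = 1 := by omega
      have u₃ : t₃ = 0 ∨ t₃ = 1 := by omega
      rcases u₁ with rfl | rfl <;> rcases u₂ with rfl | rfl <;> rcases u₃ with rfl | rfl <;> omega
    exact ⟨factorization_discr_of_ramificationIdxIn_ne_one hr₁ hp P (by omega),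
      factorization_discr_of_ramificationIdxIn_ne_one hr₂ hp P (by omega),
      factorization_discr_of_ramificationIdxIn_ne_one hr₃ hp P (by omega)⟩
  rw [Nat.factorization_mul (by positivity) z₃, Nat.factorization_mul z₁ z₂,
    Nat.factorization_mul two_ne_zero z, Nat.prime_two.factorization]
  simp only [Finsupp.coe_add, Pi.add_apply, Finsupp.single_apply]
  split_ifs at b₁ b₂ b₃ ⊢ <;> omega
end

theorem classNumber_le_of_ringEquiv {F E : Type*} [Field F] [NumberField F] [Field E]
    [NumberField E] (e : F ≃+* E) : classNumber F ≤ classNumber E := by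
  let f : 𝓞 F ≃+* 𝓞 E := RingOfIntegers.mapRingEquiv e
  have hrep (C : ClassGroup (𝓞 F)) : ∃ I, ClassGroup.mk0 I = C := ClassGroup.mk0_surjective C
  choose r hr using hrep
  have hmem (I : nonZeroDivisors (Ideal (𝓞 F))) :
      (I : Ideal (𝓞 F)).map f ∈ nonZeroDivisors (Ideal (𝓞 E)) := by
    rw [mem_nonZeroDivisors_iff_ne_zero, Ne, Ideal.zero_eq_bot,
      Ideal.map_eq_bot_iff_of_injective f.injective]
    exact nonZeroDivisors.ne_zero I.2
  refine Fintype.card_le_of_injective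
    (fun C ↦ ClassGroup.mk0 ⟨(r C : Ideal (𝓞 F)).map f, hmem (r C)⟩) fun C D h ↦ ?_
  rw [← hr C, ← hr D]
  rw [ClassGroup.mk0_eq_mk0_iff] at h ⊢
  obtain ⟨x, y, hx, hy, h⟩ := h
  refine ⟨f.symm x, f.symm y, by simpa using hx, by simpa using hy, ?_⟩
  have := congrArg (Ideal.map f.symm) h
  simpa [Ideal.map_mul, Ideal.map_span, Ideal.comap_map_of_bijective f f.bijective] using this

theorem torsionOrder_le_two_of_nrRealPlaces_ne_zero {F : Type*} [Field F] [NumberField F]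
    (h : InfinitePlace.nrRealPlaces F ≠ 0) : Units.torsionOrder F ≤ 2 := by
  have key (x : Units.torsion F) : (x : (𝓞 F)ˣ) ∈ ({1, -1} : Set (𝓞 F)ˣ) := by
    have hfin : IsOfFinOrder (x : (𝓞 F)ˣ) := (CommGroup.mem_torsion x.1).mp x.2
    by_cases hc : 2 < orderOf (x : (𝓞 F)ˣ)
    · have h1 := (IsPrimitiveRoot.coe_units_iff.mpr
        (IsPrimitiveRoot.orderOf (x : (𝓞 F)ˣ))).map_of_injective (RingOfIntegers.coe_injective (K := F))
      exact absurd (InfinitePlace.IsPrimitiveRoot.nrRealPlaces_eq_zero_of_two_lt hc h1) h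
    · have h2 : (x : (𝓞 F)ˣ) ^ 2 = 1 := by
        have := hfin.orderOf_pos
        rw [← orderOf_dvd_iff_pow_eq_one]
        interval_cases orderOf (x : (𝓞 F)ˣ) <;> simp
      have h3 : ((x : (𝓞 F)ˣ) : 𝓞 F) ^ 2 = 1 := by
        rw [← Units.val_pow_eq_pow_val, h2, Units.val_one]
      rw [sq_eq_one_iff] at h3
      exact h3.imp (fun h ↦ Units.ext h) (fun h ↦ Units.ext h)
  rw [Units.torsionOrder]
  calc Nat.card (Units.torsion F) ≤ Nat.card ({1, -1} : Set (𝓞 F)ˣ) :=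
        Nat.card_le_card_of_injective (fun x ↦ ⟨x, key x⟩) fun x y hxy ↦
          Subtype.ext (by simpa using hxy)
    _ ≤ 2 := by
        rw [Nat.card_coe_set_eq]
        exact (Set.ncard_insert_le _ _).trans (by simp)

theorem torsionOrder_mul_torsionOrder_le {K K₂ K₃ : Type*} [Field K] [NumberField K]
    [Field K₂] [NumberField K₂] [Field K₃] [NumberField K₃] [Algebra K₂ K] [Algebra K₃ K]
    (h₂ : Module.finrank ℚ K₂ = 2) (h₃ : Module.finrank ℚ K₃ = 2)
    (h₂₃ : Set.range (algebraMap K₂ K) ≠ Set.range (algebraMap K₃ K)) :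
    Units.torsionOrder K₂ * Units.torsionOrder K₃ ≤ 2 * Units.torsionOrder K := by
  let f₂ : (𝓞 K₂)ˣ →* (𝓞 K)ˣ := Units.map (algebraMap (𝓞 K₂) (𝓞 K)).toMonoidHom
  let f₃ : (𝓞 K₃)ˣ →* (𝓞 K)ˣ := Units.map (algebraMap (𝓞 K₃) (𝓞 K)).toMonoidHom
  let g : Units.torsion K₂ × Units.torsion K₃ →* (𝓞 K)ˣ :=
    (f₂.comp (Units.torsion K₂).subtype).coprod (f₃.comp (Units.torsion K₃).subtype)
  have hg (x) : ((g x : 𝓞 K) : K) = algebraMap K₂ K x.1.1 * algebraMap K₃ K x.2.1 := rfl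
  have hker (x : g.ker) : (x.1.1 : (𝓞 K₂)ˣ) ∈ ({1, -1} : Set (𝓞 K₂)ˣ) := by
    have hx : algebraMap K₂ K x.1.1.1 * algebraMap K₃ K x.1.2.1 = 1 := by
      rw [← hg, (MonoidHom.mem_ker (f := g)).mp x.2]
      rfl
    have hrat : (x.1.1.1 : K₂) ∈ Set.range (algebraMap ℚ K₂) := by
      by_contra H
      refine notMem_range_of_range_ne h₂ h₃ h₂₃ H ⟨(x.1.2.1 : K₃)⁻¹, ?_⟩
      rw [map_inv₀]
      exact (eq_inv_of_mul_eq_one_left hx).symm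
    obtain ⟨q, hq⟩ := hrat
    have hfin : IsOfFinOrder (x.1.1 : (𝓞 K₂)ˣ) := (CommGroup.mem_torsion x.1.1.1).mp x.1.1.2
    obtain ⟨n, hn, hn1⟩ := isOfFinOrder_iff_pow_eq_one.mp hfin
    have h1 : (x.1.1.1 : K₂) ^ n = 1 := by
      have := congrArg (fun u : (𝓞 K₂)ˣ ↦ ((u : 𝓞 K₂) : K₂)) hn1
      simpa using this
    have hqn : q ^ n = 1 := by
      apply (algebraMap ℚ K₂).injective
      rw [map_pow, hq, h1, map_one]
    have hq1 : q = 1 ∨ q = -1 := by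
      rcases pow_eq_one_iff_cases.mp hqn with h0 | h0 | h0
      · omega
      · exact Or.inl h0
      · exact Or.inr h0.1
    rcases hq1 with rfl | rfl
    · left
      ext
      simpa using hq.symm
    · right
      ext
      simpa using hq.symm
  have hinj : Function.Injective (fun x : g.ker ↦ (⟨x.1.1, hker x⟩ : ({1, -1} : Set (𝓞 K₂)ˣ))) := by
    intro x y hxy
    have h1 : (x.1.1 : (𝓞 K₂)ˣ) = y.1.1 := by simpa using hxy
    have hx : algebraMap K₂ K x.1.1.1 * algebraMap K₃ K x.1.2.1 = 1 := by
      rw [← hg, (MonoidHom.mem_ker (f := g)).mp x.2]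
      rfl
    have hy : algebraMap K₂ K y.1.1.1 * algebraMap K₃ K y.1.2.1 = 1 := by
      rw [← hg, (MonoidHom.mem_ker (f := g)).mp y.2]
      rfl
    rw [h1, ← hy] at hx
    have h0 : algebraMap K₂ K y.1.1.1 ≠ 0 := left_ne_zero_of_mul (hy ▸ one_ne_zero)
    have h2 := (algebraMap K₃ K).injective (mul_left_cancel₀ h0 hx)
    refine Subtype.ext (Prod.ext (Subtype.ext h1) (Subtype.ext (Units.ext ?_)))
    exact RingOfIntegers.ext h2
  have hcard : Nat.card g.ker ≤ 2 := by
    refine (Nat.card_le_card_of_injective _ hinj).trans ?_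
    rw [Nat.card_coe_set_eq]
    exact (Set.ncard_insert_le _ _).trans (by simp)
  have hrange : Nat.card g.range ≤ Units.torsionOrder K := by
    refine Subgroup.card_le_of_le ?_
    rintro _ ⟨x, rfl⟩
    rw [Units.torsion, CommGroup.mem_torsion]
    refine MonoidHom.isOfFinOrder g ?_
    exact isOfFinOrder_of_finite x
  rw [Units.torsionOrder, Units.torsionOrder, ← Nat.card_prod, ← g.ker.card_mul_index,
    Subgroup.index_ker]
  exact Nat.mul_le_mul hcard hrange

theorem two_mul_discr_natAbs_bound {h w₂ w₃ w Q H D d : ℕ} (hh : 0 < h) (hw₂ : 0 < w₂)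
    (hw₃ : 0 < w₃) (hw : 0 < w) (hQ : 1 ≤ Q) (hd : 0 < d) (hD : D ∣ 2 * d)
    (hwle : w₂ * w₃ ≤ 2 * w) (heq : (h * (w₂ * w₃)) ^ 2 * D = (Q * w * H) ^ 2 * d) : H ≤ 2 * h := by
  obtain ⟨n, hn⟩ := hD
  have h1 : (h * (w₂ * w₃)) ^ 2 * 2 = (Q * w * H) ^ 2 * n := by
    apply Nat.eq_of_mul_eq_mul_left hd
    calc d * ((h * (w₂ * w₃)) ^ 2 * 2) = (h * (w₂ * w₃)) ^ 2 * (2 * d) := by ring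
      _ = ((h * (w₂ * w₃)) ^ 2 * D) * n := by rw [hn]; ring
      _ = _ := by rw [heq]; ring
  have ha : 0 < h * (w₂ * w₃) := by positivity
  have hn1 : n ≠ 1 := by
    rintro rfl
    rw [mul_one] at h1
    have : IsSquare (2 : ℚ) := by
      refine ⟨(Q * w * H : ℕ) / (h * (w₂ * w₃) : ℕ), ?_⟩
      have h2 : ((h * (w₂ * w₃) : ℕ) : ℚ) ^ 2 * 2 = ((Q * w * H : ℕ) : ℚ) ^ 2 := by exact_mod_cast h1
      have h3 : ((h * (w₂ * w₃) : ℕ) : ℚ) ≠ 0 := by exact_mod_cast ha.ne'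
      field_simp
      linarith
    rw [Rat.isSquare_ofNat_iff] at this
    exact Nat.prime_two.not_isSquare this
  have hn0 : n ≠ 0 := by
    rintro rfl
    simp at hn
    omega
  have h2 : (Q * w * H) ^ 2 ≤ (h * (w₂ * w₃)) ^ 2 := by
    have : 2 ≤ n := by omega
    nlinarith [Nat.mul_le_mul_left ((Q * w * H) ^ 2) this]
  have h3 := (Nat.pow_le_pow_iff_left two_ne_zero).mp h2
  have h4 : w * H ≤ w * (2 * h) := by
    calc w * H ≤ Q * (w * H) := Nat.le_mul_of_pos_left _ hQ
      _ = Q * w * H := by ring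
      _ ≤ h * (w₂ * w₃) := h3
      _ ≤ h * (2 * w) := Nat.mul_le_mul_left _ hwle
      _ = _ := by ring
  exact Nat.le_of_mul_le_mul_left h4 hw

theorem regulator_eq_one_of_rank_eq_zero {F : Type*} [Field F] [NumberField F]
    (h : Units.rank F = 0) : Units.regulator F = 1 := by
  classical
  rw [Units.regulator_eq_det']
  have : IsEmpty {w : InfinitePlace F // w ≠ Units.dirichletUnitTheorem.w₀} :=
    ⟨fun w ↦ (Fin.cast h (Units.equivFinRank F |>.symm w)).elim0⟩
  simp

theorem torsionOrder_eq_two_of_nrRealPlaces_ne_zero {F : Type*} [Field F] [NumberField F]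
    (h : InfinitePlace.nrRealPlaces F ≠ 0) : Units.torsionOrder F = 2 := by
  obtain ⟨k, hk⟩ := Units.even_torsionOrder F
  have := torsionOrder_le_two_of_nrRealPlaces_ne_zero h
  have := Units.torsionOrder_pos F
  omega

theorem nrRealPlaces_add_two_mul_nrComplexPlaces_eq_two {F : Type*} [Field F] [NumberField F]
    (h : Module.finrank ℚ F = 2) :
    InfinitePlace.nrRealPlaces F + 2 * InfinitePlace.nrComplexPlaces F = 2 := by
  rw [InfinitePlace.card_add_two_mul_card_eq_rank, h]

theorem dedekindZeta_residue_of_nrComplexPlaces_eq_one {F : Type*} [Field F] [NumberField F]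
    (h : Module.finrank ℚ F = 2) (hc : InfinitePlace.nrComplexPlaces F = 1) :
    dedekindZeta_residue F =
      (2 * Real.pi) * classNumber F / (Units.torsionOrder F * Real.sqrt (discr F).natAbs) := by
  have h1 := nrRealPlaces_add_two_mul_nrComplexPlaces_eq_two h
  have h0 : InfinitePlace.nrRealPlaces F = 0 := by omega
  have hr : Units.rank F = 0 := by
    rw [Units.rank, InfinitePlace.card_eq_nrRealPlaces_add_nrComplexPlaces, h0, hc]
  rw [dedekindZeta_residue_def, h0, hc, regulator_eq_one_of_rank_eq_zero hr, Nat.cast_natAbs,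
    Int.cast_abs]
  simp

theorem dedekindZeta_residue_of_nrRealPlaces_eq_two {F : Type*} [Field F] [NumberField F]
    (hr : InfinitePlace.nrRealPlaces F = 2) (hc : InfinitePlace.nrComplexPlaces F = 0) :
    dedekindZeta_residue F =
      2 * Units.regulator F * classNumber F / Real.sqrt (discr F).natAbs := by
  rw [dedekindZeta_residue_def, hr, hc, torsionOrder_eq_two_of_nrRealPlaces_ne_zero (by omega),
    Nat.cast_natAbs, Int.cast_abs]
  push_cast
  field_simp

theorem dedekindZeta_residue_of_nrComplexPlaces_eq_two {F : Type*} [Field F] [NumberField F]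
    (hr : InfinitePlace.nrRealPlaces F = 0) (hc : InfinitePlace.nrComplexPlaces F = 2) :
    dedekindZeta_residue F = (2 * Real.pi) ^ 2 * Units.regulator F * classNumber F /
      (Units.torsionOrder F * Real.sqrt (discr F).natAbs) := by
  rw [dedekindZeta_residue_def, hr, hc, Nat.cast_natAbs, Int.cast_abs, pow_zero, one_mul]

theorem natCast_natAbs_discr_pos {F : Type*} [Field F] [NumberField F] :
    (0 : ℝ) < (discr F).natAbs :=
  Nat.cast_pos.mpr (Int.natAbs_pos.mpr (discr_ne_zero F))

theorem sq_mul_eq_of_residue_eq {h w h₁ h₂ w₂ h₃ w₃ Q d d₁ d₂ d₃ : ℕ} {R R₁ : ℝ}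
    (hd : (0 : ℝ) < d) (hd₁ : (0 : ℝ) < d₁) (hd₂ : (0 : ℝ) < d₂) (hd₃ : (0 : ℝ) < d₃)
    (hw : 0 < w) (hw₂ : 0 < w₂) (hw₃ : 0 < w₃) (hR : R ≠ 0) (hRQ : R * Q = 2 * R₁)
    (hres : (2 * Real.pi) ^ 2 * R * h / (w * Real.sqrt d) =
      2 * R₁ * h₁ / Real.sqrt d₁ *
        ((2 * Real.pi) * h₂ / (w₂ * Real.sqrt d₂)) *
        ((2 * Real.pi) * h₃ / (w₃ * Real.sqrt d₃))) :
    (h * (w₂ * w₃)) ^ 2 * (d₁ * d₂ * d₃) = (Q * w * (h₁ * h₂ * h₃)) ^ 2 * d := by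
  have hs := Real.sqrt_pos.mpr hd
  have hs₁ := Real.sqrt_pos.mpr hd₁
  have hs₂ := Real.sqrt_pos.mpr hd₂
  have hs₃ := Real.sqrt_pos.mpr hd₃
  have hq := Real.sq_sqrt hd.le
  have hq₁ := Real.sq_sqrt hd₁.le
  have hq₂ := Real.sq_sqrt hd₂.le
  have hq₃ := Real.sq_sqrt hd₃.le
  have hw' : (0 : ℝ) < w := Nat.cast_pos.mpr hw
  have hw₂' : (0 : ℝ) < w₂ := Nat.cast_pos.mpr hw₂
  have hw₃' : (0 : ℝ) < w₃ := Nat.cast_pos.mpr hw₃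
  have hpi := Real.pi_pos
  generalize Real.sqrt d = s at *
  generalize Real.sqrt d₁ = s₁ at *
  generalize Real.sqrt d₂ = s₂ at *
  generalize Real.sqrt d₃ = s₃ at *
  have hR₁ : R₁ = R * Q / 2 := by linarith
  rw [hR₁] at hres
  field_simp at hres
  have key : (h : ℝ) * (w₂ * w₃) * (s₁ * s₂ * s₃) = Q * w * (h₁ * h₂ * h₃) * s := by
    linear_combination hres
  have key2 := congrArg (· ^ 2) key
  simp only [mul_pow, hq, hq₁, hq₂, hq₃] at key2
  rify
  linear_combination key2

theorem classNumber_mul_le_of_isCMField (K K₂ K₃ : Type*) [Field K] [NumberField K]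
    [IsGalois ℚ K] [IsCMField K]
    [Field K₂] [NumberField K₂] [Field K₃] [NumberField K₃] [Algebra K₂ K] [Algebra K₃ K]
    (hK : Module.finrank ℚ K = 4) (hexp : ∀ σ : Gal(K/ℚ), σ ^ 2 = 1)
    (h₂ : Module.finrank ℚ K₂ = 2) (h₃ : Module.finrank ℚ K₃ = 2)
    (h₁₂ : Set.range (algebraMap (maximalRealSubfield K) K) ≠ Set.range (algebraMap K₂ K))
    (h₁₃ : Set.range (algebraMap (maximalRealSubfield K) K) ≠ Set.range (algebraMap K₃ K))
    (h₂₃ : Set.range (algebraMap K₂ K) ≠ Set.range (algebraMap K₃ K))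
    (hc₂ : InfinitePlace.nrComplexPlaces K₂ = 1) (hc₃ : InfinitePlace.nrComplexPlaces K₃ = 1) :
    classNumber (maximalRealSubfield K) * classNumber K₂ * classNumber K₃ ≤ 2 * classNumber K := by
  have h₁ : Module.finrank ℚ (maximalRealSubfield K) = 2 := by
    have := Module.finrank_mul_finrank ℚ (maximalRealSubfield K) K
    rw [Algebra.IsQuadraticExtension.finrank_eq_two (maximalRealSubfield K) K] at this
    omega
  have : Algebra.IsQuadraticExtension ℚ (maximalRealSubfield K) := ⟨h₁⟩
  have : Algebra.IsQuadraticExtension ℚ K₂ := ⟨h₂⟩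
  have : Algebra.IsQuadraticExtension ℚ K₃ := ⟨h₃⟩
  have hres := dedekindZeta_residue_eq_mul_mul_of_forall_prime K (maximalRealSubfield K) K₂ K₃
    fun p hp x ↦ one_sub_pow_inertiaDegIn_of_biquadratic K (maximalRealSubfield K) K₂ K₃ hK hexp
      h₁ h₂ h₃ h₁₂ h₁₃ h₂₃ hp x
  have hdvd := natAbs_discr_mul_discr_mul_discr_dvd K (maximalRealSubfield K) K₂ K₃ hK hexp
      h₁ h₂ h₃ h₁₂ h₁₃ h₂₃
  have hcK : InfinitePlace.nrComplexPlaces K = 2 := by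
    have := IsTotallyComplex.finrank K
    omega
  have hrK : InfinitePlace.nrRealPlaces K = 0 := IsTotallyComplex.nrRealPlaces_eq_zero K
  have hc₁ : InfinitePlace.nrComplexPlaces (maximalRealSubfield K) = 0 :=
    IsTotallyReal.nrComplexPlaces_eq_zero _
  have hr₁ : InfinitePlace.nrRealPlaces (maximalRealSubfield K) = 2 := by
    have := nrRealPlaces_add_two_mul_nrComplexPlaces_eq_two h₁
    omega
  have hrank : Units.rank K = 1 := by
    rw [Units.rank, InfinitePlace.card_eq_nrRealPlaces_add_nrComplexPlaces, hrK, hcK]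
  have hreg := IsCMField.regulator_div_regulator_eq_two_pow_mul_indexRealUnits_inv K
  have hQ : 1 ≤ IsCMField.indexRealUnits K := by
    rcases IsCMField.indexRealUnits_eq_one_or_two K with h | h <;> omega
  rw [dedekindZeta_residue_of_nrComplexPlaces_eq_one h₂ hc₂,
    dedekindZeta_residue_of_nrComplexPlaces_eq_one h₃ hc₃,
    dedekindZeta_residue_of_nrRealPlaces_eq_two hr₁ hc₁,
    dedekindZeta_residue_of_nrComplexPlaces_eq_two hrK hcK] at hres
  have hreg0 : Units.regulator (maximalRealSubfield K) ≠ 0 := Units.regulator_ne_zero _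
  have hregK : Units.regulator K * IsCMField.indexRealUnits K =
      2 * Units.regulator (maximalRealSubfield K) := by
    have : (IsCMField.indexRealUnits K : ℝ) ≠ 0 :=
      Nat.cast_ne_zero.mpr (Nat.one_le_iff_ne_zero.mp hQ)
    rw [hrank, div_eq_iff hreg0] at hreg
    rw [hreg]
    field_simp
  refine two_mul_discr_natAbs_bound (NumberField.classNumber_pos K)
    (Units.torsionOrder_pos K₂) (Units.torsionOrder_pos K₃) (Units.torsionOrder_pos K) hQ
    (by simpa using discr_ne_zero K) hdvd (torsionOrder_mul_torsionOrder_le h₂ h₃ h₂₃) ?_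
  exact sq_mul_eq_of_residue_eq natCast_natAbs_discr_pos natCast_natAbs_discr_pos
    natCast_natAbs_discr_pos natCast_natAbs_discr_pos (Units.torsionOrder_pos K)
    (Units.torsionOrder_pos K₂) (Units.torsionOrder_pos K₃)
    (Units.regulator_ne_zero K) hregK hres

theorem exists_ne_one_forall_isTotallyReal_apply_eq (K : Type*) [Field K] [NumberField K]
    [IsGalois ℚ K] [IsTotallyComplex K] :
    ∃ σ : Gal(K/ℚ), σ ≠ 1 ∧ ∀ (F : Type) [Field F] [NumberField F] [Algebra F K]
      [IsTotallyReal F] (x : F), σ (algebraMap F K x) = algebraMap F K x := by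
  obtain ⟨φ⟩ : Nonempty (K →+* ℂ) := inferInstance
  obtain ⟨σ, hσ⟩ := ComplexEmbedding.exists_comp_symm_eq_of_comp_eq (k := ℚ) φ
    (ComplexEmbedding.conjugate φ) (Subsingleton.elim _ _)
  have happ (x : K) : φ (σ.symm x) = starRingEnd ℂ (φ x) := by
    have := RingHom.congr_fun hσ x
    simpa using this
  refine ⟨σ.symm, fun h ↦ ?_, fun F _ _ _ _ x ↦ φ.injective ?_⟩
  · have hreal : ComplexEmbedding.IsReal φ := by
      ext x
      have := happ x
      rw [h] at this
      simpa using this.symm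
    exact InfinitePlace.not_isReal_iff_isComplex.mpr
      (IsTotallyComplex.isComplex (InfinitePlace.mk φ)) ⟨φ, hreal, rfl⟩
  · rw [happ]
    have h1 := IsTotallyReal.isReal (InfinitePlace.mk (φ.comp (algebraMap F K)))
    rw [InfinitePlace.isReal_mk_iff] at h1
    exact RingHom.congr_fun h1 x

theorem classNumber_mul_le_of_isTotallyReal (K K₁ K₂ K₃ : Type) [Field K] [NumberField K]
    [IsGalois ℚ K] [IsTotallyComplex K] [Field K₁] [NumberField K₁] [IsTotallyReal K₁]
    [Field K₂] [NumberField K₂] [Field K₃] [NumberField K₃]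
    [Algebra K₁ K] [Algebra K₂ K] [Algebra K₃ K]
    (hK : Module.finrank ℚ K = 4) (hexp : ∀ σ : Gal(K/ℚ), σ ^ 2 = 1)
    (h₁ : Module.finrank ℚ K₁ = 2) (h₂ : Module.finrank ℚ K₂ = 2) (h₃ : Module.finrank ℚ K₃ = 2)
    (h₁₂ : Set.range (algebraMap K₁ K) ≠ Set.range (algebraMap K₂ K))
    (h₁₃ : Set.range (algebraMap K₁ K) ≠ Set.range (algebraMap K₃ K))
    (h₂₃ : Set.range (algebraMap K₂ K) ≠ Set.range (algebraMap K₃ K))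
    (hc₂ : InfinitePlace.nrComplexPlaces K₂ = 1) (hc₃ : InfinitePlace.nrComplexPlaces K₃ = 1) :
    classNumber K₁ * classNumber K₂ * classNumber K₃ ≤ 2 * classNumber K := by
  have : Algebra.IsQuadraticExtension K₁ K := ⟨finrank_eq_two_of_biquadratic hK h₁⟩
  have : IsCMField K := IsCMField.ofCMExtension K₁ K
  have hrange : Set.range (algebraMap (maximalRealSubfield K) K) = Set.range (algebraMap K₁ K) := by
    ext x
    constructor
    · rintro ⟨y, rfl⟩
      exact ⟨(CMExtension.equivMaximalRealSubfield K₁ K).symm y,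
        CMExtension.algebraMap_equivMaximalRealSubfield_symm_apply K₁ K y⟩
    · rintro ⟨y, rfl⟩
      exact ⟨CMExtension.equivMaximalRealSubfield K₁ K y,
        CMExtension.equivMaximalRealSubfield_apply K₁ K y⟩
  refine le_trans ?_ (classNumber_mul_le_of_isCMField K K₂ K₃ hK hexp h₂ h₃ (hrange ▸ h₁₂)
    (hrange ▸ h₁₃) h₂₃ hc₂ hc₃)
  gcongr
  exact classNumber_le_of_ringEquiv (CMExtension.equivMaximalRealSubfield K₁ K)

theorem even_nrComplexPlaces_add_of_discr_mul_eq_sq {K₁ K₂ K₃ : Type*} [Field K₁] [NumberField K₁]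
    [Field K₂] [NumberField K₂] [Field K₃] [NumberField K₃] {n : ℤ}
    (h : discr K₁ * discr K₂ * discr K₃ = n ^ 2) :
    Even (InfinitePlace.nrComplexPlaces K₁ + InfinitePlace.nrComplexPlaces K₂ +
      InfinitePlace.nrComplexPlaces K₃) := by
  have hn : n ≠ 0 := by
    rintro rfl
    simp [discr_ne_zero] at h
  have := congrArg Int.sign h
  rw [Int.sign_mul, Int.sign_mul, sign_discr, sign_discr, sign_discr, ← pow_add, ← pow_add,
    Int.sign_eq_one_of_pos (by positivity)] at this
  exact (neg_one_pow_eq_one_iff_even (by norm_num)).mp this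

theorem nrComplexPlaces_ne_zero_of_range_ne {K F E : Type} [Field K] [NumberField K]
    [IsGalois ℚ K] [IsTotallyComplex K] [Field F] [NumberField F] [Field E] [NumberField E]
    [Algebra F K] [Algebra E K] (hF : Module.finrank F K = 2) (hE : Module.finrank E K = 2)
    (h : Set.range (algebraMap F K) ≠ Set.range (algebraMap E K))
    (hc : InfinitePlace.nrComplexPlaces F = 0) : InfinitePlace.nrComplexPlaces E ≠ 0 := by
  intro hc'
  rw [nrComplexPlaces_eq_zero_iff] at hc hc'
  obtain ⟨σ, hσ, hfix⟩ := exists_ne_one_forall_isTotallyReal_apply_eq K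
  exact h ((range_algebraMap_eq_fixedPoints hF hσ (hfix F)).trans
    (range_algebraMap_eq_fixedPoints hE hσ (hfix E)).symm)

theorem classNumber_mul_le_of_biquadratic (K K₁ K₂ K₃ : Type) [Field K] [NumberField K]
    [IsGalois ℚ K] [IsTotallyComplex K] [Field K₁] [NumberField K₁]
    [Field K₂] [NumberField K₂] [Field K₃] [NumberField K₃]
    [Algebra K₁ K] [Algebra K₂ K] [Algebra K₃ K]
    (hK : Module.finrank ℚ K = 4) (hexp : ∀ σ : Gal(K/ℚ), σ ^ 2 = 1)
    (h₁ : Module.finrank ℚ K₁ = 2) (h₂ : Module.finrank ℚ K₂ = 2) (h₃ : Module.finrank ℚ K₃ = 2)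
    (h₁₂ : Set.range (algebraMap K₁ K) ≠ Set.range (algebraMap K₂ K))
    (h₁₃ : Set.range (algebraMap K₁ K) ≠ Set.range (algebraMap K₃ K))
    (h₂₃ : Set.range (algebraMap K₂ K) ≠ Set.range (algebraMap K₃ K)) :
    classNumber K₁ * classNumber K₂ * classNumber K₃ ≤ 2 * classNumber K := by
  obtain ⟨n, hn⟩ := exists_discr_mul_discr_mul_discr_eq_sq K K₁ K₂ K₃ hK h₁ h₂ h₃ h₁₂ h₁₃ h₂₃
  obtain ⟨k, hk⟩ := even_nrComplexPlaces_add_of_discr_mul_eq_sq hn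
  have g₁ := finrank_eq_two_of_biquadratic hK h₁
  have g₂ := finrank_eq_two_of_biquadratic hK h₂
  have g₃ := finrank_eq_two_of_biquadratic hK h₃
  have e₁ := nrRealPlaces_add_two_mul_nrComplexPlaces_eq_two h₁
  have e₂ := nrRealPlaces_add_two_mul_nrComplexPlaces_eq_two h₂
  have e₃ := nrRealPlaces_add_two_mul_nrComplexPlaces_eq_two h₃
  have n₁₂ := nrComplexPlaces_ne_zero_of_range_ne g₁ g₂ h₁₂
  have n₁₃ := nrComplexPlaces_ne_zero_of_range_ne g₁ g₃ h₁₃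
  have n₂₃ := nrComplexPlaces_ne_zero_of_range_ne g₂ g₃ h₂₃
  obtain hc | hc | hc : InfinitePlace.nrComplexPlaces K₁ = 0 ∨
      InfinitePlace.nrComplexPlaces K₂ = 0 ∨ InfinitePlace.nrComplexPlaces K₃ = 0 := by omega
  · have := nrComplexPlaces_eq_zero_iff.mp hc
    exact classNumber_mul_le_of_isTotallyReal K K₁ K₂ K₃ hK hexp h₁ h₂ h₃ h₁₂ h₁₃ h₂₃
      (by omega) (by omega)
  · have := nrComplexPlaces_eq_zero_iff.mp hc
    rw [mul_comm (classNumber K₁)]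
    exact classNumber_mul_le_of_isTotallyReal K K₂ K₁ K₃ hK hexp h₂ h₁ h₃ h₁₂.symm h₂₃ h₁₃
      (by omega) (by omega)
  · have := nrComplexPlaces_eq_zero_iff.mp hc
    rw [mul_comm, ← mul_assoc]
    exact classNumber_mul_le_of_isTotallyReal K K₃ K₁ K₂ hK hexp h₃ h₁ h₂ h₁₃.symm h₂₃.symm h₁₂
      (by omega) (by omega)

theorem isTotallyComplex_of_isEmpty_ringHom_real {K : Type*} [Field K] [NumberField K]
    (h : IsEmpty (K →+* ℝ)) : IsTotallyComplex K where
  isComplex v := by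
    rw [← InfinitePlace.not_isReal_iff_isComplex]
    intro hv
    exact h.false (InfinitePlace.embedding_of_isReal hv)

end

/-- If `K` is an imaginary bicyclic biquadratic field with (pairwise distinct)
quadratic subfields `K₁`, `K₂`, `K₃`, then `h_K ≥ h_{K₁} h_{K₂} h_{K₃} / 2`. -/
theorem classNumber_biquadratic_lower_bound (K : Type) [Field K] [NumberField K]
    [IsGalois ℚ K] (hdeg : Module.finrank ℚ K = 4)
    (hexp : ∀ σ : K ≃ₐ[ℚ] K, σ ^ 2 = 1) (himag : IsEmpty (K →+* ℝ))
    (K₁ K₂ K₃ : Type) [Field K₁] [NumberField K₁] [Field K₂] [NumberField K₂]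
    [Field K₃] [NumberField K₃]
    (h₁ : Module.finrank ℚ K₁ = 2) (h₂ : Module.finrank ℚ K₂ = 2)
    (h₃ : Module.finrank ℚ K₃ = 2)
    (f₁ : K₁ →ₐ[ℚ] K) (f₂ : K₂ →ₐ[ℚ] K) (f₃ : K₃ →ₐ[ℚ] K)
    (hne₁₂ : f₁.range ≠ f₂.range) (hne₁₃ : f₁.range ≠ f₃.range)
    (hne₂₃ : f₂.range ≠ f₃.range) :
    NumberField.classNumber K₁ * NumberField.classNumber K₂ * NumberField.classNumber K₃
      ≤ 2 * NumberField.classNumber K := by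
  have := isTotallyComplex_of_isEmpty_ringHom_real himag
  let _ : Algebra K₁ K := f₁.toRingHom.toAlgebra
  let _ : Algebra K₂ K := f₂.toRingHom.toAlgebra
  let _ : Algebra K₃ K := f₃.toRingHom.toAlgebra
  exact classNumber_mul_le_of_biquadratic K K₁ K₂ K₃ hdeg hexp h₁ h₂ h₃
    (fun h ↦ hne₁₂ (SetLike.coe_injective h)) (fun h ↦ hne₁₃ (SetLike.coe_injective h))
    (fun h ↦ hne₂₃ (SetLike.coe_injective h))
end

section
/- Let K = ℚ(√(-x), √(-y)) be an imaginary bicyclic biquadratic field, where x and y are square-free positive integers, and let d be the square-free part of xy. If d has at least four distinct prime factors, then the class number of K is not equal to 4. -/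
open NumberField
open scoped nonZeroDivisors

section Biquadratic

variable {K : Type*} [Field K] [CharZero K]

theorem biquadratic_coords_eq_zero {x y : ℕ} (hx : 0 < x) (hy : 0 < y)
    (hxy : ¬ IsSquare (x * y)) {α β : K} (hα : α ^ 2 = -(x : K)) (hβ : β ^ 2 = -(y : K))
    {a b c e : ℚ} (h : (a : K) + b * α + c * β + e * (α * β) = 0) :
    a = 0 ∧ b = 0 ∧ c = 0 ∧ e = 0 := by
  have hx' : (0 : ℚ) < x := by exact_mod_cast hx
  have hy' : (0 : ℚ) < y := by exact_mod_cast hy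
  set A : ℚ := a ^ 2 + x * b ^ 2 + y * c ^ 2 + x * y * e ^ 2 with hA
  set B : ℚ := 2 * (a * e - b * c) with hB
  have h1 : (A : K) + B * (α * β) = 0 := by
    rw [hA, hB]
    push_cast
    linear_combination ((a : K) - b * α - c * β + e * (α * β)) * h
      + ((b : K) ^ 2 - e ^ 2 * β ^ 2) * hα + ((c : K) ^ 2 + e ^ 2 * x) * hβ
  have h2 : A ^ 2 = x * y * B ^ 2 := by
    have : ((A ^ 2 : ℚ) : K) = ((x * y * B ^ 2 : ℚ) : K) := by
      push_cast
      linear_combination ((A : K) - B * (α * β)) * h1 + (B : K) ^ 2 * β ^ 2 * hα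
        - (B : K) ^ 2 * x * hβ
    exact_mod_cast this
  have hB0 : B = 0 := by
    by_contra hne
    apply hxy
    rw [← Rat.isSquare_natCast_iff]
    refine ⟨A / B, ?_⟩
    push_cast
    field_simp
    linarith
  have hA0 : A = 0 := by
    rw [hB0] at h2
    simpa using h2
  have ha := sq_nonneg a
  have hb := mul_nonneg hx'.le (sq_nonneg b)
  have hc := mul_nonneg hy'.le (sq_nonneg c)
  have he := mul_nonneg (mul_pos hx' hy').le (sq_nonneg e)
  refine ⟨?_, ?_, ?_, ?_⟩
  · exact pow_eq_zero_iff two_ne_zero |>.1 (by linarith)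
  · exact pow_eq_zero_iff two_ne_zero |>.1
      ((mul_eq_zero.1 (show (x : ℚ) * b ^ 2 = 0 by linarith)).resolve_left hx'.ne')
  · exact pow_eq_zero_iff two_ne_zero |>.1
      ((mul_eq_zero.1 (show (y : ℚ) * c ^ 2 = 0 by linarith)).resolve_left hy'.ne')
  · exact pow_eq_zero_iff two_ne_zero |>.1
      ((mul_eq_zero.1 (show (x : ℚ) * y * e ^ 2 = 0 by linarith)).resolve_left
        (mul_pos hx' hy').ne')

variable {x y : ℕ} (hx : 0 < x) (hy : 0 < y) (hxy : ¬ IsSquare (x * y)) {α β : K}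
  (hα : α ^ 2 = -(x : K)) (hβ : β ^ 2 = -(y : K)) (hdeg : Module.finrank ℚ K = 4)

include hx hy hxy hα hβ hdeg

theorem exists_biquadratic_basis :
    ∃ b : Module.Basis (Fin 4) ℚ K, b 0 = 1 ∧ b 1 = α ∧ b 2 = β ∧ b 3 = α * β := by
  have hli : LinearIndependent ℚ ![(1 : K), α, β, α * β] := by
    rw [Fintype.linearIndependent_iff]
    intro g hg
    simp only [Fin.sum_univ_four, Matrix.cons_val, Algebra.smul_def, mul_one, eq_ratCast] at hg
    obtain ⟨h0, h1, h2, h3⟩ := biquadratic_coords_eq_zero hx hy hxy hα hβ hg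
    intro i
    fin_cases i <;> assumption
  refine ⟨basisOfLinearIndependentOfCardEqFinrank hli (by simp [hdeg]), ?_, ?_, ?_, ?_⟩ <;>
    simp [coe_basisOfLinearIndependentOfCardEqFinrank]

theorem exists_biquadratic_coords (z : K) :
    ∃ a b c e : ℚ, z = a + b * α + c * β + e * (α * β) := by
  obtain ⟨v, h0, h1, h2, h3⟩ := exists_biquadratic_basis hx hy hxy hα hβ hdeg
  refine ⟨v.repr z 0, v.repr z 1, v.repr z 2, v.repr z 3, ?_⟩
  conv_lhs => rw [← v.sum_repr z]
  simp [Fin.sum_univ_four, Algebra.smul_def, h0, h1, h2, h3]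

theorem biquadratic_norm_trace (a b c e : ℚ) :
    Algebra.norm ℚ ((a : K) + b * α + c * β + e * (α * β)) =
      (a ^ 2 + x * b ^ 2 + y * c ^ 2 + x * y * e ^ 2) ^ 2
        - x * y * (2 * (a * e - b * c)) ^ 2 ∧
    Algebra.trace ℚ K ((a : K) + b * α + c * β + e * (α * β)) = 4 * a := by
  obtain ⟨v, h0, h1, h2, h3⟩ := exists_biquadratic_basis hx hy hxy hα hβ hdeg
  have hM : Algebra.leftMulMatrix v ((a : K) + b * α + c * β + e * (α * β)) =
      !![a, -x * b, -y * c, x * y * e; b, a, -y * e, -y * c; c, -x * e, a, -x * b;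
        e, c, b, a] := by
    rw [Algebra.leftMulMatrix_apply, ← LinearEquiv.eq_symm_apply, LinearMap.toMatrix_symm]
    refine v.ext fun i => ?_
    rw [Matrix.toLin_self]
    fin_cases i <;>
      simp [Fin.sum_univ_four, Algebra.smul_def, h0, h1, h2, h3]
    · linear_combination ((b : K) + e * β) * hα
    · linear_combination ((c : K) + e * α) * hβ
    · linear_combination ((b : K) * β + e * β ^ 2) * hα + ((c : K) * α - e * x) * hβ
  constructor
  · rw [Algebra.norm_eq_matrix_det v, hM]
    simp [Matrix.det_succ_row_zero, Fin.sum_univ_succ, Fin.succAbove]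
    ring
  · rw [Algebra.trace_eq_matrix_trace v, hM]
    simp [Matrix.trace, Fin.sum_univ_four]
    ring

theorem exists_norm_eq_sq_sub {d m : ℕ} (hd : x * y = d * m ^ 2) (z : K) :
    0 ≤ Algebra.norm ℚ z ∧ ∃ u v : ℚ, Algebra.norm ℚ z = u ^ 2 - d * v ^ 2 := by
  obtain ⟨a, b, c, e, rfl⟩ := exists_biquadratic_coords hx hy hxy hα hβ hdeg z
  rw [(biquadratic_norm_trace hx hy hxy hα hβ hdeg a b c e).1]
  have hd' : (x : ℚ) * y = d * m ^ 2 := by exact_mod_cast hd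
  constructor
  · have hxp : (0 : ℚ) ≤ x := x.cast_nonneg
    have hyp : (0 : ℚ) ≤ y := y.cast_nonneg
    have key : (a ^ 2 + x * b ^ 2 + y * c ^ 2 + x * y * e ^ 2) ^ 2
        - x * y * (2 * (a * e - b * c)) ^ 2 =
        (a ^ 2 + x * b ^ 2 - y * c ^ 2 - x * y * e ^ 2) ^ 2
        + 4 * y * (a * c + x * b * e) ^ 2 := by ring
    rw [key]
    positivity
  · refine ⟨a ^ 2 + x * b ^ 2 + y * c ^ 2 + x * y * e ^ 2, m * (2 * (a * e - b * c)), ?_⟩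
    linear_combination -(2 * (a * e - b * c)) ^ 2 * hd'

theorem isSquare_or_of_sq_eq_natCast {n : ℕ} (hn : 0 < n) {z : K} (hz : z ^ 2 = n) :
    IsSquare n ∨ IsSquare (n * (x * y)) := by
  obtain ⟨a, b, c, e, rfl⟩ := exists_biquadratic_coords hx hy hxy hα hβ hdeg z
  have hx' : (0 : ℚ) < x := by exact_mod_cast hx
  have hy' : (0 : ℚ) < y := by exact_mod_cast hy
  have hn' : (0 : ℚ) < n := by exact_mod_cast hn
  obtain ⟨h0, h1, h2, h3⟩ := biquadratic_coords_eq_zero hx hy hxy hα hβ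
    (a := a ^ 2 - x * b ^ 2 - y * c ^ 2 + x * y * e ^ 2 - n) (b := 2 * (a * b - y * c * e))
    (c := 2 * (a * c - x * b * e)) (e := 2 * (a * e + b * c)) (by
      push_cast
      linear_combination hz - ((b : K) ^ 2 + e ^ 2 * β ^ 2 + 2 * b * e * β) * hα
        - ((c : K) ^ 2 - e ^ 2 * x + 2 * c * e * α) * hβ)
  rw [← Rat.isSquare_natCast_iff, ← Rat.isSquare_natCast_iff]
  rcases eq_or_ne e 0 with rfl | he
  · rcases eq_or_ne a 0 with rfl | ha
    · nlinarith [mul_nonneg hx'.le (sq_nonneg b), mul_nonneg hy'.le (sq_nonneg c)]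
    · have hb : b = 0 := by simpa [ha] using h1
      have hc : c = 0 := by simpa [ha] using h2
      subst hb hc
      exact Or.inl ⟨a, by linarith⟩
  · have hac : e * (a ^ 2 + y * c ^ 2) = 0 := by linear_combination a * h3 / 2 - c * h1 / 2
    have hac' := (mul_eq_zero.1 hac).resolve_left he
    have hc2 := mul_nonneg hy'.le (sq_nonneg c)
    have ha : a = 0 := pow_eq_zero_iff two_ne_zero |>.1 (by linarith [sq_nonneg a])
    have hc : c = 0 := pow_eq_zero_iff two_ne_zero |>.1
      ((mul_eq_zero.1 (show (y : ℚ) * c ^ 2 = 0 by linarith [sq_nonneg a])).resolve_left hy'.ne')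
    subst ha hc
    have hb : b = 0 := by simpa [he, hx'.ne'] using h2
    subst hb
    refine Or.inr ⟨x * y * e, ?_⟩
    push_cast
    linear_combination -(x * y : ℚ) * h0

end Biquadratic

/-- `n` is of the form `u ^ 2 - d * v ^ 2` with rational `u` and `v`. -/
def IsRatNorm (d : ℕ) (n : ℚ) : Prop := ∃ u v : ℚ, n = u ^ 2 - d * v ^ 2

theorem IsRatNorm.mul_sq {d : ℕ} {n : ℚ} (h : IsRatNorm d n) (w : ℚ) :
    IsRatNorm d (n * w ^ 2) := by
  obtain ⟨u, v, rfl⟩ := h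
  exact ⟨u * w, v * w, by ring⟩

theorem isSquare_zmod_of_mul_sq_eq {p d n : ℕ} (hp : p.Prime) (hd : Squarefree d) (hpd : p ∣ d)
    (w : ℕ) (hw : w ≠ 0) (u v : ℤ) (h : (n : ℤ) * w ^ 2 = u ^ 2 - d * v ^ 2) :
    IsSquare (n : ZMod p) := by
  have := Fact.mk hp
  have hpz := Nat.prime_iff_prime_int.1 hp
  induction w using Nat.strong_induction_on generalizing u v with
  | _ w ih =>
    have hmod : (n : ZMod p) * w ^ 2 = u ^ 2 := by
      have := congrArg (Int.cast : ℤ → ZMod p) h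
      push_cast at this
      rw [this, (ZMod.natCast_eq_zero_iff d p).2 hpd]
      ring
    by_cases hpw : p ∣ w
    · obtain ⟨w, rfl⟩ := hpw
      have hu : (p : ℤ) ∣ u := by
        rw [← ZMod.intCast_zmod_eq_zero_iff_dvd]
        push_cast at hmod
        simpa using hmod.symm
      obtain ⟨u, rfl⟩ := hu
      obtain ⟨k, rfl⟩ := hpd
      have hpk : ¬ p ∣ k := fun hk => by
        have := hd p (mul_dvd_mul_left p hk)
        exact hp.one_lt.ne' (Nat.isUnit_iff.1 this)
      have hp0 : (p : ℤ) ≠ 0 := by exact_mod_cast hp.ne_zero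
      have hv : (p : ℤ) ∣ k * v ^ 2 := by
        refine ⟨u ^ 2 - n * w ^ 2, mul_left_cancel₀ hp0 ?_⟩
        push_cast at h
        linear_combination h
      have hv' : (p : ℤ) ∣ v := hpz.dvd_of_dvd_pow
        ((hpz.dvd_or_dvd hv).resolve_left (by exact_mod_cast hpk))
      obtain ⟨v, rfl⟩ := hv'
      have hw0 : w ≠ 0 := right_ne_zero_of_mul hw
      refine ih w ?_ hw0 u v ?_
      · exact lt_mul_of_one_lt_left (Nat.pos_of_ne_zero hw0) hp.one_lt
      · refine mul_left_cancel₀ (pow_ne_zero 2 hp0) ?_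
        push_cast at h ⊢
        linear_combination h
    · have hw0 : (w : ZMod p) ≠ 0 := by rwa [Ne, ZMod.natCast_eq_zero_iff]
      refine ⟨u / w, ?_⟩
      field_simp
      exact hmod

theorem IsRatNorm.isSquare_zmod {p d n : ℕ} (hp : p.Prime) (hd : Squarefree d) (hpd : p ∣ d)
    (h : IsRatNorm d n) : IsSquare (n : ZMod p) := by
  obtain ⟨u, v, h⟩ := h
  refine isSquare_zmod_of_mul_sq_eq hp hd hpd (u.den * v.den)
    (mul_ne_zero u.den_ne_zero v.den_ne_zero) (u.num * v.den) (v.num * u.den) ?_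
  have hu := u.num_div_den
  have hv := v.num_div_den
  have hu0 : (u.den : ℚ) ≠ 0 := by exact_mod_cast u.den_ne_zero
  have hv0 : (v.den : ℚ) ≠ 0 := by exact_mod_cast v.den_ne_zero
  rw [← hu, ← hv] at h
  have : ((n : ℤ) : ℚ) * ((u.den * v.den : ℕ) : ℚ) ^ 2 =
      ((u.num * v.den : ℤ) : ℚ) ^ 2 - (d : ℤ) * ((v.num * u.den : ℤ) : ℚ) ^ 2 := by
    push_cast
    rw [h]
    field_simp
  exact_mod_cast this

theorem not_isRatNorm_of_jacobiSym_eq_neg_one {p d n : ℕ} (hp : p.Prime) (hd : Squarefree d)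
    (hpd : p ∣ d) (hn : jacobiSym n p = -1) : ¬ IsRatNorm d n := fun h =>
  ZMod.nonsquare_of_jacobiSym_eq_neg_one hn (by simpa using h.isSquare_zmod hp hd hpd)

/-- Prescribing Legendre symbols at finitely many primes. -/
theorem exists_prime_jacobiSym_eq {M : Finset ℕ} (hM : ∀ l ∈ M, l.Prime) (S : Finset ℕ) (N : ℕ) :
    ∃ q : ℕ, q.Prime ∧ N < q ∧ q % 4 = 1 ∧
      (∀ l ∈ M, jacobiSym l q = if l ∈ S then -1 else 1) ∧
      ∀ l ∈ M, l ≠ 2 → jacobiSym q l = if l ∈ S then -1 else 1 := by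
  have hres : ∀ l : ℕ, ∃ a : ℕ, (l.Prime → a.Coprime l) ∧ (l = 2 → a % 8 = if 2 ∈ S then 5 else 1) ∧
      (l.Prime → l ≠ 2 → jacobiSym a l = if l ∈ S then -1 else 1) := by
    intro l
    by_cases hl : l.Prime
    swap
    · exact ⟨if 2 ∈ S then 5 else 1, by simp [hl], fun _ => by split_ifs <;> rfl, by simp [hl]⟩
    rcases eq_or_ne l 2 with rfl | h2
    · exact ⟨if 2 ∈ S then 5 else 1, fun _ => by split_ifs <;> decide,
        fun _ => by split_ifs <;> rfl, by simp⟩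
    have := Fact.mk hl
    by_cases hS : l ∈ S
    · obtain ⟨a, ha⟩ := quadraticChar_exists_neg_one (F := ZMod l) (by rwa [ZMod.ringChar_zmod_n])
      have ha' : jacobiSym a.val l = -1 := by
        rw [← jacobiSym.legendreSym.to_jacobiSym, legendreSym]
        simpa using ha
      refine ⟨a.val, fun _ => ?_, by simp [h2], fun _ _ => by rwa [if_pos hS]⟩
      by_contra hc
      have := jacobiSym.eq_zero_iff_not_coprime (a := a.val) (b := l) |>.2
        (by rwa [Int.gcd_natCast_natCast])
      omega
    · exact ⟨1, by simp, by simp [h2], by simp [hS]⟩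
  choose a hac ha2 hal using hres
  set s : ℕ → ℕ := fun l => if l = 2 then 8 else l with hs
  set T := insert 2 M with hT
  have hTp : ∀ l ∈ T, l.Prime := by
    intro l hl
    rcases Finset.mem_insert.1 hl with rfl | h
    exacts [Nat.prime_two, hM l h]
  have hs0 : ∀ l ∈ T, s l ≠ 0 := by
    intro l hl
    simp only [hs]
    split_ifs
    exacts [by norm_num, (hTp l hl).ne_zero]
  have hsc : ∀ l ∈ T, ∀ k : ℕ, k.Coprime l → k.Coprime (s l) := by
    intro l _ k hk
    simp only [hs]
    split_ifs with h
    · subst h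
      exact Nat.Coprime.pow_right 3 hk
    · exact hk
  have hpw : Set.Pairwise (T : Set ℕ) (Function.onFun Nat.Coprime s) := by
    intro l hl k hk hne
    exact hsc k hk _ ((hsc l hl _ ((Nat.coprime_primes (hTp k hk) (hTp l hl)).2 hne.symm)).symm)
  obtain ⟨r, hr⟩ := Nat.chineseRemainderOfFinset a s T hs0 hpw
  have hrc : r.Coprime (∏ l ∈ T, s l) := by
    refine Nat.Coprime.prod_right fun l hl => ?_
    have := hsc l hl _ (hac l (hTp l hl))
    rw [Nat.Coprime, (hr l hl).gcd_eq]
    exact this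
  obtain ⟨q, hqN, hq, hqr⟩ := Nat.forall_exists_prime_gt_and_modEq N
    (Finset.prod_ne_zero_iff.2 hs0) hrc
  have hql : ∀ l ∈ T, q ≡ a l [MOD s l] := fun l hl =>
    (hqr.of_dvd (Finset.dvd_prod_of_mem s hl)).trans (hr l hl)
  have hq8 : q % 8 = if 2 ∈ S then 5 else 1 := by
    rw [← ha2 2 rfl]
    exact hql 2 (Finset.mem_insert_self _ _)
  have hq4 : q % 4 = 1 := by
    split_ifs at hq8 <;> omega
  have hodd : Odd q := Nat.odd_iff.2 (by omega)
  have hfin : ∀ l ∈ M, l ≠ 2 → jacobiSym q l = if l ∈ S then -1 else 1 := by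
    intro l hl h2
    rw [← hal l (hM l hl) h2]
    have := hql l (Finset.mem_insert_of_mem hl)
    simp only [hs, h2, if_false] at this
    rw [jacobiSym.mod_left, jacobiSym.mod_left (a l : ℤ)]
    congr 1
    exact_mod_cast this
  refine ⟨q, hq, hqN, hq4, fun l hl => ?_, hfin⟩
  rcases eq_or_ne l 2 with rfl | h2
  · rw [Nat.cast_two, jacobiSym.at_two hodd, ZMod.χ₈_nat_mod_eight, hq8]
    split_ifs <;> decide
  · rw [← hfin l hl h2, jacobiSym.quadratic_reciprocity_one_mod_four hq4
      ((hM l hl).odd_of_ne_two h2)]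

theorem jacobiSym_eq_one_of_even {x q : ℕ} (hx : Squarefree x) {S : Finset ℕ}
    (hS : Even (S ∩ x.primeFactors).card)
    (h : ∀ l ∈ x.primeFactors, jacobiSym l q = if l ∈ S then -1 else 1) :
    jacobiSym x q = 1 := by
  have hprod : ∀ T : Finset ℕ, jacobiSym (∏ l ∈ T, l : ℕ) q = ∏ l ∈ T, jacobiSym l q := by
    intro T
    induction T using Finset.induction_on with
    | empty => simp
    | insert a T ha ih =>
      rw [Finset.prod_insert ha, Finset.prod_insert ha, Nat.cast_mul, jacobiSym.mul_left, ih]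
  rw [← Nat.prod_primeFactors_of_squarefree hx, hprod, Finset.prod_congr rfl h, Finset.prod_ite]
  rw [Finset.filter_mem_eq_inter, Finset.inter_comm]
  simp [hS.neg_one_pow]

theorem exists_independent_even_subsets {A B : Finset ℕ} (hAB : Disjoint A B)
    (hcard : 4 ≤ A.card + B.card) :
    ∃ S T : Finset ℕ, Even (S ∩ A).card ∧ Even (S ∩ B).card ∧ Even (T ∩ A).card ∧
      Even (T ∩ B).card ∧ S ⊆ A ∪ B ∧ T ⊆ A ∪ B ∧ (∃ l ∈ S, l ≠ 2) ∧ (∃ l ∈ T, l ≠ 2) ∧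
      ∃ l ∈ A ∪ B, l ≠ 2 ∧ (l ∈ S ↔ l ∉ T) := by
  have hodd : ∀ {a b : ℕ}, a ≠ b → ∃ l ∈ ({a, b} : Finset ℕ), l ≠ 2 := by
    intro a b hab
    rcases eq_or_ne a 2 with rfl | ha
    · exact ⟨b, by simp, hab.symm⟩
    · exact ⟨a, by simp, ha⟩
  have hev : ∀ {C D : Finset ℕ} {a b : ℕ}, Disjoint C D → a ∈ C → b ∈ C → a ≠ b →
      Even (({a, b} : Finset ℕ) ∩ C).card ∧ Even (({a, b} : Finset ℕ) ∩ D).card := by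
    intro C D a b hCD ha hb hab
    have h1 : ({a, b} : Finset ℕ) ∩ C = {a, b} := by
      rw [Finset.inter_eq_left]
      simp [Finset.insert_subset_iff, ha, hb]
    have h2 : ({a, b} : Finset ℕ) ∩ D = ∅ := by
      rw [← Finset.disjoint_iff_inter_eq_empty]
      exact hCD.mono_left (by simp [Finset.insert_subset_iff, ha, hb])
    rw [h1, h2, Finset.card_pair hab]
    decide
  have three : ∀ {C D : Finset ℕ}, Disjoint C D → 2 < C.card →
      ∃ S T : Finset ℕ, Even (S ∩ C).card ∧ Even (S ∩ D).card ∧ Even (T ∩ C).card ∧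
      Even (T ∩ D).card ∧ S ⊆ C ∪ D ∧ T ⊆ C ∪ D ∧ (∃ l ∈ S, l ≠ 2) ∧ (∃ l ∈ T, l ≠ 2) ∧
      ∃ l ∈ C ∪ D, l ≠ 2 ∧ (l ∈ S ↔ l ∉ T) := by
    intro C D hCD hC
    obtain ⟨a, b, c, ha, hb, hc, hab, hac, hbc⟩ := Finset.two_lt_card_iff.1 hC
    refine ⟨{a, b}, {a, c}, (hev hCD ha hb hab).1, (hev hCD ha hb hab).2, (hev hCD ha hc hac).1,
      (hev hCD ha hc hac).2, by grind, by grind, hodd hab, hodd hac, ?_⟩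
    obtain ⟨l, hl, hl2⟩ := hodd hbc
    exact ⟨l, by grind, hl2, by grind⟩
  by_cases hA : 2 < A.card
  · exact three hAB hA
  by_cases hB : 2 < B.card
  · obtain ⟨S, T, h1, h2, h3, h4, h5, h6, h7⟩ := three hAB.symm hB
    rw [Finset.union_comm] at h5 h6 h7
    exact ⟨S, T, h2, h1, h4, h3, h5, h6, h7⟩
  obtain ⟨a, b, ha, hb, hab⟩ := Finset.one_lt_card_iff.1 (show 1 < A.card by omega)
  obtain ⟨c, e, hc, he, hce⟩ := Finset.one_lt_card_iff.1 (show 1 < B.card by omega)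
  refine ⟨{a, b}, {c, e}, (hev hAB ha hb hab).1, (hev hAB ha hb hab).2, (hev hAB.symm hc he hce).2,
    (hev hAB.symm hc he hce).1, by grind, by grind, hodd hab, hodd hce, ?_⟩
  obtain ⟨l, hl, hl2⟩ := hodd hab
  have hlA : l ∈ A := by grind
  have hlB := Finset.disjoint_left.1 hAB hlA
  exact ⟨l, by grind, hl2, by grind⟩

section RingOfIntegers

variable {K : Type*} [Field K] [NumberField K] {x y : ℕ} (hx : 0 < x) (hy : 0 < y)
  (hxy : ¬ IsSquare (x * y)) {α β : K}
  (hα : α ^ 2 = -(x : K)) (hβ : β ^ 2 = -(y : K)) (hdeg : Module.finrank ℚ K = 4)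

include hx hy hxy hα hβ hdeg

theorem isRatNorm_of_mk0_eq {d m : ℕ} (hd : x * y = d * m ^ 2) {I J : (Ideal (𝓞 K))⁰}
    (h : ClassGroup.mk0 I = ClassGroup.mk0 J) :
    IsRatNorm d (Ideal.absNorm (I : Ideal (𝓞 K)) * Ideal.absNorm (J : Ideal (𝓞 K))) := by
  obtain ⟨s, t, hs, ht, hst⟩ := ClassGroup.mk0_eq_mk0_iff.1 h
  have hN := congrArg (fun I => (Ideal.absNorm I : ℚ)) hst
  simp only [map_mul, Nat.cast_mul, Ideal.absNorm_span_singleton] at hN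
  have hnorm : ∀ r : 𝓞 K, (((Algebra.norm ℤ r).natAbs : ℕ) : ℚ) = Algebra.norm ℚ (r : K) := by
    intro r
    have h0 := (exists_norm_eq_sq_sub hx hy hxy hα hβ hdeg hd (r : K)).1
    rw [← Algebra.coe_norm_int] at h0 ⊢
    rw [Nat.cast_natAbs, abs_of_nonneg (by exact_mod_cast h0)]
  rw [hnorm, hnorm] at hN
  obtain ⟨-, u, v, huv⟩ := exists_norm_eq_sq_sub hx hy hxy hα hβ hdeg hd ((s : K) * (t : K))
  have hs0 : Algebra.norm ℚ (s : K) ≠ 0 := by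
    rw [Algebra.norm_ne_zero_iff]
    exact_mod_cast hs
  have key : (Ideal.absNorm (I : Ideal (𝓞 K)) * Ideal.absNorm (J : Ideal (𝓞 K)) : ℚ) =
      Algebra.norm ℚ ((s : K) * (t : K)) *
        (Ideal.absNorm (J : Ideal (𝓞 K)) / Algebra.norm ℚ (s : K)) ^ 2 := by
    rw [map_mul]
    field_simp
    linear_combination (Ideal.absNorm (J : Ideal (𝓞 K)) : ℚ) * hN
  rw [key]
  exact IsRatNorm.mul_sq ⟨u, v, huv⟩ _

theorem exists_int_coords {A B : 𝓞 K} (hA : (A : K) = α) (hB : (B : K) = β) (z : 𝓞 K) :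
    ∃ a b c e : ℤ, ((4 * x * y : ℕ) : 𝓞 K) * z = a + b * A + c * B + e * (A * B) := by
  obtain ⟨a, b, c, e, hz⟩ := exists_biquadratic_coords hx hy hxy hα hβ hdeg (z : K)
  have htr := fun a b c e => (biquadratic_norm_trace hx hy hxy hα hβ hdeg a b c e).2
  have h1 := Algebra.coe_trace_int z
  have h2 := Algebra.coe_trace_int (z * A)
  have h3 := Algebra.coe_trace_int (z * B)
  have h4 := Algebra.coe_trace_int (z * (A * B))
  have e2 : ((z * A : 𝓞 K) : K) = ((-x * b : ℚ) : K) + (a : ℚ) * α + (-x * e : ℚ) * β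
      + (c : ℚ) * (α * β) := by
    change (z : K) * (A : K) = _
    rw [hA, hz]
    push_cast
    linear_combination ((b : K) + e * β) * hα
  have e3 : ((z * B : 𝓞 K) : K) = ((-y * c : ℚ) : K) + (-y * e : ℚ) * α + (a : ℚ) * β
      + (b : ℚ) * (α * β) := by
    change (z : K) * (B : K) = _
    rw [hB, hz]
    push_cast
    linear_combination ((c : K) + e * α) * hβ
  have e4 : ((z * (A * B) : 𝓞 K) : K) = ((x * y * e : ℚ) : K) + (-y * c : ℚ) * α
      + (-x * b : ℚ) * β + (a : ℚ) * (α * β) := by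
    change (z : K) * ((A : K) * (B : K)) = _
    rw [hA, hB, hz]
    push_cast
    linear_combination ((b : K) * β + e * β ^ 2) * hα + ((c : K) * α - e * x) * hβ
  rw [hz, htr] at h1
  rw [e2, htr] at h2
  rw [e3, htr] at h3
  rw [e4, htr] at h4
  refine ⟨x * y * Algebra.trace ℤ _ z, - y * Algebra.trace ℤ _ (z * A),
    - x * Algebra.trace ℤ _ (z * B), Algebra.trace ℤ _ (z * (A * B)), ?_⟩
  apply RingOfIntegers.ext
  replace h1 := congrArg (Rat.cast : ℚ → K) h1
  replace h2 := congrArg (Rat.cast : ℚ → K) h2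
  replace h3 := congrArg (Rat.cast : ℚ → K) h3
  replace h4 := congrArg (Rat.cast : ℚ → K) h4
  push_cast at h1 h2 h3 h4
  simp only [map_mul, map_add, map_natCast, map_intCast, map_neg, Int.cast_mul, Int.cast_natCast,
    Int.cast_neg, hA, hB, Nat.cast_mul, Nat.cast_ofNat, map_ofNat, h1, h2, h3, h4, hz]
  ring

theorem exists_ideal_absNorm_eq {q : ℕ} (hq : q.Prime) (hq4 : ¬ q ∣ 4 * x * y)
    (hqx : IsSquare (-x : ZMod q)) (hqy : IsSquare (-y : ZMod q)) :
    ∃ I : Ideal (𝓞 K), Ideal.absNorm I = q := by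
  have hint : ∀ {n : ℕ} {γ : K}, γ ^ 2 = -(n : K) → IsIntegral ℤ γ := by
    intro n γ h
    exact IsIntegral.of_pow two_pos (h ▸ (isIntegral_natCast n).neg)
  obtain ⟨A, hA⟩ : ∃ A : 𝓞 K, (A : K) = α := ⟨⟨α, hint hα⟩, rfl⟩
  obtain ⟨B, hB⟩ : ∃ B : 𝓞 K, (B : K) = β := ⟨⟨β, hint hβ⟩, rfl⟩
  have hA2 : A ^ 2 = -(x : 𝓞 K) := RingOfIntegers.ext (by simp [hA, hα])
  have hB2 : B ^ 2 = -(y : 𝓞 K) := RingOfIntegers.ext (by simp [hB, hβ])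
  have hfact := Fact.mk hq
  have hnu : ¬ IsUnit ((q : ℕ) : 𝓞 K) := by
    intro hu
    have h1 := Ideal.absNorm_span_natCast (S := 𝓞 K) q
    rw [Ideal.span_singleton_eq_top.2 hu, Ideal.absNorm_top, RingOfIntegers.rank, hdeg] at h1
    exact hq.one_lt.ne (Nat.pow_left_injective (n := 4) (by norm_num) (by simpa using h1))
  obtain ⟨I, hI, hqI⟩ := exists_max_ideal_of_mem_nonunits hnu
  refine ⟨I, ?_⟩
  let k := 𝓞 K ⧸ I
  let f : 𝓞 K →+* k := Ideal.Quotient.mk I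
  let _ : Field k := Ideal.Quotient.field I
  have hfq : ((q : ℕ) : k) = 0 := by
    rw [← map_natCast f]
    exact Ideal.Quotient.eq_zero_iff_mem.2 hqI
  have hchar : CharP k q := (CharP.charP_iff_prime_eq_zero hq).2 hfq
  let g : ZMod q →+* k := ZMod.castHom dvd_rfl k
  have hroot : ∀ {n : ℕ} {C : 𝓞 K}, IsSquare (-n : ZMod q) → C ^ 2 = -(n : 𝓞 K) →
      ∃ r, g r = f C := by
    rintro n C ⟨r, hr⟩ hC
    have h1 : f C ^ 2 = g r ^ 2 := by
      rw [← map_pow, hC, ← map_pow, pow_two, ← hr]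
      simp
    rcases sq_eq_sq_iff_eq_or_eq_neg.1 h1 with h | h
    exacts [⟨r, h.symm⟩, ⟨-r, by rw [map_neg, h]⟩]
  obtain ⟨r, hr⟩ := hroot hqx hA2
  obtain ⟨s, hs⟩ := hroot hqy hB2
  have hsurj : Function.Surjective g := by
    intro z
    obtain ⟨z, rfl⟩ := Ideal.Quotient.mk_surjective z
    obtain ⟨a, b, c, e, h⟩ := exists_int_coords hx hy hxy hα hβ hdeg hA hB z
    refine ⟨(a + b * r + c * s + e * (r * s)) / ((4 * x * y : ℕ) : ZMod q), ?_⟩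
    have h0 : ((4 * x * y : ℕ) : ZMod q) ≠ 0 := by rwa [Ne, ZMod.natCast_eq_zero_iff]
    have h0' : g ((4 * x * y : ℕ) : ZMod q) ≠ 0 := (map_ne_zero g).2 h0
    rw [map_div₀, div_eq_iff h0']
    have h1 := congrArg f h
    simp only [map_mul, map_add, map_natCast, map_intCast, ← hr, ← hs] at h1 ⊢
    rw [← h1, mul_comm]
  rw [Ideal.absNorm_apply, Submodule.cardQuot_apply,
    ← Nat.card_eq_of_bijective g ⟨g.injective, hsurj⟩, Nat.card_zmod]

end RingOfIntegers

section Units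

variable {K : Type*} [Field K] [NumberField K]

theorem exists_units_isSquare_mul_of_eq (hdeg : Module.finrank ℚ K = 4) {x : ℕ} (hx : 0 < x)
    {α : K} (hα : α ^ 2 = -(x : K)) :
    ∃ f : (𝓞 K)ˣ → ZMod 2 × ZMod 2, ∀ u v, f u = f v → IsSquare (u * v) := by
  have hC : IsTotallyComplex K := by
    refine ⟨fun v => ?_⟩
    rw [← InfinitePlace.not_isReal_iff_isComplex]
    intro hv
    have h := congrArg (InfinitePlace.embedding_of_isReal hv) hα
    rw [map_pow, map_neg, map_natCast] at h
    have hx' : (0 : ℝ) < x := by exact_mod_cast hx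
    nlinarith [sq_nonneg (InfinitePlace.embedding_of_isReal hv α)]
  have hrank : Units.rank K = 1 := by
    have h1 := IsTotallyComplex.finrank (K := K)
    rw [Units.rank, InfinitePlace.card_eq_nrRealPlaces_add_nrComplexPlaces,
      IsTotallyComplex.nrRealPlaces_eq_zero]
    omega
  obtain ⟨ω, hω⟩ := IsCyclic.exists_generator (α := Units.torsion K)
  have hrep : ∀ u : (𝓞 K)ˣ, ∃ i : ℤ, ∃ j : ℤ,
      u = (ω : (𝓞 K)ˣ) ^ i * Units.fundSystem K ⟨0, by omega⟩ ^ j := by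
    intro u
    obtain ⟨⟨ζ, e⟩, h, -⟩ := Units.exist_unique_eq_mul_prod K u
    obtain ⟨i, hi⟩ := Subgroup.mem_zpowers_iff.1 (hω ζ)
    refine ⟨i, e ⟨0, by omega⟩, ?_⟩
    let _ : Unique (Fin (Units.rank K)) := ⟨⟨⟨0, by omega⟩⟩, fun a => Fin.ext (by omega)⟩
    rw [h, Fintype.prod_unique]
    simp only [← hi, Subgroup.coe_zpow]
    rfl
  choose i j hij using hrep
  refine ⟨fun u => (i u, j u), fun u v h => ?_⟩
  have hev : ∀ {a b : ℤ}, (a : ZMod 2) = b → Even (a + b) := by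
    intro a b hab
    rw [← ZMod.intCast_eq_zero_iff_even, Int.cast_add, hab]
    exact CharTwo.add_self_eq_zero _
  have h1 := hev (Prod.mk.inj h).1
  have h2 := hev (Prod.mk.inj h).2
  rw [hij u, hij v, mul_mul_mul_comm, ← zpow_add, ← zpow_add]
  exact (h1.isSquare_zpow _).mul (h2.isSquare_zpow _)

end Units

section Ramified

variable {K : Type*} [Field K] [NumberField K]

theorem span_pair_mul_self_eq {R : Type*} [CommRing R] {p k : ℕ} (hpk : p.Coprime k) {s : R}
    (hs : s ^ 2 = (p * k : ℕ)) :
    Ideal.span {(p : R), s} * Ideal.span {(p : R), s} = Ideal.span {(p : R)} := by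
  rw [Ideal.span_pair_mul_span_pair]
  apply le_antisymm
  · rw [Ideal.span_le]
    rintro z (rfl | rfl | rfl | rfl)
    · exact Ideal.mem_span_singleton.2 (Dvd.intro _ rfl)
    · exact Ideal.mem_span_singleton.2 (Dvd.intro _ rfl)
    · exact Ideal.mem_span_singleton.2 (Dvd.intro_left _ rfl)
    · exact Ideal.mem_span_singleton.2 ⟨k, by rw [← pow_two, hs, Nat.cast_mul]⟩
  · rw [Ideal.span_singleton_le_iff_mem]
    obtain ⟨a, b, hab⟩ := (Nat.isCoprime_iff_coprime.2 hpk)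
    have hab' : (a : R) * p + b * k = 1 := by exact_mod_cast congrArg (Int.cast : ℤ → R) hab
    have hp : a * (p * p) + b * (s * s) = (p : R) := by
      rw [← pow_two s, hs]
      push_cast
      linear_combination (p : R) * hab'
    have key : ∀ z ∈ ({(p : R) * p, p * s, s * p, s * s} : Set R),
        z ∈ Ideal.span {(p : R) * p, p * s, s * p, s * s} := fun z hz => Ideal.subset_span hz
    have h := add_mem (Ideal.mul_mem_left _ (a : R) (key (p * p) (by simp)))
      (Ideal.mul_mem_left _ (b : R) (key (s * s) (by simp)))
    exact Set.mem_of_eq_of_mem hp.symm h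

/-- Some ramified ideal is not principal, since the units modulo squares form a group of order at
most four. -/
theorem exists_not_isPrincipal {x y d m : ℕ} (hx : 0 < x) (hy : 0 < y)
    (hxy : ¬ IsSquare (x * y)) {α β : K}
    (hα : α ^ 2 = -(x : K)) (hβ : β ^ 2 = -(y : K)) (hdeg : Module.finrank ℚ K = 4)
    (hm : 0 < m) (hd : x * y = d * m ^ 2) (hdsq : Squarefree d)
    (hfac : 4 ≤ d.primeFactors.card) :
    ∃ I : Ideal (𝓞 K), ∃ p : ℕ, p.Prime ∧ I * I = Ideal.span {(p : 𝓞 K)} ∧ ¬ I.IsPrincipal := by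
  by_contra! hcon
  have hmK : (m : K) ≠ 0 := by exact_mod_cast hm.ne'
  have hs2 : (α * β / m) ^ 2 = (d : K) := by
    have hd' : (x : K) * y = d * m ^ 2 := by exact_mod_cast hd
    rw [div_pow, div_eq_iff (pow_ne_zero 2 hmK), ← hd']
    linear_combination β ^ 2 * hα - (x : K) * hβ
  obtain ⟨s, hs⟩ : ∃ s : 𝓞 K, (s : K) = α * β / m :=
    ⟨⟨_, IsIntegral.of_pow two_pos (hs2 ▸ isIntegral_natCast d)⟩, rfl⟩
  have hsd : s ^ 2 = (d : 𝓞 K) := RingOfIntegers.ext (by simp [hs, hs2])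
  have hgen : ∀ p ∈ insert 1 d.primeFactors, ∃ γ : 𝓞 K, ∃ u : (𝓞 K)ˣ, γ ^ 2 * u = p := by
    intro p hp
    rcases Finset.mem_insert.1 hp with rfl | hp
    · exact ⟨1, 1, by simp⟩
    have hpp := Nat.prime_of_mem_primeFactors hp
    obtain ⟨k, hk⟩ := Nat.dvd_of_mem_primeFactors hp
    have hpk : p.Coprime k := Nat.coprime_of_squarefree_mul (hk ▸ hdsq)
    have hII := span_pair_mul_self_eq hpk (hk ▸ hsd)
    obtain ⟨γ, hγ⟩ := (hcon _ p hpp hII).principal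
    rw [hγ, Ideal.submodule_span_eq, Ideal.span_singleton_mul_span_singleton,
      Ideal.span_singleton_eq_span_singleton] at hII
    obtain ⟨u, hu⟩ := hII
    exact ⟨γ, u, by rw [← hu, pow_two]⟩
  obtain ⟨f, hf⟩ := exists_units_isSquare_mul_of_eq hdeg hx hα
  choose! γ u hγu using hgen
  have h1 : 1 ∉ d.primeFactors := fun h => Nat.not_prime_one (Nat.prime_of_mem_primeFactors h)
  obtain ⟨p, hp, p', hp', hne, hpp'⟩ := Finset.exists_ne_map_eq_of_card_lt_of_maps_to
    (s := insert 1 d.primeFactors) (t := Finset.univ) (f := fun p => f (u p))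
    (by rw [Finset.card_insert_of_notMem h1]; simp; omega)
    (fun _ _ => Finset.mem_coe.2 (Finset.mem_univ _))
  obtain ⟨w, hw⟩ := hf _ _ hpp'
  have hz : ((γ p * γ p' * w : 𝓞 K) : K) ^ 2 = ((p * p' : ℕ) : K) := by
    have : (γ p * γ p' * w : 𝓞 K) ^ 2 = ((p * p' : ℕ) : 𝓞 K) := by
      rw [Nat.cast_mul, ← hγu p hp, ← hγu p' hp']
      have := congrArg (Units.val) hw
      push_cast at this
      linear_combination -(γ p * γ p') ^ 2 * this
    rw [← map_pow, this, map_natCast]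
  have hpos : ∀ r ∈ insert 1 d.primeFactors, 0 < r := fun r hr => by
    rcases Finset.mem_insert.1 hr with rfl | hr
    exacts [one_pos, (Nat.prime_of_mem_primeFactors hr).pos]
  have hdvd : ∀ {l n : ℕ}, l.Prime → l ∣ n → IsSquare n → l ^ 2 ∣ n := by
    rintro l n hl hln ⟨r, rfl⟩
    rw [← pow_two] at hln ⊢
    exact pow_dvd_pow_of_dvd (hl.dvd_of_dvd_pow hln) 2
  have hndvd : ∀ {l r : ℕ}, l.Prime → r ∈ insert 1 d.primeFactors → l ∣ r → l = r := by
    intro l r hl hr hlr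
    rcases Finset.mem_insert.1 hr with rfl | hr
    · exact absurd (Nat.dvd_one.1 hlr) hl.ne_one
    · exact (Nat.prime_dvd_prime_iff_eq hl (Nat.prime_of_mem_primeFactors hr)).1 hlr
  rcases isSquare_or_of_sq_eq_natCast hx hy hxy hα hβ hdeg
    (Nat.mul_pos (hpos p hp) (hpos p' hp')) hz with hsq | hsq
  · have key : ∀ {a b : ℕ}, a ∈ d.primeFactors → b ∈ insert 1 d.primeFactors → a ≠ b →
        ¬ IsSquare (a * b) := by
      intro a b ha hb hab hsq
      have hap := Nat.prime_of_mem_primeFactors ha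
      have := hdvd hap (dvd_mul_right a b) hsq
      rw [pow_two] at this
      exact hab (hndvd hap hb ((Nat.mul_dvd_mul_iff_left hap.pos).1 this))
    rcases Finset.mem_insert.1 hp with rfl | hp1
    · rcases Finset.mem_insert.1 hp' with rfl | hp1'
      · exact hne rfl
      · exact key hp1' hp hne.symm (by rwa [mul_comm])
    · exact key hp1 hp' hne hsq
  · obtain ⟨l, hl, hl'⟩ : ∃ l ∈ d.primeFactors, l ∉ ({p, p'} : Finset ℕ) := by
      by_contra! hsub
      have := (Finset.card_le_card hsub).trans Finset.card_le_two
      omega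
    simp only [Finset.mem_insert, Finset.mem_singleton, not_or] at hl'
    have hlp := Nat.prime_of_mem_primeFactors hl
    have hsq' : IsSquare (p * p' * d) := by
      rw [← Rat.isSquare_natCast_iff] at hsq ⊢
      obtain ⟨r, hr⟩ := hsq
      have hm' : (m : ℚ) ≠ 0 := by exact_mod_cast hm.ne'
      refine ⟨r / m, ?_⟩
      rw [hd] at hr
      push_cast at hr ⊢
      field_simp
      linarith
    have h2 := hdvd hlp ((Nat.dvd_of_mem_primeFactors hl).mul_left _) hsq'
    obtain ⟨k, rfl⟩ := Nat.dvd_of_mem_primeFactors hl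
    rw [mul_left_comm, pow_two, Nat.mul_dvd_mul_iff_left hlp.pos, hlp.dvd_mul, hlp.dvd_mul] at h2
    rcases h2 with (h | h) | h
    · exact hl'.1 (hndvd hlp hp h)
    · exact hl'.2 (hndvd hlp hp' h)
    · exact hlp.ne_one (Nat.isUnit_iff.1 (hdsq l (mul_dvd_mul_left l h)))

end Ramified

theorem IsRatNorm.of_mul_sq {d : ℕ} {n w : ℚ} (hw : w ≠ 0) (h : IsRatNorm d (n * w ^ 2)) :
    IsRatNorm d n := by
  have := h.mul_sq w⁻¹
  rwa [mul_assoc, ← mul_pow, mul_inv_cancel₀ hw, one_pow, mul_one] at this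

theorem not_isSquare_mul_sq {d m : ℕ} (hd : Squarefree d) (hd1 : d ≠ 1) (hm : 0 < m) :
    ¬ IsSquare (d * m ^ 2) := by
  intro h
  have hsq : IsSquare d := by
    rw [← Rat.isSquare_natCast_iff] at h ⊢
    obtain ⟨r, hr⟩ := h
    have hm' : (m : ℚ) ≠ 0 := by exact_mod_cast hm.ne'
    refine ⟨r / m, ?_⟩
    push_cast at hr
    field_simp
    linarith
  obtain ⟨r, rfl⟩ := hsq
  exact hd1 (by rw [Nat.isUnit_iff.1 (hd r dvd_rfl)])

theorem not_dvd_of_dvd_of_dvd {x y d m l : ℕ} (hx : Squarefree x) (hy : Squarefree y)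
    (hdsq : Squarefree d) (hd : x * y = d * m ^ 2) (hl : l.Prime) (hld : l ∣ d) (hlx : l ∣ x) :
    ¬ l ∣ y := by
  rintro ⟨b, rfl⟩
  obtain ⟨a, rfl⟩ := hlx
  obtain ⟨k, rfl⟩ := hld
  have hndvd : ∀ {n : ℕ}, Squarefree (l * n) → ¬ l ∣ n := fun h hn =>
    hl.ne_one (Nat.isUnit_iff.1 (h l (mul_dvd_mul_left l hn)))
  have h1 : l * (a * b) = k * m ^ 2 := Nat.eq_of_mul_eq_mul_left hl.pos (by linarith)
  obtain ⟨c, rfl⟩ := hl.dvd_of_dvd_pow ((hl.dvd_mul.1 (Dvd.intro _ h1)).resolve_left (hndvd hdsq))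
  have h2 : a * b = l * (k * c ^ 2) := Nat.eq_of_mul_eq_mul_left hl.pos (by linarith)
  rcases hl.dvd_mul.1 (Dvd.intro _ h2.symm) with h | h
  exacts [hndvd hx h, hndvd hy h]

theorem exists_split_ideal {K : Type*} [Field K] [NumberField K] {x y : ℕ} (hx : 0 < x)
    (hy : 0 < y) (hxsq : Squarefree x) (hysq : Squarefree y)
    (hxy : ¬ IsSquare (x * y)) {α β : K} (hα : α ^ 2 = -(x : K)) (hβ : β ^ 2 = -(y : K))
    (hdeg : Module.finrank ℚ K = 4) {S : Finset ℕ}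
    (hSx : Even (S ∩ x.primeFactors).card) (hSy : Even (S ∩ y.primeFactors).card) :
    ∃ (q : ℕ) (I : Ideal (𝓞 K)), q.Prime ∧ Ideal.absNorm I = q ∧
      ∀ l ∈ (x * y).primeFactors, l ≠ 2 → jacobiSym q l = if l ∈ S then -1 else 1 := by
  obtain ⟨q, hq, hqN, hq4, hql, hlq⟩ := exists_prime_jacobiSym_eq
    (M := (x * y).primeFactors) (fun l => Nat.prime_of_mem_primeFactors) S (4 * x * y)
  have hfact := Fact.mk hq
  have hsq : ∀ n : ℕ, Squarefree n → n.primeFactors ⊆ (x * y).primeFactors →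
      Even (S ∩ n.primeFactors).card → IsSquare (-n : ZMod q) := by
    intro n hn hsub hS
    have h1 : jacobiSym (-(n : ℤ)) q = 1 := by
      rw [jacobiSym.neg _ (Nat.odd_iff.2 (by omega)), ZMod.χ₄_nat_one_mod_four hq4,
        jacobiSym_eq_one_of_even hn hS fun l hl => hql l (hsub hl), one_mul]
    simpa using ZMod.isSquare_of_jacobiSym_eq_one h1
  have hxy0 : x * y ≠ 0 := (Nat.mul_pos hx hy).ne'
  obtain ⟨I, hI⟩ := exists_ideal_absNorm_eq hx hy hxy hα hβ hdeg hq
    (fun h => absurd (Nat.le_of_dvd (by positivity) h) (by omega))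
    (hsq x hxsq (Nat.primeFactors_mono (dvd_mul_right x y) hxy0) hSx)
    (hsq y hysq (Nat.primeFactors_mono (dvd_mul_left y x) hxy0) hSy)
  exact ⟨q, I, hq, hI, hlq⟩

/-- Let `K = ℚ(√(-x), √(-y))` be an imaginary bicyclic biquadratic field, `x, y`
square-free positive integers, and let `d` be the square-free part of `x * y`. If `d`
has at least four distinct prime factors, then the class number of `K` is not `4`. -/
theorem classNumber_ne_four_of_four_primes (x y d : ℕ) (hx : 0 < x) (hy : 0 < y)
    (hxsq : Squarefree x) (hysq : Squarefree y)
    (hdsq : Squarefree d) (hd : ∃ m : ℕ, 0 < m ∧ x * y = d * m ^ 2)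
    (hfac : 4 ≤ d.primeFactors.card)
    (K : Type) [Field K] [NumberField K] (hdeg : Module.finrank ℚ K = 4)
    (hgen : ∃ α β : K, α ^ 2 = -(x : K) ∧ β ^ 2 = -(y : K)) :
    NumberField.classNumber K ≠ 4 := by
  obtain ⟨m, hm, hd⟩ := hd
  obtain ⟨α, β, hα, hβ⟩ := hgen
  have hd1 : d ≠ 1 := by
    rintro rfl
    simp at hfac
  have hxy : ¬ IsSquare (x * y) := hd ▸ not_isSquare_mul_sq hdsq hd1 hm
  have hxy0 : x * y ≠ 0 := (Nat.mul_pos hx hy).ne'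
  have hdxy : d ∣ x * y := Dvd.intro _ hd.symm
  have hprime : ∀ l ∈ d.primeFactors, l.Prime := fun l => Nat.prime_of_mem_primeFactors
  have hdisj : Disjoint (d.primeFactors ∩ x.primeFactors) (d.primeFactors ∩ y.primeFactors) := by
    rw [Finset.disjoint_left]
    intro l hl hl'
    rw [Finset.mem_inter] at hl hl'
    exact not_dvd_of_dvd_of_dvd hxsq hysq hdsq hd (hprime l hl.1)
      (Nat.dvd_of_mem_primeFactors hl.1) (Nat.dvd_of_mem_primeFactors hl.2)
      (Nat.dvd_of_mem_primeFactors hl'.2)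
  have hunion : (d.primeFactors ∩ x.primeFactors) ∪ (d.primeFactors ∩ y.primeFactors) =
      d.primeFactors := by
    rw [← Finset.inter_union_distrib_left, ← Nat.primeFactors_mul hx.ne' hy.ne',
      Finset.inter_eq_left]
    exact Nat.primeFactors_mono hdxy hxy0
  obtain ⟨S, T, hSx, hSy, hTx, hTy, hSd, hTd, ⟨l₁, hl₁, hl₁2⟩, ⟨l₂, hl₂, hl₂2⟩,
    l₃, hl₃, hl₃2, hl₃ST⟩ := exists_independent_even_subsets hdisj
      (by rwa [← Finset.card_union_of_disjoint hdisj, hunion])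
  rw [hunion] at hSd hTd hl₃
  rw [← Finset.inter_assoc, Finset.inter_eq_left.2 hSd] at hSx hSy
  rw [← Finset.inter_assoc, Finset.inter_eq_left.2 hTd] at hTx hTy
  obtain ⟨q₁, I₁, hq₁, hI₁, hJ₁⟩ := exists_split_ideal hx hy hxsq hysq hxy hα hβ hdeg hSx hSy
  obtain ⟨q₂, I₂, hq₂, hI₂, hJ₂⟩ := exists_split_ideal hx hy hxsq hysq hxy hα hβ hdeg hTx hTy
  obtain ⟨I₀, p, hp, hI₀, hI₀p⟩ :=
    exists_not_isPrincipal hx hy hxy hα hβ hdeg hm hd hdsq hfac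
  have hmem : ∀ l ∈ d.primeFactors, l ∈ (x * y).primeFactors := fun l hl =>
    Nat.primeFactors_mono hdxy hxy0 hl
  have hnot : ∀ {l n : ℕ}, l ∈ d.primeFactors → jacobiSym n l = -1 → ¬ IsRatNorm d n :=
    fun hl => not_isRatNorm_of_jacobiSym_eq_neg_one (hprime _ hl) hdsq
      (Nat.dvd_of_mem_primeFactors hl)
  have hn₁ : ¬ IsRatNorm d q₁ := hnot (hSd hl₁) (by rw [hJ₁ _ (hmem _ (hSd hl₁)) hl₁2, if_pos hl₁])
  have hn₂ : ¬ IsRatNorm d q₂ := hnot (hTd hl₂) (by rw [hJ₂ _ (hmem _ (hTd hl₂)) hl₂2, if_pos hl₂])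
  have hn₃ : ¬ IsRatNorm d (q₁ * q₂ : ℕ) := hnot hl₃ (by
    rw [Nat.cast_mul, jacobiSym.mul_left, hJ₁ _ (hmem _ hl₃) hl₃2, hJ₂ _ (hmem _ hl₃) hl₃2]
    by_cases h : l₃ ∈ T <;> simp [h, hl₃ST])
  have hN₀ : Ideal.absNorm I₀ = p ^ 2 := by
    have h := congrArg Ideal.absNorm hI₀
    rw [map_mul, Ideal.absNorm_span_natCast, RingOfIntegers.rank, hdeg] at h
    exact Nat.pow_left_injective (n := 2) two_ne_zero (by simp only; linarith)
  have hmem₀ : ∀ {I : Ideal (𝓞 K)} {n : ℕ}, Ideal.absNorm I = n → n ≠ 0 → I ∈ (Ideal (𝓞 K))⁰ :=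
    fun h hn => Ideal.absNorm_ne_zero_iff_mem_nonZeroDivisors.1 (h ▸ hn)
  have hpsq : p ^ 2 ≠ 0 := pow_ne_zero 2 hp.ne_zero
  let J₀ : (Ideal (𝓞 K))⁰ := ⟨I₀, hmem₀ hN₀ hpsq⟩
  let J₁ : (Ideal (𝓞 K))⁰ := ⟨I₁, hmem₀ hI₁ hq₁.ne_zero⟩
  let J₂ : (Ideal (𝓞 K))⁰ := ⟨I₂, hmem₀ hI₂ hq₂.ne_zero⟩
  have hne : ∀ {I J : (Ideal (𝓞 K))⁰} (n w : ℕ), ¬ IsRatNorm d n → w ≠ 0 →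
      Ideal.absNorm (I : Ideal (𝓞 K)) * Ideal.absNorm (J : Ideal (𝓞 K)) = n * w ^ 2 →
      ClassGroup.mk0 I ≠ ClassGroup.mk0 J := by
    intro I J n w hn hw hIJ h
    have h1 := isRatNorm_of_mk0_eq hx hy hxy hα hβ hdeg hd h
    rw [← Nat.cast_mul, hIJ, Nat.cast_mul, Nat.cast_pow] at h1
    exact hn (h1.of_mul_sq (by exact_mod_cast hw))
  have h₁ : ClassGroup.mk0 J₁ ≠ 1 := by
    rw [← map_one (ClassGroup.mk0 (R := 𝓞 K))]
    exact hne q₁ 1 hn₁ one_ne_zero (by simp [J₁, hI₁])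
  have h₂ : ClassGroup.mk0 J₂ ≠ 1 := by
    rw [← map_one (ClassGroup.mk0 (R := 𝓞 K))]
    exact hne q₂ 1 hn₂ one_ne_zero (by simp [J₂, hI₂])
  have h₁₂ : ClassGroup.mk0 J₁ ≠ ClassGroup.mk0 J₂ :=
    hne _ 1 hn₃ one_ne_zero (by simp [J₁, J₂, hI₁, hI₂])
  have h₃ : ClassGroup.mk0 J₁ * ClassGroup.mk0 J₂ ≠ 1 := by
    rw [← map_mul, ← map_one (ClassGroup.mk0 (R := 𝓞 K))]
    exact hne _ 1 hn₃ one_ne_zero (by simp [J₁, J₂, hI₁, hI₂])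
  have h₀ : ClassGroup.mk0 J₀ ≠ 1 := fun h => hI₀p ((ClassGroup.mk0_eq_one_iff _).1 h)
  have h₀₁ : ClassGroup.mk0 J₀ ≠ ClassGroup.mk0 J₁ :=
    hne q₁ p hn₁ hp.ne_zero (by simp [J₀, J₁, hI₁, hN₀, mul_comm])
  have h₀₂ : ClassGroup.mk0 J₀ ≠ ClassGroup.mk0 J₂ :=
    hne q₂ p hn₂ hp.ne_zero (by simp [J₀, J₂, hI₂, hN₀, mul_comm])
  have h₀₃ : ClassGroup.mk0 J₀ ≠ ClassGroup.mk0 J₁ * ClassGroup.mk0 J₂ := by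
    rw [← map_mul]
    exact hne _ p hn₃ hp.ne_zero (by simp [J₀, J₁, J₂, hI₁, hI₂, hN₀, mul_comm])
  intro hcard
  classical
  have huniv : ({1, ClassGroup.mk0 J₁, ClassGroup.mk0 J₂,
      ClassGroup.mk0 J₁ * ClassGroup.mk0 J₂} : Finset (ClassGroup (𝓞 K))) = Finset.univ := by
    rw [← Finset.card_eq_iff_eq_univ, show Fintype.card (ClassGroup (𝓞 K)) = 4 from hcard,
      Finset.card_insert_of_notMem (by simp [h₁.symm, h₂.symm, h₃.symm]),
      Finset.card_insert_of_notMem (by simp [h₁₂, h₂]),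
      Finset.card_insert_of_notMem (by simp [h₁]), Finset.card_singleton]
  have := huniv ▸ Finset.mem_univ (ClassGroup.mk0 J₀)
  simp [h₀, h₀₁, h₀₂, h₀₃] at this
end

section
/- Let K = ℚ(√(-x), √(-y)) be an imaginary bicyclic biquadratic field, where x, y are square-free positive integers, and let d be the square-free part of xy. If d has at least four distinct prime factors, then the class number of K is not equal to 6. -/
theorem isSquare_or_isSquare_or_isSquare_mul_of_card_eq_six {G : Type*} [CommGroup G]
    (hG : Nat.card G = 6) (a b : G) : IsSquare a ∨ IsSquare b ∨ IsSquare (a * b) := by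
  have : Finite G := Nat.finite_of_card_ne_zero (by omega)
  obtain ⟨t, ht⟩ := exists_prime_orderOf_dvd_card' (G := G) 3 (by rw [hG]; norm_num)
  have hcard : Nat.card (Subgroup.zpowers t) = 3 := by rw [Nat.card_zpowers, ht]
  have hindex : (Subgroup.zpowers t).index = 2 := by
    have := (Subgroup.zpowers t).card_mul_index
    rw [hcard, hG] at this
    omega
  have hsq : ∀ g ∈ Subgroup.zpowers t, IsSquare g := by
    rintro g ⟨k, rfl⟩
    refine ⟨t ^ (2 * k), ?_⟩
    have h3 : t ^ (3 : ℤ) = 1 := by exact_mod_cast ht ▸ pow_orderOf_eq_one t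
    change t ^ k = _
    rw [← zpow_add, show 2 * k + 2 * k = 3 * k + k by ring, zpow_add, zpow_mul, h3, one_zpow,
      one_mul]
  have := Subgroup.mul_mem_iff_of_index_two hindex (a := a) (b := b)
  by_cases ha : a ∈ Subgroup.zpowers t
  · exact .inl (hsq a ha)
  by_cases hb : b ∈ Subgroup.zpowers t
  · exact .inr (.inl (hsq b hb))
  exact .inr (.inr (hsq _ (by tauto)))

theorem exists_not_dvd_and_legendreSym_eq (p : ℕ) [Fact p.Prime] (hp : p ≠ 2) (P : Prop)
    [Decidable P] : ∃ r : ℕ, ¬ p ∣ r ∧ legendreSym p r = if P then -1 else 1 := by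
  split_ifs
  · obtain ⟨z, hz⟩ := FiniteField.exists_nonsquare (F := ZMod p) (by rwa [ZMod.ringChar_zmod_n])
    have h : legendreSym p (z.val : ℕ) = -1 := by
      rw [legendreSym.eq_neg_one_iff]
      simpa using hz
    refine ⟨z.val, fun hd => ?_, h⟩
    rw [← ZMod.natCast_eq_zero_iff] at hd
    rw [(legendreSym.eq_zero_iff p _).2 (by exact_mod_cast hd)] at h
    norm_num at h
  · refine ⟨1, (Fact.out : p.Prime).one_lt.ne' ∘ Nat.dvd_one.1, by simp⟩

/-- A form of Dirichlet's theorem: the quadratic characters of a large prime `q ≡ 1 mod 4` at the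
primes dividing `n` can be prescribed. -/
theorem exists_prime_gt_and_legendreSym_eq (n : ℕ) (S : Finset ℕ) (M : ℕ) :
    ∃ q > M, ∃ _ : Fact q.Prime, q % 4 = 1 ∧
      ∀ p ∈ n.primeFactors, legendreSym q p = if p ∈ S then -1 else 1 := by
  classical
  have hr : ∀ p : ℕ, ∃ r : ℕ, (p = 2 → r = if 2 ∈ S then 5 else 1) ∧
      (p ≠ 2 → ∀ _ : Fact p.Prime,
        ¬ p ∣ r ∧ legendreSym p r = if p ∈ S then -1 else 1) := by
    intro p
    by_cases h2 : p = 2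
    · exact ⟨_, fun _ => rfl, fun h => absurd h2 h⟩
    · by_cases hp : p.Prime
      · have := Fact.mk hp
        obtain ⟨r, hr⟩ := exists_not_dvd_and_legendreSym_eq p h2 (p ∈ S)
        exact ⟨r, fun h => absurd h h2, fun _ _ => hr⟩
      · exact ⟨0, fun h => absurd h h2, fun _ h => absurd h.out hp⟩
  choose r hr2 hr using hr
  let s : ℕ → ℕ := fun p => if p = 2 then 8 else p
  let T := insert 2 n.primeFactors
  have hT : ∀ p ∈ T, p.Prime := by
    intro p hp
    rcases Finset.mem_insert.1 hp with rfl | hp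
    · exact Nat.prime_two
    · exact Nat.prime_of_mem_primeFactors hp
  have hs : ∀ p ∈ T, s p ∣ p ^ 3 := by
    intro p hp
    by_cases h : p = 2
    · simp [s, h]
    · simp [s, h]
  have hs0 : ∀ p ∈ T, s p ≠ 0 := fun p hp =>
    ne_zero_of_dvd_ne_zero (pow_ne_zero _ (hT p hp).ne_zero) (hs p hp)
  have hcop : Set.Pairwise (T : Set ℕ) (Function.onFun Nat.Coprime s) := by
    intro p hp p' hp' hne
    exact (Nat.Coprime.pow 3 3 ((Nat.coprime_primes (hT p hp) (hT p' hp')).2 hne)).of_dvd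
      (hs p hp) (hs p' hp')
  obtain ⟨k, hk⟩ := Nat.chineseRemainderOfFinset r s T hs0 hcop
  have hkcop : k.Coprime (∏ p ∈ T, s p) := by
    refine Nat.Coprime.prod_right fun p hp => Nat.Coprime.coprime_dvd_right (hs p hp) ?_
    refine Nat.Coprime.pow_right 3 (((hT p hp).coprime_iff_not_dvd.2 ?_).symm)
    have hk := hk p hp
    by_cases h2 : p = 2
    · subst h2
      have h8 : k % 8 = r 2 % 8 := hk
      rw [hr2 2 rfl] at h8
      split_ifs at h8 <;> omega
    · have h := (hr p h2 ⟨hT p hp⟩).1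
      simp only [s, h2, if_false] at hk
      rwa [hk.dvd_iff dvd_rfl]
  obtain ⟨q, hqM, hq, hqk⟩ := Nat.forall_exists_prime_gt_and_modEq M
    (Finset.prod_ne_zero_iff.2 hs0) hkcop
  have hqr : ∀ p ∈ T, q ≡ r p [MOD s p] := fun p hp =>
    (hqk.of_dvd (Finset.dvd_prod_of_mem s hp)).trans (hk p hp)
  have hq8 : q % 8 = if 2 ∈ S then 5 else 1 := by
    have h : q % 8 = r 2 % 8 := hqr 2 (Finset.mem_insert_self _ _)
    rw [hr2 2 rfl] at h
    split_ifs at h ⊢ <;> omega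
  have hq4 : q % 4 = 1 := by split_ifs at hq8 <;> omega
  have hqF := Fact.mk hq
  refine ⟨q, hqM, hqF, hq4, fun p hp => ?_⟩
  have hpT : p ∈ T := Finset.mem_insert_of_mem hp
  have hpF := Fact.mk (hT p hpT)
  by_cases h2 : p = 2
  · subst h2
    rw [Nat.cast_ofNat, legendreSym.at_two (by omega), ZMod.χ₈_nat_eq_if_mod_eight]
    split_ifs at hq8 ⊢ <;> omega
  · rw [← (hr p h2 hpF).2, ← legendreSym.quadratic_reciprocity_one_mod_four hq4 h2]
    have h := hqr p hpT
    simp only [s, h2, if_false] at h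
    rw [legendreSym.mod p q, legendreSym.mod p (r p)]
    have h' : (q : ℤ) % p = r p % p := by exact_mod_cast h
    rw [h']

theorem isSquare_of_mul_sq_eq_sq_add_mul_sq {p x : ℕ} [Fact p.Prime] (hpx : p ∣ x)
    (hpx2 : ¬ p ^ 2 ∣ x) {n : ℕ} (c : ℕ) (hc : c ≠ 0) (a b : ℤ)
    (h : (n : ℤ) * c ^ 2 = a ^ 2 + x * b ^ 2) : IsSquare (n : ZMod p) := by
  have hp : p.Prime := Fact.out
  have hpZ : Prime (p : ℤ) := Nat.prime_iff_prime_int.1 hp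
  induction c using Nat.strong_induction_on generalizing a b with
  | _ c ih =>
  by_cases hpc : p ∣ c
  · obtain ⟨c, rfl⟩ := hpc
    obtain ⟨x', rfl⟩ := hpx
    have hx' : ¬ (p : ℤ) ∣ x' := by
      rw [Int.natCast_dvd_natCast]
      exact fun hd => hpx2 (by rw [sq]; exact mul_dvd_mul_left p hd)
    push_cast at h
    have ha : (p : ℤ) ∣ a := by
      refine hpZ.dvd_of_dvd_pow (n := 2) ⟨n * p * c ^ 2 - x' * b ^ 2, ?_⟩
      linear_combination -h
    obtain ⟨a, rfl⟩ := ha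
    have hp0 : (p : ℤ) ≠ 0 := hpZ.ne_zero
    have hb : (p : ℤ) ∣ b := by
      have : (p : ℤ) ∣ x' * b ^ 2 := by
        refine ⟨n * c ^ 2 - a ^ 2, mul_left_cancel₀ hp0 ?_⟩
        linear_combination -h
      exact hpZ.dvd_of_dvd_pow ((hpZ.dvd_or_dvd this).resolve_left hx')
    obtain ⟨b, rfl⟩ := hb
    have hc0 : c ≠ 0 := by rintro rfl; simp at hc
    refine ih c ?_ hc0 a b ?_
    · exact lt_mul_of_one_lt_left (Nat.pos_of_ne_zero hc0) hp.one_lt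
    · refine mul_left_cancel₀ (pow_ne_zero 2 hp0) ?_
      push_cast
      linear_combination h
  · have hc' : (c : ZMod p) ≠ 0 := by rwa [Ne, ZMod.natCast_eq_zero_iff]
    have hx' : (x : ZMod p) = 0 := by rwa [ZMod.natCast_eq_zero_iff]
    have h' := congrArg (Int.cast : ℤ → ZMod p) h
    push_cast at h'
    rw [hx', zero_mul, add_zero] at h'
    refine ⟨a / c, ?_⟩
    field_simp
    exact h'

theorem isSquare_of_eq_sq_add_mul_sq {p x : ℕ} [Fact p.Prime] (hpx : p ∣ x)
    (hx : Squarefree x) {n : ℕ} {u v : ℚ} (h : (n : ℚ) = u ^ 2 + x * v ^ 2) :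
    IsSquare (n : ZMod p) := by
  have hp : p.Prime := Fact.out
  refine isSquare_of_mul_sq_eq_sq_add_mul_sq hpx
    (fun hd => hp.one_lt.ne' (Nat.isUnit_iff.1 (hx p (by rwa [← sq]))))
    (u.den * v.den) (mul_ne_zero u.den_nz v.den_nz) (u.num * v.den) (v.num * u.den) ?_
  have hu := u.mul_den_eq_num
  have hv := v.mul_den_eq_num
  have : (n : ℚ) * (u.den * v.den) ^ 2 = (u.num * v.den) ^ 2 + x * (v.num * u.den) ^ 2 := by
    rw [← hu, ← hv, h]
    ring
  exact_mod_cast this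

section

open NumberField

theorem exists_norm_eq_sq_add_mul_sq {K : Type*} [Field K] [Algebra ℚ K] [FiniteDimensional ℚ K]
    {x : ℕ} (hx : 0 < x) {α : K} (hα : α ^ 2 = -(x : K)) (γ : K) :
    ∃ u v : ℚ, Algebra.norm ℚ γ = u ^ 2 + x * v ^ 2 := by
  have : Fact (∀ r : ℚ, r ^ 2 ≠ -(x : ℚ) + 0 * r) := ⟨fun r h => by
    have : (0 : ℚ) < x := by exact_mod_cast hx
    nlinarith [sq_nonneg r]⟩
  let f : QuadraticAlgebra ℚ (-(x : ℚ)) 0 →ₐ[ℚ] K :=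
    QuadraticAlgebra.lift ⟨α, by rw [← sq, hα]; simp [Algebra.smul_def]⟩
  let := f.toRingHom.toAlgebra
  have : IsScalarTower ℚ (QuadraticAlgebra ℚ (-(x : ℚ)) 0) K :=
    IsScalarTower.of_algebraMap_eq fun r => (f.commutes r).symm
  have : FiniteDimensional (QuadraticAlgebra ℚ (-(x : ℚ)) 0) K :=
    Module.Finite.of_restrictScalars_finite ℚ _ K
  rw [← Algebra.norm_norm (S := QuadraticAlgebra ℚ (-(x : ℚ)) 0)]
  generalize Algebra.norm (QuadraticAlgebra ℚ (-(x : ℚ)) 0) γ = z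
  have hz : Algebra.norm ℚ z = z.norm := QuadraticAlgebra.det_toLinearMap_eq_norm z
  refine ⟨z.re, z.im, ?_⟩
  rw [hz, QuadraticAlgebra.norm_def]
  ring

theorem exists_absNorm_eq_of_mk0_isSquare {K : Type*} [Field K] [NumberField K]
    {x : ℕ} (hx : 0 < x) {α : K} (hα : α ^ 2 = -(x : K)) (I : nonZeroDivisors (Ideal (𝓞 K)))
    (hI : IsSquare (ClassGroup.mk0 I)) :
    ∃ u v : ℚ, (Ideal.absNorm (I : Ideal (𝓞 K)) : ℚ) = u ^ 2 + x * v ^ 2 := by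
  obtain ⟨c, hc⟩ := hI
  obtain ⟨J, rfl⟩ := ClassGroup.mk0_surjective c
  rw [← map_mul, ClassGroup.mk0_eq_mk0_iff] at hc
  obtain ⟨a, b, ha, hb, hab⟩ := hc
  obtain ⟨u, v, huv⟩ := exists_norm_eq_sq_add_mul_sq hx hα ((b : K) / a)
  have hab := congrArg (fun I => (Ideal.absNorm I : ℚ)) hab
  simp only [map_mul, Submonoid.coe_mul, Ideal.absNorm_span_singleton, Nat.cast_mul,
    Nat.cast_natAbs, Int.cast_abs, Algebra.coe_norm_int] at hab
  have ha' : Algebra.norm ℚ (a : K) ≠ 0 := by simpa [Algebra.norm_eq_zero_iff] using ha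
  have hdiv : Algebra.norm ℚ ((b : K) / a) = Algebra.norm ℚ (b : K) / Algebra.norm ℚ (a : K) := by
    rw [eq_div_iff ha', ← map_mul, div_mul_cancel₀ _ (by simpa using ha)]
  rw [hdiv] at huv
  have habs : |Algebra.norm ℚ (b : K)| / |Algebra.norm ℚ (a : K)| = u ^ 2 + x * v ^ 2 := by
    rw [← abs_div, huv, abs_of_nonneg (by positivity)]
  set s : ℚ := (Ideal.absNorm (J : Ideal (𝓞 K)) : ℚ)
  refine ⟨u * s, v * s, ?_⟩
  have : |Algebra.norm ℚ (a : K)| ≠ 0 := abs_ne_zero.2 ha'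
  rw [div_eq_iff this] at habs
  rw [habs] at hab
  refine mul_left_cancel₀ this ?_
  linear_combination hab

theorem linearIndependent_of_sq_eq_neg {K : Type*} [Field K] [Algebra ℚ K]
    {x y : ℕ} (hx : 0 < x) (hy : 0 < y) (hxy : ¬ IsSquare ((x * y : ℕ) : ℚ)) {α β : K}
    (hα : α ^ 2 = -(x : K)) (hβ : β ^ 2 = -(y : K)) :
    LinearIndependent ℚ ![1, α, β, α * β] := by
  have : CharZero K := algebraRat.charZero K
  have hx' : (0 : ℚ) < x := by exact_mod_cast hx
  have hy' : (0 : ℚ) < y := by exact_mod_cast hy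
  have h1 : ∀ u v : ℚ, (u : K) + v * α = 0 → u = 0 ∧ v = 0 := by
    intro u v h
    have h' : (u : K) ^ 2 + x * v ^ 2 = 0 := by
      linear_combination (u - v * α) * h + v ^ 2 * hα
    have h' : u ^ 2 + x * v ^ 2 = 0 := by exact_mod_cast h'
    have hu : u ^ 2 = 0 := by nlinarith [sq_nonneg u, mul_nonneg hx'.le (sq_nonneg v)]
    rw [hu, zero_add] at h'
    exact ⟨by simpa using hu, by simpa [hx.ne'] using h'⟩
  rw [Fintype.linearIndependent_iff]
  intro g hg
  simp only [Fin.sum_univ_four, Algebra.smul_def, eq_ratCast] at hg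
  simp only [Matrix.cons_val] at hg
  obtain ⟨a, ha⟩ : ∃ a, g 0 = a := ⟨_, rfl⟩
  obtain ⟨b, hb⟩ : ∃ b, g 1 = b := ⟨_, rfl⟩
  obtain ⟨c, hc⟩ : ∃ c, g 2 = c := ⟨_, rfl⟩
  obtain ⟨d, hd⟩ : ∃ d, g 3 = d := ⟨_, rfl⟩
  rw [ha, hb, hc, hd] at hg
  suffices c ^ 2 + x * d ^ 2 = 0 by
    have hc2 : c ^ 2 = 0 := by nlinarith [sq_nonneg c, mul_nonneg hx'.le (sq_nonneg d)]
    rw [hc2, zero_add] at this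
    have hc0 : c = 0 := by simpa using hc2
    have hd0 : d = 0 := by simpa [hx.ne'] using this
    obtain ⟨ha0, hb0⟩ := h1 a b (by simpa [hc0, hd0] using hg)
    simp [Fin.forall_fin_succ, ha, hb, hc, hd, ha0, hb0, hc0, hd0]
  by_contra hn
  set n := c ^ 2 + x * d ^ 2 with hn'
  set U := a * c + x * b * d with hU
  set V := b * c - a * d with hV
  have hβ' : (n : K) * β = -(U + V * α) := by
    simp only [hn', hU, hV]
    push_cast
    linear_combination (c - d * α) * hg + (d ^ 2 * β + b * d) * hα
  obtain ⟨h2, h3⟩ := h1 (U ^ 2 - x * V ^ 2 + y * n ^ 2) (2 * U * V) (by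
    push_cast
    linear_combination (-(n * β) + (U + V * α)) * hβ' - V ^ 2 * hα + n ^ 2 * hβ)
  rcases mul_eq_zero.1 h3 with h3 | h3
  · replace h3 : U = 0 := by simpa using h3
    refine hxy ⟨x * V / n, ?_⟩
    rw [h3] at h2
    push_cast
    field_simp
    linear_combination h2
  · rw [h3] at h2
    have : 0 < y * n ^ 2 := by positivity
    nlinarith [sq_nonneg U]

theorem exists_int_mul_eq_of_sq_eq_neg {K : Type*} [Field K] [NumberField K]
    (hdeg : Module.finrank ℚ K = 4) {A B : 𝓞 K}
    (hlin : LinearIndependent ℚ ![1, (A : K), B, A * B]) :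
    ∃ N : ℤ, N ≠ 0 ∧ ∀ z : 𝓞 K, (N : 𝓞 K) * z ∈ Algebra.adjoin ℤ {A, B} := by
  have hspan := hlin.span_eq_top_of_card_eq_finrank (by simp [hdeg])
  have hz : ∀ z : 𝓞 K, ∃ n : ℤ, n ≠ 0 ∧ (n : 𝓞 K) * z ∈ Algebra.adjoin ℤ {A, B} := by
    intro z
    have hzspan : (z : K) ∈ Submodule.span ℚ (Set.range ![1, (A : K), B, A * B]) :=
      hspan ▸ Submodule.mem_top
    obtain ⟨r, hr⟩ := (Submodule.mem_span_range_iff_exists_fun ℚ).1 hzspan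
    obtain ⟨⟨n, hn⟩, hm⟩ :=
      IsLocalization.exist_integer_multiples_of_finite (nonZeroDivisors ℤ) r
    choose m hm using hm
    refine ⟨n, nonZeroDivisors.ne_zero hn, ?_⟩
    have hA : A ∈ Algebra.adjoin ℤ {A, B} := Algebra.subset_adjoin (by simp)
    have hB : B ∈ Algebra.adjoin ℤ {A, B} := Algebra.subset_adjoin (by simp)
    have : (n : 𝓞 K) * z = m 0 + m 1 * A + m 2 * B + m 3 * (A * B) := by
      have hm' : ∀ i, (m i : K) = n * r i := fun i => by
        have := hm i
        simp only [Algebra.smul_def, eq_intCast] at this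
        exact_mod_cast congrArg (Rat.cast : ℚ → K) this
      have key : (n : K) * z = m 0 + m 1 * (A : K) + m 2 * B + m 3 * (A * B) := by
        rw [hm', hm', hm', hm', ← hr]
        simp only [Fin.sum_univ_four, Algebra.smul_def, eq_ratCast]
        simp only [Matrix.cons_val]
        ring
      apply RingOfIntegers.ext
      simp only [map_add, map_mul, map_intCast]
      exact key
    rw [this]
    exact add_mem (add_mem (add_mem (intCast_mem _ _) (mul_mem (intCast_mem _ _) hA))
      (mul_mem (intCast_mem _ _) hB)) (mul_mem (intCast_mem _ _) (mul_mem hA hB))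
  choose n hn0 hn using hz
  let b := RingOfIntegers.basis K
  refine ⟨∏ i, n (b i), Finset.prod_ne_zero_iff.2 fun i _ => hn0 _, fun z => ?_⟩
  rw [← b.sum_repr z, Finset.mul_sum]
  refine sum_mem fun i _ => ?_
  rw [zsmul_eq_mul, ← Finset.mul_prod_erase _ _ (Finset.mem_univ i)]
  rw [Int.cast_mul]
  have : ∀ u v w t : 𝓞 K, u * v * (w * t) = v * w * (u * t) := fun u v w t => by ring
  rw [this]
  exact mul_mem (mul_mem (intCast_mem _ _) (intCast_mem _ _)) (hn _)

theorem exists_absNorm_eq_of_adjoin {K : Type*} [Field K] [NumberField K] {A B : 𝓞 K} {x y : ℤ}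
    (hA : A ^ 2 = x) (hB : B ^ 2 = y) {N : ℤ}
    (hN : ∀ z : 𝓞 K, (N : 𝓞 K) * z ∈ Algebra.adjoin ℤ {A, B}) {q : ℕ} [Fact q.Prime]
    (hqN : ¬ (q : ℤ) ∣ N) (hx : IsSquare (x : ZMod q)) (hy : IsSquare (y : ZMod q)) :
    ∃ I : nonZeroDivisors (Ideal (𝓞 K)), Ideal.absNorm (I : Ideal (𝓞 K)) = q := by
  have hq : q.Prime := Fact.out
  have hne : Ideal.span {(q : 𝓞 K)} ≠ ⊤ := by
    rw [Ne, ← Ideal.absNorm_eq_one_iff, Ideal.absNorm_span_natCast]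
    exact (one_lt_pow₀ hq.one_lt Module.finrank_pos.ne').ne'
  obtain ⟨Q, hQ, hle⟩ := Ideal.exists_le_maximal _ hne
  have hqQ : (q : 𝓞 K) ∈ Q := hle (Ideal.mem_span_singleton_self _)
  have hQ0 : Q ≠ ⊥ := by
    rintro rfl
    exact hq.ne_zero (by exact_mod_cast (Ideal.mem_bot.1 hqQ))
  refine ⟨⟨Q, mem_nonZeroDivisors_of_ne_zero hQ0⟩, ?_⟩
  let := Ideal.Quotient.field Q
  have hchar : CharP (𝓞 K ⧸ Q) q := by
    refine (CharP.charP_iff_prime_eq_zero hq).2 ?_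
    rw [← map_natCast (Ideal.Quotient.mk Q)]
    exact Ideal.Quotient.eq_zero_iff_mem.2 hqQ
  let φ := ZMod.castHom (dvd_refl q) (𝓞 K ⧸ Q)
  let π := Ideal.Quotient.mk Q
  have hint : ∀ n : ℤ, π n ∈ φ.range := fun n => by rw [map_intCast]; exact intCast_mem _ n
  have hroot : ∀ (C : 𝓞 K) (w : ℤ), C ^ 2 = w → IsSquare (w : ZMod q) → π C ∈ φ.range := by
    rintro C w hC ⟨r, hr⟩
    have h : π C ^ 2 = φ r ^ 2 := by
      rw [← map_pow, hC, map_intCast, ← map_pow, sq r, ← hr, map_intCast]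
    rcases sq_eq_sq_iff_eq_or_eq_neg.1 h with h | h
    · exact ⟨r, h.symm⟩
    · exact ⟨-r, by rw [map_neg, h]⟩
  have hadj : ∀ z ∈ Algebra.adjoin ℤ {A, B}, π z ∈ φ.range := by
    intro z hz
    induction hz using Algebra.adjoin_induction with
    | mem z hz =>
      rcases hz with rfl | rfl
      · exact hroot _ _ hA hx
      · exact hroot _ _ hB hy
    | algebraMap n => exact hint n
    | add _ _ _ _ h h' => rw [map_add]; exact add_mem h h'
    | mul _ _ _ _ h h' => rw [map_mul]; exact mul_mem h h'
  have hsurj : Function.Surjective φ := by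
    intro w
    obtain ⟨z, rfl⟩ := Ideal.Quotient.mk_surjective w
    obtain ⟨r, hr⟩ := hadj _ (hN z)
    have hN0 : (N : ZMod q) ≠ 0 := by rwa [Ne, ZMod.intCast_zmod_eq_zero_iff_dvd]
    refine ⟨(N : ZMod q)⁻¹ * r, ?_⟩
    rw [map_mul, hr, map_mul, map_inv₀, map_intCast, map_intCast, inv_mul_cancel_left₀]
    rw [← map_intCast φ]
    exact (map_ne_zero φ).2 hN0
  rw [Ideal.absNorm_apply, Submodule.cardQuot_apply]
  exact (Nat.card_congr (Equiv.ofBijective φ ⟨φ.injective, hsurj⟩)).symm.trans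
    (Nat.card_zmod q)

end

theorem isSquare_neg_of_legendreSym_eq {q : ℕ} [Fact q.Prime] (hq : q % 4 = 1) {x : ℕ}
    (hxsq : Squarefree x) {S : Finset ℕ} (hS : Even (x.primeFactors ∩ S).card)
    (h : ∀ p ∈ x.primeFactors, legendreSym q p = if p ∈ S then -1 else 1) :
    IsSquare ((-x : ℤ) : ZMod q) := by
  have hprod : legendreSym q x = ∏ p ∈ x.primeFactors, legendreSym q p := by
    conv_lhs => rw [← Nat.prod_primeFactors_of_squarefree hxsq, Nat.cast_prod]
    exact map_prod (legendreSym.hom q) _ _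
  have hone : legendreSym q x = 1 := by
    rw [hprod, Finset.prod_congr rfl h, Finset.prod_ite, Finset.prod_const, Finset.prod_const_one,
      mul_one, Finset.filter_mem_eq_inter, hS.neg_one_pow]
  have hx0 : ((x : ℤ) : ZMod q) ≠ 0 := fun h0 => by
    rw [(legendreSym.eq_zero_iff q _).2 h0] at hone
    exact zero_ne_one hone
  have hneg : IsSquare (-1 : ZMod q) := ZMod.exists_sq_eq_neg_one_iff.2 (by omega)
  rw [← neg_one_mul]
  push_cast
  exact hneg.mul (by simpa using (legendreSym.eq_one_iff q hx0).1 hone)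

theorem not_dvd_and_dvd_of_squarefree_of_mul_eq_mul_sq {x y d m p : ℕ} (hp : p.Prime)
    (hx : Squarefree x)
    (hy : Squarefree y) (hd : Squarefree d) (h : x * y = d * m ^ 2) (hpd : p ∣ d) :
    ¬ (p ∣ x ∧ p ∣ y) := by
  rintro ⟨⟨x, rfl⟩, ⟨y, rfl⟩⟩
  obtain ⟨d, rfl⟩ := hpd
  have key : ∀ z, Squarefree (p * z) → ¬ p ∣ z := fun z hz hpz =>
    hp.one_lt.ne' (Nat.isUnit_iff.1 (hz p (mul_dvd_mul_left p hpz)))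
  have h1 : p * (x * y) = d * m ^ 2 := by
    refine Nat.eq_of_mul_eq_mul_left hp.pos ?_
    linear_combination h
  have hpm : p ∣ m := hp.dvd_of_dvd_pow
    ((hp.dvd_mul.1 (Dvd.intro _ h1)).resolve_left (key d hd))
  obtain ⟨m, rfl⟩ := hpm
  have h2 : x * y = p * (d * m ^ 2) := by
    refine Nat.eq_of_mul_eq_mul_left hp.pos ?_
    linear_combination h1
  rcases hp.dvd_mul.1 (Dvd.intro _ h2.symm) with h3 | h3
  · exact key x hx h3
  · exact key y hy h3

/-- A two-coloured set with at least four elements contains two monochromatic pairs, each with an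
element outside the other. -/
theorem exists_pairs_of_four_le_card {ι : Type*} (s : Finset ι) (hs : 4 ≤ s.card)
    (P : ι → Prop) : ∃ a ∈ s, ∃ b ∈ s, ∃ c ∈ s, ∃ e ∈ s, (P a ↔ P b) ∧ (P c ↔ P e) ∧
      a ≠ b ∧ c ≠ e ∧ a ≠ c ∧ a ≠ e ∧ c ≠ b := by
  classical
  have three : ∀ t ⊆ s, (∀ a ∈ t, ∀ b ∈ t, (P a ↔ P b)) → 2 < t.card →
      ∃ a ∈ s, ∃ b ∈ s, ∃ c ∈ s, ∃ e ∈ s, (P a ↔ P b) ∧ (P c ↔ P e) ∧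
      a ≠ b ∧ c ≠ e ∧ a ≠ c ∧ a ≠ e ∧ c ≠ b := by
    intro t hts hP ht
    obtain ⟨a, b, c, ha, hb, hc, hab, hac, hbc⟩ := Finset.two_lt_card_iff.1 ht
    exact ⟨a, hts ha, b, hts hb, c, hts hc, b, hts hb, hP a ha b hb, hP c hc b hb, hab, hbc.symm,
      hac, hab, hbc.symm⟩
  have hcard := s.card_filter_add_card_filter_not P
  by_cases h1 : 2 < (s.filter P).card
  · exact three _ (Finset.filter_subset _ _) (by simp +contextual) h1
  by_cases h2 : 2 < (s.filter fun a => ¬ P a).card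
  · exact three _ (Finset.filter_subset _ _) (by simp +contextual) h2
  obtain ⟨a, ha, b, hb, hab⟩ := Finset.one_lt_card.1 (show 1 < (s.filter P).card by omega)
  obtain ⟨c, hc, e, he, hce⟩ :=
    Finset.one_lt_card.1 (show 1 < (s.filter fun a => ¬ P a).card by omega)
  rw [Finset.mem_filter] at ha hb hc he
  refine ⟨a, ha.1, b, hb.1, c, hc.1, e, he.1, iff_of_true ha.2 hb.2, iff_of_false hc.2 he.2, hab,
    hce, ?_, ?_, ?_⟩
  · rintro rfl; exact hc.2 ha.2
  · rintro rfl; exact he.2 ha.2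
  · rintro rfl; exact hc.2 hb.2

theorem even_card_inter_pair {s : Finset ℕ} {a b : ℕ} (hab : a ≠ b) (h : a ∈ s ↔ b ∈ s) :
    Even (s ∩ {a, b}).card := by
  by_cases ha : a ∈ s
  · rw [Finset.inter_eq_right.2 (by simp [Finset.insert_subset_iff, ha, ← h]),
      Finset.card_pair hab]
    exact even_two
  · rw [Finset.disjoint_iff_inter_eq_empty.1 (by simp [ha, ← h])]
    exact Even.zero


/-- Let `K = ℚ(√(-x), √(-y))` be an imaginary bicyclic biquadratic field, `x, y`
square-free positive integers, and let `d` be the square-free part of `x * y`. If `d`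
has at least four distinct prime factors, then the class number of `K` is not `6`. -/
theorem classNumber_ne_six_of_four_primes (x y d : ℕ) (hx : 0 < x) (hy : 0 < y)
    (hxsq : Squarefree x) (hysq : Squarefree y)
    (hdsq : Squarefree d) (hd : ∃ m : ℕ, 0 < m ∧ x * y = d * m ^ 2)
    (hfac : 4 ≤ d.primeFactors.card)
    (K : Type) [Field K] [NumberField K] (hdeg : Module.finrank ℚ K = 4)
    (hgen : ∃ α β : K, α ^ 2 = -(x : K) ∧ β ^ 2 = -(y : K)) :
    NumberField.classNumber K ≠ 6 := by
  obtain ⟨m, hm, hxy⟩ := hd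
  obtain ⟨α, β, hα, hβ⟩ := hgen
  have hxy0 : x * y ≠ 0 := (Nat.mul_pos hx hy).ne'
  have hdvd : d ∣ x * y := Dvd.intro _ hxy.symm
  have hdiv : ∀ p ∈ d.primeFactors, p ∣ y ↔ ¬ p ∣ x := by
    intro p hp
    have hpp := Nat.prime_of_mem_primeFactors hp
    have hpd := Nat.dvd_of_mem_primeFactors hp
    have h1 := not_dvd_and_dvd_of_squarefree_of_mul_eq_mul_sq hpp hxsq hysq hdsq hxy hpd
    have h2 := hpp.dvd_mul.1 (hpd.trans hdvd)
    tauto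
  have hnsq : ¬ IsSquare ((x * y : ℕ) : ℚ) := by
    intro h
    rw [Rat.isSquare_natCast_iff] at h
    obtain ⟨r, hr⟩ := h
    obtain ⟨k, rfl⟩ : m ∣ r := by
      refine (Nat.pow_dvd_pow_iff two_ne_zero).1 ?_
      rw [sq r, ← hr, hxy]
      exact dvd_mul_left _ _
    have hdk : d = k * k := by
      refine Nat.eq_of_mul_eq_mul_right (pow_pos hm 2) ?_
      rw [← hxy, hr]
      ring
    have hk1 : k = 1 := Nat.isUnit_iff.1 (hdsq k hdk.symm.dvd)
    rw [hdk, hk1] at hfac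
    simp at hfac
  obtain ⟨A, rfl⟩ : ∃ A : NumberField.RingOfIntegers K, (A : K) = α :=
    ⟨⟨α, IsIntegral.of_pow two_pos (by rw [hα]; exact (map_natCast (algebraMap ℤ K) x ▸ isIntegral_algebraMap).neg)⟩, rfl⟩
  obtain ⟨B, rfl⟩ : ∃ B : NumberField.RingOfIntegers K, (B : K) = β :=
    ⟨⟨β, IsIntegral.of_pow two_pos (by rw [hβ]; exact (map_natCast (algebraMap ℤ K) y ▸ isIntegral_algebraMap).neg)⟩, rfl⟩
  have hA : A ^ 2 = ((-x : ℤ) : NumberField.RingOfIntegers K) :=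
    NumberField.RingOfIntegers.ext (by simpa using hα)
  have hB : B ^ 2 = ((-y : ℤ) : NumberField.RingOfIntegers K) :=
    NumberField.RingOfIntegers.ext (by simpa using hβ)
  obtain ⟨N, hN0, hN⟩ := exists_int_mul_eq_of_sq_eq_neg hdeg
    (linearIndependent_of_sq_eq_neg hx hy hnsq hα hβ)
  have hpair : ∀ a ∈ d.primeFactors, ∀ b ∈ d.primeFactors, a ≠ b → (a ∣ x ↔ b ∣ x) →
      ∃ (q : ℕ) (I : nonZeroDivisors (Ideal (NumberField.RingOfIntegers K))),
        Ideal.absNorm (I : Ideal (NumberField.RingOfIntegers K)) = q ∧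
        ∀ p ∈ d.primeFactors, p ≠ 2 → ∀ _ : Fact p.Prime,
          legendreSym p q = if p ∈ ({a, b} : Finset ℕ) then -1 else 1 := by
    intro a ha b hb hab habx
    have haby : a ∣ y ↔ b ∣ y := by rw [hdiv a ha, hdiv b hb, habx]
    obtain ⟨q, hq, hqF, hq4, hqS⟩ := exists_prime_gt_and_legendreSym_eq (x * y) {a, b} N.natAbs
    have hap := Nat.prime_of_mem_primeFactors ha
    have hbp := Nat.prime_of_mem_primeFactors hb
    have hxS := isSquare_neg_of_legendreSym_eq hq4 hxsq
      (even_card_inter_pair hab (by simp [hap, hbp, habx, hx.ne'])) fun p hp =>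
      hqS p (Nat.primeFactors_mono (dvd_mul_right x y) hxy0 hp)
    have hyS := isSquare_neg_of_legendreSym_eq hq4 hysq
      (even_card_inter_pair hab (by simp [hap, hbp, haby, hy.ne'])) fun p hp =>
      hqS p (Nat.primeFactors_mono (dvd_mul_left y x) hxy0 hp)
    obtain ⟨I, hI⟩ := exists_absNorm_eq_of_adjoin hA hB hN (q := q)
      (fun h => absurd (Nat.le_of_dvd (Int.natAbs_pos.2 hN0) (Int.natCast_dvd.1 h)) hq.not_ge)
      hxS hyS
    refine ⟨q, I, hI, fun p hp hp2 hpF => ?_⟩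
    exact (legendreSym.quadratic_reciprocity_one_mod_four hq4 hp2).trans
      (hqS p (Nat.primeFactors_mono hdvd hxy0 hp))
  have hsquare : ∀ I : nonZeroDivisors (Ideal (NumberField.RingOfIntegers K)),
      IsSquare (ClassGroup.mk0 I) → ∀ p ∈ d.primeFactors, ∀ _ : Fact p.Prime,
      legendreSym p (Ideal.absNorm (I : Ideal (NumberField.RingOfIntegers K)) : ℕ) ≠ -1 := by
    intro I hI p hp hpF
    rw [Ne, legendreSym.eq_neg_one_iff, not_not, Int.cast_natCast]
    by_cases hpx : p ∣ x
    · obtain ⟨u, v, h⟩ := exists_absNorm_eq_of_mk0_isSquare hx hα I hI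
      exact isSquare_of_eq_sq_add_mul_sq hpx hxsq h
    · obtain ⟨u, v, h⟩ := exists_absNorm_eq_of_mk0_isSquare hy hβ I hI
      exact isSquare_of_eq_sq_add_mul_sq ((hdiv p hp).2 hpx) hysq h
  obtain ⟨a, ha, b, hb, c, hc, e, he, hab, hce, hab', hce', hac, hae, hcb⟩ :=
    exists_pairs_of_four_le_card d.primeFactors hfac (· ∣ x)
  obtain ⟨q, I, hI, hqI⟩ := hpair a ha b hb hab' hab
  obtain ⟨r, J, hJ, hrJ⟩ := hpair c hc e he hce' hce
  intro h6
  have hfact : ∀ p ∈ d.primeFactors, Fact p.Prime := fun p hp =>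
    ⟨Nat.prime_of_mem_primeFactors hp⟩
  have odd_or : ∀ u w : ℕ, u ≠ w → u ≠ 2 ∨ w ≠ 2 := by omega
  rcases isSquare_or_isSquare_or_isSquare_mul_of_card_eq_six
    (G := ClassGroup (NumberField.RingOfIntegers K))
    (by rw [Nat.card_eq_fintype_card]; exact h6) (ClassGroup.mk0 I) (ClassGroup.mk0 J)
    with h | h | h
  · have h := hsquare I h
    rw [hI] at h
    rcases odd_or a b hab' with h2 | h2
    · exact h a ha (hfact a ha) (by simp [hqI a ha h2 (hfact a ha)])
    · exact h b hb (hfact b hb) (by simp [hqI b hb h2 (hfact b hb)])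
  · have h := hsquare J h
    rw [hJ] at h
    rcases odd_or c e hce' with h2 | h2
    · exact h c hc (hfact c hc) (by simp [hrJ c hc h2 (hfact c hc)])
    · exact h e he (hfact e he) (by simp [hrJ e he h2 (hfact e he)])
  · rw [← map_mul] at h
    have h := hsquare (I * J) h
    rw [Submonoid.coe_mul, map_mul, hI, hJ, Nat.cast_mul] at h
    rcases odd_or a c hac with h2 | h2
    · have := hfact a ha
      exact h a ha this (by simp [legendreSym.mul, hqI a ha h2, hrJ a ha h2, hac, hae])
    · have := hfact c hc
      exact h c hc this (by simp [legendreSym.mul, hqI c hc h2, hrJ c hc h2, hac.symm, hcb])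
end

section
/- Let p and q be distinct primes both congruent to 3 mod 4. Then 4 divides the class number of the imaginary quadratic field ℚ(√(-pq)). -/
/-- A finite group containing two distinct commuting involutions has order divisible by `4`. -/
theorem four_dvd_card_of_sq_eq_one {G : Type*} [CommGroup G] {a b : G}
    (ha : a ^ 2 = 1) (hb : b ^ 2 = 1) (ha1 : a ≠ 1) (hb1 : b ≠ 1) (hab : a * b ≠ 1) :
    4 ∣ Nat.card G := by
  have hoa : orderOf a = 2 := orderOf_eq_prime ha ha1
  have hbn : b ∉ Subgroup.zpowers a := by
    rintro ⟨k, rfl⟩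
    rcases Int.even_or_odd' k with ⟨c, rfl | rfl⟩
    · apply hb1
      have : a ^ (2 : ℤ) = 1 := by exact_mod_cast ha
      simp [zpow_mul, this]
    · apply hab
      have : a ^ (2 : ℤ) = 1 := by exact_mod_cast ha
      simp [zpow_add, zpow_mul, this, ← sq, ha]
  have hob : orderOf (b : G ⧸ Subgroup.zpowers a) = 2 :=
    orderOf_eq_prime (by rw [← QuotientGroup.mk_pow, hb, QuotientGroup.mk_one])
      (by rwa [Ne, QuotientGroup.eq_one_iff])
  rw [Subgroup.card_eq_card_quotient_mul_card_subgroup (Subgroup.zpowers a), Nat.card_zpowers, hoa]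
  exact Nat.mul_dvd_mul (hob ▸ orderOf_dvd_natCard _) dvd_rfl

/-- If `n` is squarefree and `n w ^ 2` is an integer, then so is the rational number `w`. -/
theorem exists_intCast_eq_of_squarefree_mul_sq {n : ℤ} (hn : Squarefree n) {w : ℚ} {k : ℤ}
    (h : (n : ℚ) * w ^ 2 = k) : ∃ t : ℤ, (t : ℚ) = w := by
  have hn0 : (n : ℚ) ≠ 0 := by exact_mod_cast hn.ne_zero
  have hint : IsIntegral ℤ ((n : ℚ) * w) := by
    refine IsIntegral.of_pow (n := 2) two_pos ?_
    have : ((n : ℚ) * w) ^ 2 = ((n * k : ℤ) : ℚ) := by push_cast; rw [← h]; ring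
    rw [this]
    exact isIntegral_algebraMap (R := ℤ) (x := n * k)
  obtain ⟨z, hz⟩ := IsIntegrallyClosed.isIntegral_iff.mp hint
  replace hz : (z : ℚ) = n * w := by simpa using hz
  have hz2 : z ^ 2 = n * k := by
    have : (z : ℚ) ^ 2 = n * k := by rw [hz, ← h]; ring
    exact_mod_cast this
  obtain ⟨t, rfl⟩ := (hn.dvd_pow_iff_dvd two_ne_zero).mp (Dvd.intro k hz2.symm)
  refine ⟨t, mul_left_cancel₀ hn0 ?_⟩
  rw [← hz]; push_cast; rfl

section QuadraticField

variable {F : Type*} [Field F] [NumberField F]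

/-- Trace and norm in the quadratic field generated by a square root `α` of `d`. -/
theorem exists_trace_norm_of_sq_eq (hdeg : Module.finrank ℚ F = 2) {d : ℚ} (hd : ¬ IsSquare d)
    {α : F} (hα : α ^ 2 = algebraMap ℚ F d) (x : F) :
    ∃ u v : ℚ, Algebra.trace ℚ F x = 2 * u ∧ Algebra.norm ℚ x = u ^ 2 - d * v ^ 2 := by
  have hli : LinearIndependent ℚ ![(1 : F), α] := by
    rw [LinearIndependent.pair_iff' one_ne_zero]
    intro c hc
    apply hd
    refine ⟨c, (algebraMap ℚ F).injective ?_⟩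
    rw [← hα, ← hc, Algebra.smul_def, mul_one, sq, map_mul]
  let b := basisOfLinearIndependentOfCardEqFinrank hli (by simp [hdeg])
  have hb0 : b 0 = 1 := by simp [b]
  have hb1 : b 1 = α := by simp [b]
  have hx : x = algebraMap ℚ F (b.repr x 0) + algebraMap ℚ F (b.repr x 1) * α := by
    conv_lhs => rw [← b.sum_repr x]
    simp [Fin.sum_univ_two, hb0, hb1, Algebra.smul_def]
  generalize b.repr x 0 = u at hx
  generalize b.repr x 1 = v at hx
  have e0 : x * b 0 = u • b 0 + v • b 1 := by
    rw [hb0, hb1, hx]; simp [Algebra.smul_def]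
  have e1 : x * b 1 = (d * v) • b 0 + u • b 1 := by
    rw [hb0, hb1, hx]; simp only [Algebra.smul_def, map_mul, ← hα]; ring
  have hM : Algebra.leftMulMatrix b x = !![u, d * v; v, u] := by
    ext i j
    rw [Algebra.leftMulMatrix_eq_repr_mul]
    fin_cases i <;> fin_cases j <;> simp [e0, e1]
  refine ⟨u, v, ?_, ?_⟩
  · rw [Algebra.trace_eq_matrix_trace b, hM, Matrix.trace_fin_two_of]; ring
  · rw [Algebra.norm_eq_matrix_det b, hM, Matrix.det_fin_two_of]; ring

open NumberField

/-- For `n ≡ 1 mod 4` squarefree and positive, norms of integers of `ℚ(√-n)` are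
represented by `x ^ 2 + n y ^ 2`. -/
theorem exists_norm_eq_sq_add_mul_sq_s15 (hdeg : Module.finrank ℚ F = 2) {n : ℕ}
    (hn : Squarefree n) (hn4 : n % 4 = 1) {α : F} (hα : α ^ 2 = -(n : F)) (x : 𝓞 F) :
    ∃ u v : ℤ, Algebra.norm ℤ x = u ^ 2 + n * v ^ 2 := by
  have hd : ¬ IsSquare (-(n : ℚ)) := fun h ↦ by
    have : (0 : ℚ) < n := by exact_mod_cast hn.ne_zero.bot_lt
    linarith [h.nonneg]
  obtain ⟨u, v, ht, hN⟩ := exists_trace_norm_of_sq_eq hdeg hd (by simpa using hα) (x : F)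
  rw [← Algebra.coe_trace_int] at ht
  rw [← Algebra.coe_norm_int] at hN
  set s := Algebra.trace ℤ (𝓞 F) x
  set N := Algebra.norm ℤ x
  have hw : ((n : ℤ) : ℚ) * (2 * v) ^ 2 = ((4 * N - s ^ 2 : ℤ) : ℚ) := by
    push_cast; rw [hN, ht]; ring
  obtain ⟨t, ht'⟩ := exists_intCast_eq_of_squarefree_mul_sq (Int.squarefree_natCast.mpr hn) hw
  rw [← ht'] at hw
  have hst : (n : ℤ) * t ^ 2 = 4 * N - s ^ 2 := by exact_mod_cast hw
  obtain ⟨m, hm⟩ : ∃ m : ℤ, (n : ℤ) = 4 * m + 1 := ⟨n / 4, by omega⟩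
  rw [hm] at hst
  rcases Int.even_or_odd' s with ⟨a, ha | ha⟩ <;> rcases Int.even_or_odd' t with ⟨b, hb | hb⟩ <;>
    rw [ha, hb] at hst
  · refine ⟨a, b, ?_⟩
    rw [hm]; linarith
  all_goals
    ring_nf at hst
    omega

/-- If `I ^ 2 = (m)` for a principal ideal `I` in the ring of integers of `ℚ(√-n)`, then `m` is
represented by `x ^ 2 + n y ^ 2`. -/
theorem exists_eq_sq_add_mul_sq_of_isPrincipal (hdeg : Module.finrank ℚ F = 2) {n : ℕ}
    (hn : Squarefree n) (hn4 : n % 4 = 1) {α : F} (hα : α ^ 2 = -(n : F)) {I : Ideal (𝓞 F)}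
    {m : ℕ} (hI : I ^ 2 = Ideal.span {(m : 𝓞 F)}) (hp : I.IsPrincipal) :
    ∃ u v : ℤ, (m : ℤ) = u ^ 2 + n * v ^ 2 := by
  obtain ⟨x, hx⟩ := hp
  obtain ⟨u, v, huv⟩ := exists_norm_eq_sq_add_mul_sq_s15 hdeg hn hn4 hα x
  refine ⟨u, v, ?_⟩
  rw [← huv]
  have h := congrArg Ideal.absNorm hI
  have hm : Algebra.norm ℤ (m : 𝓞 F) = (m : ℤ) ^ 2 := by
    have := Algebra.norm_algebraMap (S := 𝓞 F) (m : ℤ)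
    rwa [RingOfIntegers.rank, hdeg, map_natCast] at this
  rw [map_pow, hx, ← Ideal.span, Ideal.absNorm_span_singleton, Ideal.absNorm_span_singleton,
    hm, Int.natAbs_pow, Int.natAbs_natCast] at h
  have h' := Nat.pow_left_injective two_ne_zero h
  have hnn : 0 ≤ Algebra.norm ℤ x := by rw [huv]; positivity
  omega

end QuadraticField

/-- The ideal `(2, 1 + a)` above `2` is ramified when `a ^ 2 = -n` with `n ≡ 1 mod 4`. -/
theorem span_pair_two_sq {R : Type*} [CommRing R] {a : R} {n : ℕ} (hn4 : n % 4 = 1)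
    (ha : a ^ 2 = -(n : R)) : Ideal.span {2, 1 + a} ^ 2 = Ideal.span {((2 : ℕ) : R)} := by
  obtain ⟨m, rfl⟩ : ∃ m, n = 4 * m + 1 := ⟨n / 4, by omega⟩
  push_cast at ha ⊢
  rw [sq, Ideal.span_pair_mul_span_pair]
  apply le_antisymm
  · rw [Ideal.span_le]
    rintro y (rfl | rfl | rfl | rfl) <;> rw [SetLike.mem_coe, Ideal.mem_span_singleton]
    · exact ⟨2, rfl⟩
    · exact ⟨1 + a, rfl⟩
    · exact ⟨1 + a, by ring⟩
    · exact ⟨a - 2 * m, by linear_combination ha⟩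
  · rw [Ideal.span_singleton_le_iff_mem]
    have h (y : R) (hy : y ∈ ({2 * 2, 2 * (1 + a), (1 + a) * 2, (1 + a) * (1 + a)} : Set R)) :=
      Ideal.subset_span hy
    have h1 := Ideal.mul_mem_left _ (-m : R) (h (2 * 2) (by simp))
    have h2 := h (2 * (1 + a)) (by simp)
    have h3 := h ((1 + a) * (1 + a)) (by simp)
    convert Ideal.add_mem _ (Ideal.sub_mem _ h2 h3) h1 using 1
    linear_combination ha

/-- The ideal `(p, a)` above `p` is ramified when `a ^ 2 = -p q` with `p`, `q` coprime. -/
theorem span_pair_natCast_sq {R : Type*} [CommRing R] {a : R} {p q : ℕ} (hpq : p.Coprime q)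
    (ha : a ^ 2 = -((p * q : ℕ) : R)) :
    Ideal.span {(p : R), a} ^ 2 = Ideal.span {(p : R)} := by
  push_cast at ha
  rw [sq, Ideal.span_pair_mul_span_pair]
  apply le_antisymm
  · rw [Ideal.span_le]
    rintro y (rfl | rfl | rfl | rfl) <;> rw [SetLike.mem_coe, Ideal.mem_span_singleton]
    · exact ⟨p, rfl⟩
    · exact ⟨a, rfl⟩
    · exact ⟨a, by ring⟩
    · exact ⟨-q, by linear_combination ha⟩
  · rw [Ideal.span_singleton_le_iff_mem]
    obtain ⟨c, d, hcd⟩ : IsCoprime (p : R) (q : R) := by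
      simpa using (Nat.isCoprime_iff_coprime.mpr hpq).map (Int.castRingHom R)
    have h1 : (p : R) * p ∈ Ideal.span {(p : R) * p, p * a, a * p, a * a} :=
      Ideal.subset_span (by simp)
    have h2 : a * a ∈ Ideal.span {(p : R) * p, p * a, a * p, a * a} :=
      Ideal.subset_span (by simp)
    convert Ideal.sub_mem _ (Ideal.mul_mem_left _ c h1) (Ideal.mul_mem_left _ d h2) using 1
    linear_combination (-p : R) * hcd + d * ha

/-- The form `x ^ 2 + n y ^ 2` represents no nonsquare `m` smaller than `n`. -/
theorem ne_sq_add_mul_sq {n m : ℕ} (hmn : m < n) (hm : ¬ IsSquare m) (u v : ℤ) :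
    (m : ℤ) ≠ u ^ 2 + n * v ^ 2 := by
  intro h
  have hv : v = 0 := by
    by_contra hv
    have : 0 < v ^ 2 := by positivity
    have hmn' : (m : ℤ) < n := by exact_mod_cast hmn
    nlinarith [sq_nonneg u]
  subst hv
  apply hm
  refine ⟨u.natAbs, ?_⟩
  zify
  rw [← sq, sq_abs]
  linarith

/-- If `p ≠ q` are primes both congruent to `3` mod `4`, then `4` divides the class
number of the imaginary quadratic field `ℚ(√(-p q))`. -/
theorem four_dvd_classNumber (p q : ℕ) (hp : p.Prime) (hq : q.Prime) (hpq : p ≠ q)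
    (hpmod : p % 4 = 3) (hqmod : q % 4 = 3)
    (F : Type) [Field F] [NumberField F] (hdeg : Module.finrank ℚ F = 2)
    (hgen : ∃ α : F, α ^ 2 = -((p : F) * q)) :
    4 ∣ NumberField.classNumber F := by
  obtain ⟨α, hα⟩ := hgen
  replace hα : α ^ 2 = -((p * q : ℕ) : F) := by rw [hα]; push_cast; rfl
  have hcop : p.Coprime q := (Nat.coprime_primes hp hq).mpr hpq
  have hsf : Squarefree (p * q) :=
    (Nat.squarefree_mul hcop).mpr ⟨hp.prime.squarefree, hq.prime.squarefree⟩
  have hmod : (p * q) % 4 = 1 := by rw [Nat.mul_mod, hpmod, hqmod]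
  have hint : IsIntegral ℤ α := by
    refine IsIntegral.of_pow (n := 2) two_pos ?_
    rw [hα]
    exact (isIntegral_natCast _).neg
  obtain ⟨a, rfl⟩ : ∃ a : NumberField.RingOfIntegers F, (a : F) = α := ⟨⟨α, hint⟩, rfl⟩
  have ha : a ^ 2 = -((p * q : ℕ) : NumberField.RingOfIntegers F) := by
    apply NumberField.RingOfIntegers.coe_injective
    simpa using hα
  set I : Ideal (NumberField.RingOfIntegers F) := Ideal.span {2, 1 + a}
  set J : Ideal (NumberField.RingOfIntegers F) := Ideal.span {(p : NumberField.RingOfIntegers F), a}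
  have hI : I ^ 2 = _ := span_pair_two_sq hmod ha
  have hJ : J ^ 2 = _ := span_pair_natCast_sq hcop ha
  have hIJ : (I * J) ^ 2 = Ideal.span {((2 * p : ℕ) : NumberField.RingOfIntegers F)} := by
    rw [mul_pow, hI, hJ, Ideal.span_singleton_mul_span_singleton, ← Nat.cast_mul]
  have mem_nonZeroDivisors {K : Ideal (NumberField.RingOfIntegers F)} {m : ℕ}
      (hK : K ^ 2 = Ideal.span {(m : NumberField.RingOfIntegers F)}) (hm : m ≠ 0) :
      K ∈ nonZeroDivisors (Ideal (NumberField.RingOfIntegers F)) := by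
    rw [mem_nonZeroDivisors_iff_ne_zero]
    rintro rfl
    rw [zero_pow two_ne_zero, eq_comm, Ideal.zero_eq_bot, Ideal.span_singleton_eq_bot] at hK
    exact hm (by exact_mod_cast hK)
  have hI0 := mem_nonZeroDivisors hI two_ne_zero
  have hJ0 := mem_nonZeroDivisors hJ hp.ne_zero
  have key {K : Ideal (NumberField.RingOfIntegers F)} {m : ℕ}
      (hK : K ^ 2 = Ideal.span {(m : NumberField.RingOfIntegers F)}) (hm : ¬ IsSquare m) (hlt : m < p * q) : ¬ K.IsPrincipal := fun h ↦ by
    obtain ⟨u, v, huv⟩ := exists_eq_sq_add_mul_sq_of_isPrincipal hdeg hsf hmod hα hK h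
    exact ne_sq_add_mul_sq hlt hm u v huv
  have h3p : 3 ≤ p := by omega
  have h3q : 3 ≤ q := by omega
  rw [NumberField.classNumber, ← Nat.card_eq_fintype_card]
  apply four_dvd_card_of_sq_eq_one (a := ClassGroup.mk0 ⟨I, hI0⟩) (b := ClassGroup.mk0 ⟨J, hJ0⟩)
  · rw [← map_pow, ClassGroup.mk0_eq_one_iff]
    exact ⟨_, hI⟩
  · rw [← map_pow, ClassGroup.mk0_eq_one_iff]
    exact ⟨_, hJ⟩
  · rw [Ne, ClassGroup.mk0_eq_one_iff]
    exact key hI Nat.prime_two.prime.not_isSquare (by nlinarith)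
  · rw [Ne, ClassGroup.mk0_eq_one_iff]
    exact key hJ hp.prime.not_isSquare (by nlinarith)
  · rw [← map_mul, Ne, ClassGroup.mk0_eq_one_iff]
    refine key hIJ ?_ (by nlinarith)
    rintro ⟨r, hr⟩
    have h2r : 2 ∣ r := by
      have : 2 ∣ r * r := ⟨p, hr.symm⟩
      simpa [Nat.prime_two.dvd_mul] using this
    obtain ⟨k, rfl⟩ := h2r
    have : p = 2 * (k * k) := by linarith
    omega
end
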